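/- arXiv:2507.16750 — 2 statements merged into one kernel-verified Lean document; each statement's English description precedes it below -/
import Mathlib

section
/- Let n ≥ 3 and s₀, s₁, s₂ ∈ ℝ. There exists a constant C > 0 such that the product estimate ‖fg‖_{H^{−s₀}(ℝⁿ)} ≤ C‖f‖_{H^{s₁}(ℝⁿ)}‖g‖_{H^{s₂}(ℝⁿ)} holds for all Schwartz functions f, g on ℝⁿ if and only if the following conditions hold: (1) s₀+s₁+s₂ ≥ n/2; (2) s₀+s₁ ≥ 0; (3) s₀+s₂ ≥ 0; (4) s₁+s₂ ≥ 0; and (5) if (1) is an equality, then the inequalities (2), (3), (4) are all strict. -/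
/-!
STATEMENT 0: Sobolev product estimate on ℝⁿ (n ≥ 3): the estimate
‖fg‖_{H^{−s₀}} ≤ C‖f‖_{H^{s₁}}‖g‖_{H^{s₂}} for all Schwartz f, g holds for some C > 0
iff the conditions (1)-(5) on (s₀, s₁, s₂) hold.
-/

open MeasureTheory
open scoped FourierTransform

noncomputable section

/-- The (inhomogeneous) Sobolev `H^s` norm of a function on `ℝⁿ`, defined via the
Fourier transform: `‖f‖_{H^s} = ‖⟨ξ⟩^s 𝓕f(ξ)‖_{L²}`, where `⟨ξ⟩² = 1 + |ξ|²`. -/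
def sobolevNorm (n : ℕ) (s : ℝ) (f : EuclideanSpace ℝ (Fin n) → ℂ) : ℝ :=
  (∫ ξ : EuclideanSpace ℝ (Fin n), (1 + ‖ξ‖ ^ 2) ^ s * ‖𝓕 f ξ‖ ^ 2) ^ (1 / 2 : ℝ)

namespace SobProd

open scoped ENNReal SchwartzMap

variable {n : ℕ}

/-- The Euclidean space. -/
abbrev E (n : ℕ) := EuclideanSpace ℝ (Fin n)

/-- The Bessel weight, extended nonnegative valued. -/
def J (s : ℝ) (x : E n) : ℝ≥0∞ := ENNReal.ofReal ((1 + ‖x‖ ^ 2) ^ s)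

/-- Squared weighted norm. -/
def Nsq (s : ℝ) (F : E n → ℝ≥0∞) : ℝ≥0∞ := ∫⁻ x, J s x * F x ^ 2

lemma measurable_J (s : ℝ) : Measurable (J s : E n → ℝ≥0∞) := by
  unfold J; fun_prop

lemma integrable_weight (s : ℝ) (F : 𝓢(E n, ℂ)) :
    Integrable (fun ξ => (1 + ‖ξ‖ ^ 2) ^ s * ‖F ξ‖ ^ 2) := by
  have hg : (fun (x : E n) ↦ (1 + ‖x‖ ^ 2) ^ s).HasTemperateGrowth :=
    Function.hasTemperateGrowth_one_add_norm_sq_rpow (E n) s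
  let H := SchwartzMap.pairing (ContinuousLinearMap.mul ℝ ℂ)
    (SchwartzMap.smulLeftCLM ℂ (fun (x : E n) ↦ (1 + ‖x‖ ^ 2) ^ s) F) F
  have := H.integrable (μ := volume)
  refine this.norm.congr (.of_forall fun x => ?_)
  have hp : 0 ≤ (1 + ‖x‖ ^ 2) ^ s := by positivity
  have h1 : H x = (((1 + ‖x‖ ^ 2) ^ s : ℝ) • F x) * F x := by
    simp only [H, SchwartzMap.pairing_apply_apply, ContinuousLinearMap.mul_apply',
      SchwartzMap.smulLeftCLM_apply_apply hg]
  show ‖H x‖ = _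
  rw [h1, norm_mul, norm_smul, Real.norm_of_nonneg hp]
  ring

lemma ofReal_integral (s : ℝ) (F : 𝓢(E n, ℂ)) :
    ENNReal.ofReal (∫ ξ, (1 + ‖ξ‖ ^ 2) ^ s * ‖F ξ‖ ^ 2) = Nsq s (fun x => ‖F x‖ₑ) := by
  rw [ofReal_integral_eq_lintegral_ofReal (integrable_weight s F)
    (.of_forall fun x => by positivity)]
  unfold Nsq J
  refine lintegral_congr fun x => ?_
  simp only []
  rw [ENNReal.ofReal_mul (by positivity), ← ofReal_norm, ENNReal.ofReal_pow (by positivity)]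

lemma sob_sq (s : ℝ) (f : 𝓢(E n, ℂ)) :
    ENNReal.ofReal (sobolevNorm n s f ^ 2) = Nsq s (fun x => ‖𝓕 f x‖ₑ) := by
  rw [← ofReal_integral, sobolevNorm, ← Real.rpow_natCast, ← Real.rpow_mul]
  · simp [SchwartzMap.fourier_coe]
  · exact integral_nonneg fun x => by positivity

lemma sob_nonneg (s : ℝ) (f : E n → ℂ) : 0 ≤ sobolevNorm n s f := by
  unfold sobolevNorm
  exact Real.rpow_nonneg (integral_nonneg fun x => by positivity) _

/-- Product of Schwartz functions. -/
def sm (f g : 𝓢(E n, ℂ)) : 𝓢(E n, ℂ) := SchwartzMap.pairing (ContinuousLinearMap.mul ℂ ℂ) f g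

lemma coe_sm (f g : 𝓢(E n, ℂ)) : ⇑(sm f g) = fun x => f x * g x := by
  ext x; simp [sm]

lemma fourier_sm (f g : 𝓢(E n, ℂ)) (ξ : E n) :
    𝓕 (sm f g) ξ = ∫ η, 𝓕 f η * 𝓕 g (ξ - η) := by
  have h := SchwartzMap.convolution_apply (ContinuousLinearMap.mul ℂ ℂ) (𝓕 f) (𝓕 g) ξ
  rw [MeasureTheory.convolution_def] at h
  simp only [ContinuousLinearMap.mul_apply'] at h
  rw [← h]
  have h1 : SchwartzMap.convolution (ContinuousLinearMap.mul ℂ ℂ) (𝓕 f) (𝓕 g)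
      = 𝓕⁻ (sm (𝓕 (𝓕 f)) (𝓕 (𝓕 g))) := rfl
  have key : ∀ (u : 𝓢(E n, ℂ)) (x : E n), 𝓕 (𝓕 u) x = u (-x) := by
    intro u x
    have h2 : 𝓕⁻ (𝓕 u) (-x) = u (-x) := by simp
    rw [← h2, SchwartzMap.fourierInv_coe, Real.fourierInv_eq_fourier_neg, neg_neg,
      SchwartzMap.fourier_coe]
  rw [h1, SchwartzMap.fourierInv_coe, Real.fourierInv_eq_fourier_comp_neg, SchwartzMap.fourier_coe]
  have h2 : (fun x => (sm (𝓕 (𝓕 f)) (𝓕 (𝓕 g))) (-x)) = ⇑(sm f g) := by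
    funext x
    simp [coe_sm, key]
  rw [h2]

end SobProd

namespace SobProd

open scoped ENNReal SchwartzMap

variable {n : ℕ}

lemma J_mul (a b : ℝ) (x : E n) : J a x * J b x = J (a + b) x := by
  unfold J
  rw [← ENNReal.ofReal_mul (by positivity), ← Real.rpow_add (by positivity)]

lemma J_zero (x : E n) : J 0 x = 1 := by simp [J]

lemma J_ne_top (a : ℝ) (x : E n) : J a x ≠ ∞ := ENNReal.ofReal_ne_top

lemma J_half_sq (a : ℝ) (x : E n) : J (a / 2) x ^ 2 = J a x := by
  rw [pow_two, J_mul]; congr 1; ring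

lemma J_neg_mul (a : ℝ) (x : E n) : J (-a) x * J a x = 1 := by
  rw [J_mul]; simp [J_zero]

lemma rpow_comp {u v : ℝ} (s : ℝ) {K : ℝ} (hK : 0 < K) (hu : 0 < u) (hv : 0 < v) (h1 : u ≤ K * v)
    (h2 : v ≤ K * u) : u ^ s ≤ K ^ |s| * v ^ s := by
  rcases le_total 0 s with hs | hs
  · rw [abs_of_nonneg hs, ← Real.mul_rpow hK.le hv.le]
    exact Real.rpow_le_rpow hu.le h1 hs
  · rw [abs_of_nonpos hs]
    have h3 : v / K ≤ u := by rw [div_le_iff₀ hK]; linarith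
    have := Real.rpow_le_rpow_of_nonpos (by positivity) h3 hs
    rwa [Real.div_rpow hv.le hK.le, div_eq_inv_mul, ← Real.rpow_neg hK.le] at this

lemma J_comp (s : ℝ) (x y : E n) (h1 : ‖x‖ ≤ 2 * ‖y‖) (h2 : ‖y‖ ≤ 2 * ‖x‖) :
    J s x ≤ ENNReal.ofReal (4 ^ |s|) * J s y := by
  unfold J
  rw [← ENNReal.ofReal_mul (by positivity)]
  apply ENNReal.ofReal_le_ofReal
  have := norm_nonneg x
  have := norm_nonneg y
  apply rpow_comp s (by norm_num) (by positivity) (by positivity) <;> nlinarith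

lemma cs (f g : E n → ℝ≥0∞) (hf : AEMeasurable f) (hg : AEMeasurable g) :
    (∫⁻ x, f x * g x) ^ 2 ≤ (∫⁻ x, f x ^ 2) * ∫⁻ x, g x ^ 2 := by
  have h := ENNReal.lintegral_mul_le_Lp_mul_Lq volume Real.HolderConjugate.two_two hf hg
  have h2 := pow_le_pow_left₀ (by positivity) h 2
  refine h2.trans_eq ?_
  rw [mul_pow]
  simp only [← ENNReal.rpow_natCast, ← ENNReal.rpow_mul]
  norm_num

lemma cs3 (a b c : ℝ≥0∞) : (a + b + c) ^ 2 ≤ 3 * (a ^ 2 + b ^ 2 + c ^ 2) := by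
  rcases eq_or_ne a ∞ with rfl | ha
  · simp
  rcases eq_or_ne b ∞ with rfl | hb
  · simp
  rcases eq_or_ne c ∞ with rfl | hc
  · simp
  lift a to NNReal using ha
  lift b to NNReal using hb
  lift c to NNReal using hc
  norm_cast
  rw [← NNReal.coe_le_coe]
  push_cast
  nlinarith [sq_nonneg ((a : ℝ) - b), sq_nonneg ((b : ℝ) - c), sq_nonneg ((a : ℝ) - c)]

lemma kernel_radial (hn : 3 ≤ n) {s a : ℝ} (ha : 0 < a) (has : a + s = n / 2) {R : ℝ} (hR : 0 ≤ R) :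
    ∫⁻ x : E n, (Metric.closedBall (0 : E n) R).indicator (J (-s)) x ≤
      ENNReal.ofReal (n * volume.real (Metric.ball (0 : E n) 1) * ((1 + R ^ 2) ^ a / (2 * a))) := by
  have : Nonempty (Fin n) := ⟨⟨0, by omega⟩⟩
  have : Nontrivial (E n) := by infer_instance
  have hcont : Continuous fun x : E n => (1 + ‖x‖ ^ 2) ^ (-s) := by
    refine Continuous.rpow_const (by fun_prop) fun x => Or.inl (by positivity)
  have hcont1 : ∀ b : ℝ, Continuous fun x : ℝ => (1 + x ^ 2) ^ b := by
    intro b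
    refine Continuous.rpow_const (by fun_prop) fun x => Or.inl (by positivity)
  rw [lintegral_indicator Metric.isClosed_closedBall.measurableSet]
  unfold J
  rw [← ofReal_integral_eq_lintegral_ofReal
    (hcont.continuousOn.integrableOn_compact (isCompact_closedBall _ _))
    (.of_forall fun x => by positivity)]
  apply ENNReal.ofReal_le_ofReal
  have e1 : ∫ x in Metric.closedBall (0 : E n) R, (1 + ‖x‖ ^ 2) ^ (-s) =
      ∫ x : E n, (fun r : ℝ => (Set.Iic R).indicator (fun r => (1 + r ^ 2) ^ (-s)) r) ‖x‖ := by
    rw [← integral_indicator Metric.isClosed_closedBall.measurableSet]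
    congr 1
    ext x
    simp [Set.indicator]
  rw [e1, integral_fun_norm_addHaar, finrank_euclideanSpace_fin, nsmul_eq_mul, smul_eq_mul,
    ← mul_assoc]
  gcongr
  have e2 : ∫ y in Set.Ioi (0 : ℝ), y ^ (n - 1) • (Set.Iic R).indicator (fun r => (1 + r ^ 2) ^ (-s)) y
      = ∫ y in Set.Ioc (0 : ℝ) R, y ^ (n - 1) * (1 + y ^ 2) ^ (-s) := by
    rw [← integral_indicator measurableSet_Ioi, ← integral_indicator measurableSet_Ioc]
    congr 1
    ext y
    by_cases h1 : 0 < y <;> by_cases h2 : y ≤ R <;> simp [Set.indicator, h1, h2]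
  rw [e2, ← intervalIntegral.integral_of_le hR]
  have hFTC : ∫ y in (0 : ℝ)..R, y * (1 + y ^ 2) ^ (a - 1) =
      (1 + R ^ 2) ^ a / (2 * a) - (1 + (0:ℝ) ^ 2) ^ a / (2 * a) := by
    refine intervalIntegral.integral_eq_sub_of_hasDerivAt
      (f := fun r : ℝ => (1 + r ^ 2) ^ a / (2 * a)) (fun x _ => ?_) ?_
    · have h1 : HasDerivAt (fun r : ℝ => 1 + r ^ 2) (2 * x) x := by
        simpa using (hasDerivAt_pow 2 x).const_add 1
      have h2 := (h1.rpow_const (p := a) (Or.inl (by positivity))).div_const (2 * a)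
      convert! h2 using 1
      field_simp
    · exact (continuous_id.mul (hcont1 _)).intervalIntegrable _ _
  calc ∫ y in (0 : ℝ)..R, y ^ (n - 1) * (1 + y ^ 2) ^ (-s)
      ≤ ∫ y in (0 : ℝ)..R, y * (1 + y ^ 2) ^ (a - 1) := by
        refine intervalIntegral.integral_mono_on hR
          (((continuous_pow _).mul (hcont1 _)).intervalIntegrable _ _)
          ((continuous_id.mul (hcont1 _)).intervalIntegrable _ _) fun y hy => ?_
        have hy0 : 0 ≤ y := hy.1
        have h3 : y ^ (n - 1) = y * y ^ (n - 2) := by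
          rw [← pow_succ']; congr 1; omega
        have h4 : y ^ (n - 2) ≤ (1 + y ^ 2) ^ ((n : ℝ) / 2 - 1) := by
          have : y ^ (n - 2) = (y ^ 2) ^ ((n : ℝ) / 2 - 1) := by
            rw [← Real.rpow_natCast, ← Real.rpow_natCast, ← Real.rpow_mul hy0]
            congr 1
            rw [Nat.cast_sub (by omega)]; push_cast; ring
          rw [this]
          have : (3 : ℝ) ≤ n := by exact_mod_cast hn
          exact Real.rpow_le_rpow (by positivity) (by linarith) (by linarith)
        have h5 : (1 + y ^ 2) ^ (a - 1) = (1 + y ^ 2) ^ ((n : ℝ) / 2 - 1) * (1 + y ^ 2) ^ (-s) := by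
          rw [← Real.rpow_add (by positivity)]; congr 1; linarith
        rw [h3, h5, mul_assoc]
        gcongr
    _ ≤ _ := by
        rw [hFTC]
        have : 0 ≤ (1 + (0:ℝ) ^ 2) ^ a / (2 * a) := by positivity
        linarith

lemma kernel (hn : 3 ≤ n) {s a : ℝ} (ha : 0 ≤ a) (has : a + s ≥ n / 2)
    (hne : a + s = n / 2 → 0 < a) :
    ∃ C : ℝ≥0∞, C ≠ ∞ ∧ ∀ y : E n,
      ∫⁻ x : E n, (Metric.closedBall (0 : E n) ‖y‖).indicator (J (-s)) x ≤ C * J a y := by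
  rcases has.lt_or_eq with h | h
  · refine ⟨∫⁻ x : E n, J (-(a + s)) x, ?_, fun y => ?_⟩
    · have := integrable_rpow_neg_one_add_norm_sq (E := E n) (μ := volume) (r := 2 * (a + s))
        (by rw [finrank_euclideanSpace_fin]; linarith)
      have h2 := this.lintegral_lt_top
      refine ne_of_lt (lt_of_eq_of_lt ?_ h2)
      unfold J
      refine lintegral_congr fun x => ?_
      congr 2; ring
    · rw [← lintegral_mul_const _ (measurable_J _)]
      refine lintegral_mono fun x => ?_
      by_cases hx : x ∈ Metric.closedBall (0 : E n) ‖y‖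
      · rw [Set.indicator_of_mem hx]
        have hx' : ‖x‖ ≤ ‖y‖ := by simpa using hx
        have h3 : J (-s) x = J (-(a + s)) x * J a x := by
          rw [J_mul]; congr 1; ring
        rw [h3]
        gcongr
        unfold J
        gcongr
      · rw [Set.indicator_of_notMem hx]; exact zero_le
  · have ha' := hne h.symm
    refine ⟨ENNReal.ofReal (n * volume.real (Metric.ball (0 : E n) 1) * (1 / (2 * a))),
      ENNReal.ofReal_ne_top, fun y => ?_⟩
    refine (kernel_radial hn ha' h.symm (norm_nonneg y)).trans_eq ?_
    unfold J
    rw [← ENNReal.ofReal_mul (by positivity)]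
    congr 1; ring

end SobProd

namespace SobProd

open scoped ENNReal SchwartzMap

variable {n : ℕ}

lemma region1 (a b : E n → ℝ≥0∞) (w : E n × E n → ℝ≥0∞) (ha : Measurable a) (hb : Measurable b)
    (hw : Measurable w) (C : ℝ≥0∞) (h : ∀ ξ, ∫⁻ η, w (ξ, η) ^ 2 ≤ C) :
    ∫⁻ ξ, (∫⁻ η, a η * b (ξ - η) * w (ξ, η)) ^ 2 ≤ C * (∫⁻ x, a x ^ 2) * ∫⁻ x, b x ^ 2 := by
  calc ∫⁻ ξ, (∫⁻ η, a η * b (ξ - η) * w (ξ, η)) ^ 2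
      ≤ ∫⁻ ξ, (∫⁻ η, a η ^ 2 * b (ξ - η) ^ 2) * C := by
        refine lintegral_mono fun ξ => ?_
        refine (cs (fun η => a η * b (ξ - η)) (fun η => w (ξ, η)) (by fun_prop)
          (by fun_prop)).trans ?_
        simp only [mul_pow]
        gcongr
        exact h ξ
    _ = (∫⁻ ξ, ∫⁻ η, a η ^ 2 * b (ξ - η) ^ 2) * C := by
        rw [lintegral_mul_const]
        exact Measurable.lintegral_prod_right' (f := fun p : E n × E n => a p.2 ^ 2 * b (p.1 - p.2) ^ 2)
          (by fun_prop)
    _ = (∫⁻ η, ∫⁻ ξ, a η ^ 2 * b (ξ - η) ^ 2) * C := by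
        rw [lintegral_lintegral_swap]
        exact Measurable.aemeasurable (by unfold Function.uncurry; fun_prop)
    _ = (∫⁻ η, a η ^ 2 * ∫⁻ x, b x ^ 2) * C := by
        congr 1
        refine lintegral_congr fun η => ?_
        rw [lintegral_const_mul _ (by fun_prop), lintegral_sub_right_eq_self (fun x => b x ^ 2)]
    _ = _ := by
        rw [lintegral_mul_const _ (by fun_prop)]; ring

lemma region2 (a b : E n → ℝ≥0∞) (w : E n × E n → ℝ≥0∞) (ha : Measurable a) (hb : Measurable b)
    (hw : Measurable w) (C : ℝ≥0∞) (h : ∀ η, ∫⁻ ξ, w (ξ, η) ^ 2 ≤ C) :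
    ∫⁻ ξ, (∫⁻ η, a η * b (ξ - η) * w (ξ, η)) ^ 2 ≤ C * (∫⁻ x, a x ^ 2) * ∫⁻ x, b x ^ 2 := by
  calc ∫⁻ ξ, (∫⁻ η, a η * b (ξ - η) * w (ξ, η)) ^ 2
      ≤ ∫⁻ ξ, (∫⁻ η, a η ^ 2 * w (ξ, η) ^ 2) * ∫⁻ x, b x ^ 2 := by
        refine lintegral_mono fun ξ => ?_
        have := cs (fun η => a η * w (ξ, η)) (fun η => b (ξ - η)) (by fun_prop) (by fun_prop)
        rw [lintegral_sub_left_eq_self (fun x => b x ^ 2)] at this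
        simp only [mul_pow] at this
        refine le_trans (le_of_eq ?_) this
        congr 2
        ext η
        ring
    _ = (∫⁻ ξ, ∫⁻ η, a η ^ 2 * w (ξ, η) ^ 2) * ∫⁻ x, b x ^ 2 := by
        rw [lintegral_mul_const]
        exact Measurable.lintegral_prod_right' (f := fun p : E n × E n => a p.2 ^ 2 * w p ^ 2)
          (by fun_prop)
    _ = (∫⁻ η, ∫⁻ ξ, a η ^ 2 * w (ξ, η) ^ 2) * ∫⁻ x, b x ^ 2 := by
        rw [lintegral_lintegral_swap]
        exact Measurable.aemeasurable (by unfold Function.uncurry; fun_prop)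
    _ ≤ (∫⁻ η, a η ^ 2 * C) * ∫⁻ x, b x ^ 2 := by
        gcongr with η
        rw [lintegral_const_mul _ (by fun_prop)]
        gcongr
        exact h η
    _ = _ := by
        rw [lintegral_mul_const _ (by fun_prop)]; ring

lemma suff (hn : 3 ≤ n) {s₀ s₁ s₂ : ℝ} (h : s₀ + s₁ + s₂ ≥ n / 2) (h01 : s₀ + s₁ ≥ 0)
    (h02 : s₀ + s₂ ≥ 0) (h12 : s₁ + s₂ ≥ 0)
    (h5 : s₀ + s₁ + s₂ = n / 2 → s₀ + s₁ > 0 ∧ s₀ + s₂ > 0 ∧ s₁ + s₂ > 0) :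
    ∃ C : ℝ≥0∞, C ≠ ∞ ∧ ∀ F G : E n → ℝ≥0∞, Measurable F → Measurable G →
      Nsq (-s₀) (fun ξ => ∫⁻ η, F η * G (ξ - η)) ≤ C * Nsq s₁ F * Nsq s₂ G := by
  obtain ⟨C0, hC0, k0⟩ := kernel hn (s := s₀) h12 (by linarith)
    (fun e => (h5 (by linarith)).2.2)
  obtain ⟨C1, hC1, k1⟩ := kernel hn (s := s₁) h02 (by linarith)
    (fun e => (h5 (by linarith)).2.1)
  obtain ⟨C2, hC2, k2⟩ := kernel hn (s := s₂) h01 (by linarith)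
    (fun e => (h5 (by linarith)).1)
  let W : E n × E n → ℝ≥0∞ := fun p => J (-s₀ / 2) p.1 * J (-s₁ / 2) p.2 * J (-s₂ / 2) (p.1 - p.2)
  have mJ : ∀ s, Measurable (J s : E n → ℝ≥0∞) := measurable_J
  have mW : Measurable W := by fun_prop
  have W2 : ∀ p, W p ^ 2 = J (-s₀) p.1 * J (-s₁) p.2 * J (-s₂) (p.1 - p.2) := by
    intro p; simp only [W, mul_pow, J_half_sq]
  let A0 : Set (E n × E n) := {p | ‖p.1‖ ≤ ‖p.2‖} ∩ {p | ‖p.1‖ ≤ ‖p.1 - p.2‖}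
  let A1 : Set (E n × E n) := {p | ‖p.2‖ ≤ ‖p.1‖} ∩ {p | ‖p.2‖ ≤ ‖p.1 - p.2‖}
  let A2 : Set (E n × E n) := {p | ‖p.1 - p.2‖ ≤ ‖p.1‖} ∩ {p | ‖p.1 - p.2‖ ≤ ‖p.2‖}
  have mA0 : MeasurableSet A0 := (measurableSet_le (by fun_prop) (by fun_prop)).inter
    (measurableSet_le (by fun_prop) (by fun_prop))
  have mA1 : MeasurableSet A1 := (measurableSet_le (by fun_prop) (by fun_prop)).inter
    (measurableSet_le (by fun_prop) (by fun_prop))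
  have mA2 : MeasurableSet A2 := (measurableSet_le (by fun_prop) (by fun_prop)).inter
    (measurableSet_le (by fun_prop) (by fun_prop))
  have hcov : ∀ p, W p ≤ A0.indicator W p + A1.indicator W p + A2.indicator W p := by
    intro p
    by_cases p0 : p ∈ A0
    · rw [Set.indicator_of_mem p0, add_assoc]; exact le_self_add
    by_cases p1 : p ∈ A1
    · rw [Set.indicator_of_mem p1, add_right_comm]; exact le_add_self
    have p2 : p ∈ A2 := by
      simp only [A0, A1, A2, Set.mem_inter_iff, Set.mem_ofPred_eq, not_and_or, not_le] at p0 p1 ⊢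
      rcases p0 with p0 | p0 <;> rcases p1 with p1 | p1 <;> constructor <;> linarith
    rw [Set.indicator_of_mem p2]; exact le_add_self
  set c1 : ℝ≥0∞ := ENNReal.ofReal (4 ^ |-s₁|) with hc1
  set c2 : ℝ≥0∞ := ENNReal.ofReal (4 ^ |-s₂|) with hc2
  have b0 : ∀ η, ∫⁻ ξ, A0.indicator W (ξ, η) ^ 2 ≤ c2 * C0 := by
    intro η
    calc ∫⁻ ξ, A0.indicator W (ξ, η) ^ 2
        ≤ ∫⁻ ξ, (c2 * J (-(s₁ + s₂)) η) * (Metric.closedBall (0 : E n) ‖η‖).indicator (J (-s₀)) ξ := by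
          refine lintegral_mono fun ξ => ?_
          by_cases hp : (ξ, η) ∈ A0
          · have hp' : ‖ξ‖ ≤ ‖η‖ ∧ ‖ξ‖ ≤ ‖ξ - η‖ := hp
            rw [Set.indicator_of_mem hp, W2, Set.indicator_of_mem (by simpa using hp'.1)]
            have h1 : ‖ξ - η‖ ≤ 2 * ‖η‖ := by linarith [norm_sub_le ξ η, hp'.1]
            have h2 : ‖η‖ ≤ 2 * ‖ξ - η‖ := by
              have := norm_sub_le ξ (ξ - η)
              rw [sub_sub_cancel] at this
              linarith [hp'.2]
            have h3 := J_comp (-s₂) (ξ - η) η h1 h2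
            have h4 : J (-(s₁ + s₂)) η = J (-s₁) η * J (-s₂) η := by rw [J_mul]; congr 1; ring
            rw [h4]
            calc _ ≤ J (-s₀) ξ * J (-s₁) η * (c2 * J (-s₂) η) := by gcongr
              _ = _ := by ring
          · rw [Set.indicator_of_notMem hp]; simp
      _ ≤ (c2 * J (-(s₁ + s₂)) η) * (C0 * J (s₁ + s₂) η) := by
          rw [lintegral_const_mul _ ((mJ _).indicator Metric.isClosed_closedBall.measurableSet)]
          gcongr
          exact k0 η
      _ = c2 * C0 * (J (-(s₁ + s₂)) η * J (s₁ + s₂) η) := by ring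
      _ = _ := by rw [J_neg_mul, mul_one]
  have b1 : ∀ ξ, ∫⁻ η, A1.indicator W (ξ, η) ^ 2 ≤ c2 * C1 := by
    intro ξ
    calc ∫⁻ η, A1.indicator W (ξ, η) ^ 2
        ≤ ∫⁻ η, (c2 * J (-(s₀ + s₂)) ξ) * (Metric.closedBall (0 : E n) ‖ξ‖).indicator (J (-s₁)) η := by
          refine lintegral_mono fun η => ?_
          by_cases hp : (ξ, η) ∈ A1
          · have hp' : ‖η‖ ≤ ‖ξ‖ ∧ ‖η‖ ≤ ‖ξ - η‖ := hp
            rw [Set.indicator_of_mem hp, W2, Set.indicator_of_mem (by simpa using hp'.1)]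
            have h1 : ‖ξ - η‖ ≤ 2 * ‖ξ‖ := by linarith [norm_sub_le ξ η, hp'.1]
            have h2 : ‖ξ‖ ≤ 2 * ‖ξ - η‖ := by
              have := norm_add_le (ξ - η) η
              rw [sub_add_cancel] at this
              linarith [hp'.2]
            have h3 := J_comp (-s₂) (ξ - η) ξ h1 h2
            have h4 : J (-(s₀ + s₂)) ξ = J (-s₀) ξ * J (-s₂) ξ := by rw [J_mul]; congr 1; ring
            rw [h4]
            calc _ ≤ J (-s₀) ξ * J (-s₁) η * (c2 * J (-s₂) ξ) := by gcongr
              _ = _ := by ring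
          · rw [Set.indicator_of_notMem hp]; simp
      _ ≤ (c2 * J (-(s₀ + s₂)) ξ) * (C1 * J (s₀ + s₂) ξ) := by
          rw [lintegral_const_mul _ ((mJ _).indicator Metric.isClosed_closedBall.measurableSet)]
          gcongr
          exact k1 ξ
      _ = c2 * C1 * (J (-(s₀ + s₂)) ξ * J (s₀ + s₂) ξ) := by ring
      _ = _ := by rw [J_neg_mul, mul_one]
  have b2 : ∀ ξ, ∫⁻ η, A2.indicator W (ξ, η) ^ 2 ≤ c1 * C2 := by
    intro ξ
    calc ∫⁻ η, A2.indicator W (ξ, η) ^ 2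
        ≤ ∫⁻ η, (c1 * J (-(s₀ + s₁)) ξ) *
            (Metric.closedBall (0 : E n) ‖ξ‖).indicator (J (-s₂)) (ξ - η) := by
          refine lintegral_mono fun η => ?_
          by_cases hp : (ξ, η) ∈ A2
          · have hp' : ‖ξ - η‖ ≤ ‖ξ‖ ∧ ‖ξ - η‖ ≤ ‖η‖ := hp
            rw [Set.indicator_of_mem hp, W2, Set.indicator_of_mem (by simpa using hp'.1)]
            have h1 : ‖η‖ ≤ 2 * ‖ξ‖ := by
              have := norm_sub_le ξ (ξ - η)
              rw [sub_sub_cancel] at this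
              linarith [hp'.1]
            have h2 : ‖ξ‖ ≤ 2 * ‖η‖ := by
              have := norm_add_le (ξ - η) η
              rw [sub_add_cancel] at this
              linarith [hp'.2]
            have h3 := J_comp (-s₁) η ξ h1 h2
            have h4 : J (-(s₀ + s₁)) ξ = J (-s₀) ξ * J (-s₁) ξ := by rw [J_mul]; congr 1; ring
            rw [h4]
            calc _ ≤ J (-s₀) ξ * (c1 * J (-s₁) ξ) * J (-s₂) (ξ - η) := by gcongr
              _ = _ := by ring
          · rw [Set.indicator_of_notMem hp]; simp
      _ ≤ (c1 * J (-(s₀ + s₁)) ξ) * (C2 * J (s₀ + s₁) ξ) := by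
          have mI := (mJ (-s₂)).indicator
            (Metric.isClosed_closedBall (x := (0 : E n)) (ε := ‖ξ‖)).measurableSet
          rw [lintegral_const_mul _ (by fun_prop),
            lintegral_sub_left_eq_self ((Metric.closedBall (0 : E n) ‖ξ‖).indicator (J (-s₂)))]
          gcongr
          exact k2 ξ
      _ = c1 * C2 * (J (-(s₀ + s₁)) ξ * J (s₀ + s₁) ξ) := by ring
      _ = _ := by rw [J_neg_mul, mul_one]
  refine ⟨3 * (c2 * C0 + c2 * C1 + c1 * C2), by finiteness, fun F G mF mG => ?_⟩
  let a : E n → ℝ≥0∞ := fun x => J (s₁ / 2) x * F x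
  let b : E n → ℝ≥0∞ := fun x => J (s₂ / 2) x * G x
  have ma : Measurable a := by fun_prop
  have mb : Measurable b := by fun_prop
  have ea : ∫⁻ x, a x ^ 2 = Nsq s₁ F := by simp only [a, mul_pow, J_half_sq, Nsq]
  have eb : ∫⁻ x, b x ^ 2 = Nsq s₂ G := by simp only [b, mul_pow, J_half_sq, Nsq]
  have mi0 := mW.indicator mA0
  have mi1 := mW.indicator mA1
  have mi2 := mW.indicator mA2
  have r0 := region2 a b _ ma mb mi0 _ b0
  have r1 := region1 a b _ ma mb mi1 _ b1
  have r2 := region1 a b _ ma mb mi2 _ b2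
  rw [ea, eb] at r0 r1 r2
  have mK : ∀ w : E n × E n → ℝ≥0∞, Measurable w →
      Measurable fun ξ => (∫⁻ η, a η * b (ξ - η) * w (ξ, η)) ^ 2 := by
    intro w hw
    refine Measurable.pow_const ?_ 2
    exact Measurable.lintegral_prod_right' (f := fun p : E n × E n => a p.2 * b (p.1 - p.2) * w p)
          (by fun_prop)
  calc Nsq (-s₀) (fun ξ => ∫⁻ η, F η * G (ξ - η))
      = ∫⁻ ξ, (∫⁻ η, a η * b (ξ - η) * W (ξ, η)) ^ 2 := by
        unfold Nsq
        refine lintegral_congr fun ξ => ?_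
        rw [← J_half_sq, ← mul_pow, ← lintegral_const_mul _ (by fun_prop)]
        congr 2
        ext η
        simp only [a, b, W]
        have e1 := J_neg_mul (s₁ / 2) η
        have e2 := J_neg_mul (s₂ / 2) (ξ - η)
        rw [← neg_div] at e1 e2
        calc _ = J (-s₀ / 2) ξ * (F η * G (ξ - η)) * ((J (-s₁ / 2) η * J (s₁ / 2) η) *
              (J (-s₂ / 2) (ξ - η) * J (s₂ / 2) (ξ - η))) := by rw [e1, e2]; ring
          _ = _ := by
            ring
    _ ≤ ∫⁻ ξ, 3 * ((∫⁻ η, a η * b (ξ - η) * A0.indicator W (ξ, η)) ^ 2 +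
          (∫⁻ η, a η * b (ξ - η) * A1.indicator W (ξ, η)) ^ 2 +
          (∫⁻ η, a η * b (ξ - η) * A2.indicator W (ξ, η)) ^ 2) := by
        refine lintegral_mono fun ξ => ?_
        refine le_trans ?_ (cs3 _ _ _)
        refine pow_le_pow_left₀ zero_le ?_ 2
        rw [← lintegral_add_left (by fun_prop), ← lintegral_add_left (by fun_prop)]
        refine lintegral_mono fun η => ?_
        rw [← mul_add, ← mul_add]
        gcongr
        exact hcov _
    _ = 3 * ((∫⁻ ξ, (∫⁻ η, a η * b (ξ - η) * A0.indicator W (ξ, η)) ^ 2) +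
          (∫⁻ ξ, (∫⁻ η, a η * b (ξ - η) * A1.indicator W (ξ, η)) ^ 2) +
          ∫⁻ ξ, (∫⁻ η, a η * b (ξ - η) * A2.indicator W (ξ, η)) ^ 2) := by
        have m0 := mK _ mi0
        have m1 := mK _ mi1
        have m2 := mK _ mi2
        rw [lintegral_const_mul _ (by fun_prop), lintegral_add_left (by fun_prop),
          lintegral_add_left m0]
    _ ≤ 3 * (c2 * C0 * Nsq s₁ F * Nsq s₂ G + c2 * C1 * Nsq s₁ F * Nsq s₂ G
          + c1 * C2 * Nsq s₁ F * Nsq s₂ G) := by gcongr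
    _ = _ := by ring

lemma suff_main (hn : 3 ≤ n) {s₀ s₁ s₂ : ℝ} (h : s₀ + s₁ + s₂ ≥ n / 2) (h01 : s₀ + s₁ ≥ 0)
    (h02 : s₀ + s₂ ≥ 0) (h12 : s₁ + s₂ ≥ 0)
    (h5 : s₀ + s₁ + s₂ = n / 2 → s₀ + s₁ > 0 ∧ s₀ + s₂ > 0 ∧ s₁ + s₂ > 0) :
    ∃ C > (0 : ℝ), ∀ f g : SchwartzMap (EuclideanSpace ℝ (Fin n)) ℂ,
        sobolevNorm n (-s₀) (fun x => f x * g x) ≤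
          C * sobolevNorm n s₁ (⇑f) * sobolevNorm n s₂ (⇑g) := by
  obtain ⟨C, hC, hF⟩ := suff hn h h01 h02 h12 h5
  refine ⟨Real.sqrt C.toReal + 1, by positivity, fun f g => ?_⟩
  have n1 := sob_nonneg s₁ (f : E n → ℂ)
  have n2 := sob_nonneg s₂ (g : E n → ℂ)
  have mm : ∀ u : 𝓢(E n, ℂ), Measurable fun x => ‖u x‖ₑ := fun u => by
    have := u.continuous
    fun_prop
  have h1 := hF (fun x => ‖𝓕 f x‖ₑ) (fun x => ‖𝓕 g x‖ₑ) (mm _) (mm _)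
  rw [← sob_sq, ← sob_sq] at h1
  have h2 : ENNReal.ofReal (sobolevNorm n (-s₀) (fun x => f x * g x) ^ 2) ≤
      C * ENNReal.ofReal (sobolevNorm n s₁ (⇑f) ^ 2) * ENNReal.ofReal (sobolevNorm n s₂ (⇑g) ^ 2) := by
    refine le_trans ?_ h1
    rw [← coe_sm, sob_sq]
    unfold Nsq
    gcongr with x
    simp only []
    rw [fourier_sm]
    refine (enorm_integral_le_lintegral_enorm _).trans_eq ?_
    simp only [enorm_mul]
  rw [← ENNReal.ofReal_toReal hC, ← ENNReal.ofReal_mul (by positivity),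
    ← ENNReal.ofReal_mul (by positivity), ENNReal.ofReal_le_ofReal_iff (by positivity)] at h2
  have h3 : sobolevNorm n (-s₀) (fun x => f x * g x) ≤
      Real.sqrt C.toReal * sobolevNorm n s₁ (⇑f) * sobolevNorm n s₂ (⇑g) := by
    refine le_of_sq_le_sq ?_ (by positivity)
    rw [mul_pow, mul_pow, Real.sq_sqrt (by positivity)]
    exact h2
  refine h3.trans ?_
  gcongr
  linarith

end SobProd

namespace SobProd

open scoped ENNReal SchwartzMap ContDiff

variable {n : ℕ}

/-- Nonnegative smooth compactly supported functions. -/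
structure Tst (F : E n → ℝ) : Prop where
  smooth : ContDiff ℝ ∞ F
  cpt : HasCompactSupport F
  nonneg : ∀ x, 0 ≤ F x

/-- Coercion to extended nonnegative reals. -/
def up (F : E n → ℝ) (x : E n) : ℝ≥0∞ := ENNReal.ofReal (F x)

lemma Tst.meas {F : E n → ℝ} (hF : Tst F) : Measurable (up F) := by
  have := hF.smooth.continuous.measurable
  unfold up
  fun_prop

lemma Tst.lint {F : E n → ℝ} (hF : Tst F) : ∫⁻ x, up F x ≠ ⊤ :=
  ((hF.smooth.continuous.integrable_of_hasCompactSupport hF.cpt).lintegral_lt_top).ne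

/-- The trilinear form. -/
def T (F G H : E n → ℝ≥0∞) : ℝ≥0∞ := ∫⁻ x, ∫⁻ y, F x * G y * H (x + y)

/-- The trilinear estimate on test functions. -/
def P (n : ℕ) (s₀ s₁ s₂ : ℝ) : Prop := ∃ C : ℝ≥0∞, C ≠ ⊤ ∧ ∀ F G H : E n → ℝ,
  Tst F → Tst G → Tst H →
    T (up F) (up G) (up H) ^ 2 ≤ C * Nsq s₁ (up F) * Nsq s₂ (up G) * Nsq s₀ (up H)

lemma T_eq (F G H : E n → ℝ≥0∞) : T F G H = ∫⁻ x, ∫⁻ z, F x * G (z - x) * H z := by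
  unfold T
  refine lintegral_congr fun x => ?_
  rw [← lintegral_add_left_eq_self (fun z => F x * G (z - x) * H z) x]
  simp

lemma T_swap {F G H : E n → ℝ≥0∞} (hF : Measurable F) (hG : Measurable G) (hH : Measurable H) :
    T F G H = T G F H := by
  unfold T
  rw [lintegral_lintegral_swap]
  · refine lintegral_congr fun x => lintegral_congr fun y => ?_
    rw [add_comm, mul_comm (F y)]
  · exact Measurable.aemeasurable (by unfold Function.uncurry; fun_prop)

lemma T_rot {F G H : E n → ℝ≥0∞} (hF : Measurable F) (hG : Measurable G) (hH : Measurable H) :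
    T F G H = T H (fun x => G (-x)) F := by
  rw [T_eq, T_eq, lintegral_lintegral_swap]
  · refine lintegral_congr fun x => lintegral_congr fun y => ?_
    rw [neg_sub]; ring
  · exact Measurable.aemeasurable (by unfold Function.uncurry; fun_prop)

lemma P_swap {s₀ s₁ s₂ : ℝ} (h : P n s₀ s₁ s₂) : P n s₀ s₂ s₁ := by
  obtain ⟨C, hC, h⟩ := h
  refine ⟨C, hC, fun F G H hF hG hH => ?_⟩
  rw [T_swap hF.meas hG.meas hH.meas]
  refine (h G F H hG hF hH).trans_eq (by ring)

lemma Nsq_neg (s : ℝ) (F : E n → ℝ≥0∞) : Nsq s (fun x => F (-x)) = Nsq s F := by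
  unfold Nsq
  rw [← lintegral_neg_eq_self]
  simp [J]

lemma Tst.neg {F : E n → ℝ} (hF : Tst F) : Tst (fun x => F (-x)) :=
  ⟨hF.smooth.comp contDiff_neg, hF.cpt.comp_homeomorph (Homeomorph.neg _), fun x => hF.nonneg _⟩

lemma P_rot {s₀ s₁ s₂ : ℝ} (h : P n s₀ s₁ s₂) : P n s₁ s₀ s₂ := by
  obtain ⟨C, hC, h⟩ := h
  refine ⟨C, hC, fun F G H hF hG hH => ?_⟩
  rw [T_rot hF.meas hG.meas hH.meas]
  have := h H _ F hH hG.neg hF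
  have e : up (fun x => G (-x)) = fun x => up G (-x) := rfl
  rw [e, Nsq_neg] at this
  exact this.trans_eq (by ring)

lemma pair_le (s : ℝ) {K H : E n → ℝ≥0∞} (hK : Measurable K) (hH : Measurable H) :
    (∫⁻ x, K x * H x) ^ 2 ≤ Nsq (-s) K * Nsq s H := by
  have mJ : ∀ s, Measurable (J s : E n → ℝ≥0∞) := measurable_J
  have h := cs (fun x => J (-s / 2) x * K x) (fun x => J (s / 2) x * H x) (by fun_prop)
    (by fun_prop)
  simp only [mul_pow, J_half_sq] at h
  refine le_trans (le_of_eq ?_) h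
  congr 2
  ext x
  have e1 := J_neg_mul (s / 2) x
  rw [← neg_div] at e1
  calc K x * H x = (J (-s / 2) x * J (s / 2) x) * (K x * H x) := by rw [e1, one_mul]
    _ = _ := by ring

lemma P_of_est {s₀ s₁ s₂ : ℝ} (h : ∃ C > (0 : ℝ), ∀ f g : SchwartzMap (EuclideanSpace ℝ (Fin n)) ℂ,
        sobolevNorm n (-s₀) (fun x => f x * g x) ≤
          C * sobolevNorm n s₁ (⇑f) * sobolevNorm n s₂ (⇑g)) : P n s₀ s₁ s₂ := by
  obtain ⟨C, hC, h⟩ := h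
  refine ⟨ENNReal.ofReal (C ^ 2), ENNReal.ofReal_ne_top, fun F G H hF hG hH => ?_⟩
  have lft : ∀ F : E n → ℝ, Tst F → ∃ f : 𝓢(E n, ℂ), ∀ x, 𝓕 f x = (F x : ℂ) := by
    intro F hF
    have h1 : HasCompactSupport (fun x => (F x : ℂ)) := hF.cpt.comp_left Complex.ofReal_zero
    have h2 : ContDiff ℝ ∞ (fun x => (F x : ℂ)) := Complex.ofRealCLM.contDiff.comp hF.smooth
    refine ⟨𝓕⁻ (h1.toSchwartzMap h2), fun x => ?_⟩
    simp
  obtain ⟨f, hf⟩ := lft F hF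
  obtain ⟨g, hg⟩ := lft G hG
  have mF := hF.meas
  have mG := hG.meas
  have mH := hH.meas
  let K : E n → ℝ≥0∞ := fun ξ => ∫⁻ η, up F η * up G (ξ - η)
  have mK : Measurable K :=
    Measurable.lintegral_prod_right' (f := fun p : E n × E n => up F p.2 * up G (p.1 - p.2))
      (by fun_prop)
  have eF : ∀ (u : 𝓢(E n, ℂ)) (F : E n → ℝ), Tst F → (∀ x, 𝓕 u x = (F x : ℂ)) →
      (fun x => ‖𝓕 u x‖ₑ) = up F := by
    intro u F hF hu
    ext x
    rw [hu, ← ofReal_norm, Complex.norm_real, Real.norm_of_nonneg (hF.nonneg x)]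
    rfl
  have eK : (fun x => ‖𝓕 (sm f g) x‖ₑ) = K := by
    ext ξ
    rw [fourier_sm]
    simp only [hf, hg, ← Complex.ofReal_mul]
    rw [integral_complex_ofReal, ← ofReal_norm, Complex.norm_real, Real.norm_of_nonneg
      (integral_nonneg fun x => mul_nonneg (hF.nonneg _) (hG.nonneg _)),
      ofReal_integral_eq_lintegral_ofReal]
    · refine lintegral_congr fun x => ?_
      rw [ENNReal.ofReal_mul (hF.nonneg _)]; rfl
    · have c1 := hF.smooth.continuous
      have c2 := hG.smooth.continuous
      exact Continuous.integrable_of_hasCompactSupport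
        (c1.mul (c2.comp (continuous_const.sub continuous_id))) hF.cpt.mul_right
    · exact .of_forall fun x => mul_nonneg (hF.nonneg _) (hG.nonneg _)
  have h1 : Nsq (-s₀) K ≤ ENNReal.ofReal (C ^ 2) * Nsq s₁ (up F) * Nsq s₂ (up G) := by
    have h2 := h f g
    rw [← coe_sm] at h2
    have h3 := pow_le_pow_left₀ (sob_nonneg _ _) h2 2
    have h4 := ENNReal.ofReal_le_ofReal h3
    rw [mul_pow, mul_pow, ENNReal.ofReal_mul (by positivity), ENNReal.ofReal_mul (by positivity),
      sob_sq, sob_sq, sob_sq, eK, eF f F hF hf, eF g G hG hg] at h4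
    exact h4
  have h2 : T (up F) (up G) (up H) = ∫⁻ x, K x * up H x := by
    rw [T_eq, lintegral_lintegral_swap]
    · refine lintegral_congr fun x => ?_
      rw [lintegral_mul_const _ (by fun_prop)]
    · exact Measurable.aemeasurable (by unfold Function.uncurry; fun_prop)
  rw [h2]
  refine (pair_le s₀ mK mH).trans ?_
  gcongr

/-- Bump functions. -/
lemma bump (p : E n) {r R : ℝ} (hr : 0 < r) (hR : r < R) : ∃ F : E n → ℝ, Tst F ∧
    (∀ x ∈ Metric.closedBall p r, F x = 1) ∧ (∀ x, F x ≤ 1) ∧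
    (∀ x, x ∉ Metric.closedBall p R → F x = 0) := by
  let b : ContDiffBump p := ⟨r, R, hr, hR⟩
  refine ⟨b, ⟨b.contDiff, b.hasCompactSupport, fun x => b.nonneg⟩, fun x hx =>
    b.one_of_mem_closedBall hx, fun x => b.le_one, fun x hx => b.zero_of_le_dist ?_⟩
  have : R < dist x p := by simpa using hx
  exact this.le

lemma Nsq_bump (s : ℝ) (p : E n) {r : ℝ} (hr : r ≤ ‖p‖ / 2) {F : E n → ℝ}
    (h1 : ∀ x, F x ≤ 1) (h0 : ∀ x, x ∉ Metric.closedBall p r → F x = 0) :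
    Nsq s (up F) ≤ ENNReal.ofReal (4 ^ |s|) * J s p * volume (Metric.closedBall p r) := by
  rw [← lintegral_indicator_const Metric.isClosed_closedBall.measurableSet]
  unfold Nsq
  refine lintegral_mono fun x => ?_
  by_cases hx : x ∈ Metric.closedBall p r
  · rw [Set.indicator_of_mem hx]
    have hx' : ‖x - p‖ ≤ r := by simpa [dist_eq_norm] using hx
    have e1 : ‖x‖ ≤ ‖x - p‖ + ‖p‖ := by simpa using norm_add_le (x - p) p
    have e2 : ‖p‖ ≤ ‖x‖ + ‖x - p‖ := by simpa using norm_sub_le x (x - p)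
    have := norm_nonneg p
    have h2 : up F x ≤ 1 := by
      unfold up; simpa using h1 x
    calc J s x * up F x ^ 2 ≤ J s x * 1 ^ 2 := by gcongr
      _ = J s x := by simp
      _ ≤ _ := J_comp s x p (by linarith) (by linarith)
  · simp [up, h0 x hx]

lemma vol_ball (p : E n) {r : ℝ} (hr : 0 < r) : volume (Metric.closedBall p r) =
    ENNReal.ofReal (r ^ n) * volume (Metric.ball (0 : E n) 1) := by
  rw [Measure.addHaar_closedBall _ _ hr.le, finrank_euclideanSpace_fin]

lemma vol_ne_zero : volume (Metric.ball (0 : E n) 1) ≠ 0 :=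
  (Metric.measure_ball_pos _ _ one_pos).ne'

lemma vol_ne_top : volume (Metric.ball (0 : E n) 1) ≠ ⊤ := measure_ball_lt_top.ne

lemma keyP {s₀ s₁ s₂ : ℝ} (h : P n s₀ s₁ s₂) : ∃ C : ℝ≥0∞, C ≠ ⊤ ∧
    ∀ (p q : E n) (r : ℝ) (H : E n → ℝ), 0 < r → 8 * r ≤ ‖p‖ → 8 * r ≤ ‖q‖ → Tst H →
      (∀ x, x ∉ Metric.closedBall (p + q) r → H x = 0) →
      (∫⁻ x, up H x) ^ 2 ≤ C * J s₁ p * J s₂ q * Nsq s₀ (up H) := by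
  obtain ⟨C, hC, h⟩ := h
  refine ⟨C * ENNReal.ofReal (4 ^ |s₁|) * ENNReal.ofReal (4 ^ |s₂|) * (2 ^ n * 4 ^ n),
    by finiteness, fun p q r H hr hp hq hH hsupp => ?_⟩
  obtain ⟨F, tF, F1, Fle, F0⟩ := bump p hr (show r < 2 * r by linarith)
  obtain ⟨G, tG, G1, Gle, G0⟩ := bump q (show 0 < 2 * r by linarith) (show 2 * r < 4 * r by linarith)
  have hT := h F G H tF tG hH
  have nF := Nsq_bump s₁ p (r := 2 * r) (by linarith) Fle F0
  have nG := Nsq_bump s₂ q (r := 4 * r) (by linarith) Gle G0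
  set V := volume (Metric.closedBall p r) with hV
  have hV0 : V ≠ 0 := (Metric.measure_closedBall_pos _ _ hr).ne'
  have hVt : V ≠ ⊤ := measure_closedBall_lt_top.ne
  have v2 : volume (Metric.closedBall p (2 * r)) = 2 ^ n * V := by
    rw [hV, vol_ball _ hr, vol_ball _ (by linarith), mul_pow, ENNReal.ofReal_mul (by positivity),
      ENNReal.ofReal_pow (by norm_num)]
    simp [mul_assoc]
  have v4 : volume (Metric.closedBall q (4 * r)) = 4 ^ n * V := by
    rw [hV, vol_ball _ hr, vol_ball _ (by linarith), mul_pow, ENNReal.ofReal_mul (by positivity),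
      ENNReal.ofReal_pow (by norm_num)]
    simp [mul_assoc]
  rw [v2] at nF
  rw [v4] at nG
  have low : (∫⁻ x, up H x) * V ≤ T (up F) (up G) (up H) := by
    rw [T_eq, hV, ← lintegral_indicator_const Metric.isClosed_closedBall.measurableSet]
    refine lintegral_mono fun x => ?_
    by_cases hx : x ∈ Metric.closedBall p r
    · rw [Set.indicator_of_mem hx]
      refine lintegral_mono fun z => ?_
      by_cases hz : z ∈ Metric.closedBall (p + q) r
      · have : z - x ∈ Metric.closedBall q (2 * r) := by
          rw [Metric.mem_closedBall, dist_eq_norm] at hx hz ⊢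
          have e : z - x - q = (z - (p + q)) - (x - p) := by abel
          rw [e]
          linarith [norm_sub_le (z - (p + q)) (x - p)]
        simp [up, F1 x hx, G1 _ this]
      · simp [up, hsupp z hz]
    · rw [Set.indicator_of_notMem hx]; exact zero_le
  have fin : (∫⁻ x, up H x) ^ 2 * V ^ 2 ≤ (C * ENNReal.ofReal (4 ^ |s₁|) * ENNReal.ofReal (4 ^ |s₂|) *
      (2 ^ n * 4 ^ n) * J s₁ p * J s₂ q * Nsq s₀ (up H)) * V ^ 2 := by
    rw [← mul_pow]
    refine (pow_le_pow_left₀ zero_le low 2).trans (hT.trans ?_)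
    calc C * Nsq s₁ (up F) * Nsq s₂ (up G) * Nsq s₀ (up H)
        ≤ C * (ENNReal.ofReal (4 ^ |s₁|) * J s₁ p * (2 ^ n * V)) *
          (ENNReal.ofReal (4 ^ |s₂|) * J s₂ q * (4 ^ n * V)) * Nsq s₀ (up H) := by gcongr
      _ = _ := by ring
  exact (ENNReal.mul_le_mul_iff_left (by positivity) (by finiteness)).1 fin

end SobProd

namespace SobProd

open scoped ENNReal SchwartzMap ContDiff

variable {n : ℕ}

lemma exists_vec (hn : 3 ≤ n) {c : ℝ} (hc : 0 ≤ c) : ∃ p : E n, ‖p‖ = c := by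
  have : Nonempty (Fin n) := ⟨⟨0, by omega⟩⟩
  exact exists_norm_eq (E n) hc

lemma lim_aux {A B : ℝ≥0∞} (hA : A ≠ 0) (hB : B ≠ ⊤) {σ : ℝ}
    (h : ∀ M : ℝ, 8 ≤ M → A ≤ B * ENNReal.ofReal (M ^ σ)) : 0 ≤ σ := by
  by_contra! hσ
  have h1 : Filter.Tendsto (fun M : ℝ => M ^ σ) Filter.atTop (nhds 0) := by
    have := tendsto_rpow_neg_atTop (y := -σ) (by linarith)
    simpa using this
  have h2 := ENNReal.Tendsto.const_mul (a := B) (ENNReal.tendsto_ofReal h1) (Or.inr hB)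
  have h3 := ge_of_tendsto h2 (Filter.eventually_atTop.2 ⟨8, h⟩)
  simp at h3
  exact hA h3

lemma lint_bump {H : E n → ℝ} {p : E n} {r : ℝ} (h1 : ∀ x ∈ Metric.closedBall p r, H x = 1) :
    volume (Metric.closedBall p r) ≤ ∫⁻ x, up H x := by
  rw [← lintegral_indicator_one Metric.isClosed_closedBall.measurableSet]
  refine lintegral_mono fun x => ?_
  by_cases hx : x ∈ Metric.closedBall p r
  · rw [Set.indicator_of_mem hx]; simp [up, h1 x hx]
  · rw [Set.indicator_of_notMem hx]; exact zero_le

lemma Tst.Nsq_ne_top {F : E n → ℝ} (hF : Tst F) (s : ℝ) : Nsq s (up F) ≠ ⊤ := by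
  have hc : Continuous fun x : E n => (1 + ‖x‖ ^ 2) ^ s :=
    Continuous.rpow_const (by fun_prop) fun x => Or.inl (by positivity)
  have hc2 := hF.smooth.continuous
  have : Integrable (fun x : E n => (1 + ‖x‖ ^ 2) ^ s * (F x * F x)) :=
    Continuous.integrable_of_hasCompactSupport (hc.mul (hc2.mul hc2)) hF.cpt.mul_left.mul_left
  have h := this.lintegral_lt_top
  refine ne_of_lt (lt_of_eq_of_lt ?_ h)
  unfold Nsq J up
  refine lintegral_congr fun x => ?_
  rw [ENNReal.ofReal_mul (by positivity), ENNReal.ofReal_mul (hF.nonneg x), pow_two (ENNReal.ofReal (F x))]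

lemma J_neg_arg (s : ℝ) (p : E n) : J s (-p) = J s p := by simp [J]

lemma testA (hn : 3 ≤ n) {s₀ s₁ s₂ : ℝ} (h : P n s₀ s₁ s₂) : 0 ≤ s₁ + s₂ := by
  by_contra! hneg
  obtain ⟨C, hC, h⟩ := keyP h
  obtain ⟨H, tH, H1, Hle, H0⟩ := bump (0 : E n) (show (0 : ℝ) < 1 / 2 by norm_num)
    (show (1 / 2 : ℝ) < 1 by norm_num)
  have hpos : (∫⁻ x, up H x) ^ 2 ≠ 0 := by
    have := (Metric.measure_closedBall_pos volume (0 : E n) (show (0 : ℝ) < 1 / 2 by norm_num)).trans_le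
      (lint_bump H1)
    positivity
  have hfin := tH.Nsq_ne_top s₀
  have := lim_aux (σ := 2 * (s₁ + s₂)) hpos (B := C * Nsq s₀ (up H)) (by finiteness) fun M hM => by
    obtain ⟨p, hp⟩ := exists_vec hn (show 0 ≤ M by linarith)
    have := h p (-p) 1 H one_pos (by linarith) (by rw [norm_neg]; linarith) tH (by simpa using H0)
    rw [J_neg_arg, mul_assoc C, J_mul] at this
    refine this.trans ?_
    rw [mul_right_comm]
    gcongr
    unfold J
    apply ENNReal.ofReal_le_ofReal
    rw [hp, Real.rpow_mul (by linarith)]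
    refine Real.rpow_le_rpow_of_nonpos (by positivity) ?_ hneg.le
    norm_num
  linarith

lemma testB (hn : 3 ≤ n) {s₀ s₁ s₂ : ℝ} (h : P n s₀ s₁ s₂) : n / 2 ≤ s₀ + s₁ + s₂ := by
  obtain ⟨C, hC, h⟩ := keyP h
  set v := volume (Metric.ball (0 : E n) 1) with hv
  have hv0 : v ≠ 0 := vol_ne_zero
  have hvt : v ≠ ⊤ := vol_ne_top
  set c := ENNReal.ofReal (4 ^ |s₀|) with hc
  set k := ENNReal.ofReal (65 ^ |s₀ + s₁ + s₂|) with hk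
  set d := ENNReal.ofReal ((1 / 2) ^ n) with hd
  have hd0 : d ≠ 0 := by
    rw [hd, ne_eq, ENNReal.ofReal_eq_zero, not_le]; positivity
  have := lim_aux (A := (d * v) ^ 2) (B := C * c * c * k * v) (σ := 2 * (s₀ + s₁ + s₂) - n)
    (by positivity) (by finiteness) fun r hr => by
    have hr0 : 0 < r := by linarith
    obtain ⟨p, hp⟩ := exists_vec hn (show 0 ≤ 8 * r by linarith)
    obtain ⟨H, tH, H1, Hle, H0⟩ := bump (p + p) (show (0 : ℝ) < (1 / 2) * r by linarith)
      (show (1 / 2) * r < r by linarith)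
    have h1 := h p p r H hr0 hp.ge hp.ge tH H0
    have hpp : ‖p + p‖ = 16 * r := by
      rw [← two_smul ℝ p, norm_smul, hp]; norm_num; ring
    have h2 := Nsq_bump s₀ (p + p) (r := r) (by rw [hpp]; linarith) Hle H0
    have h3 := lint_bump H1
    rw [vol_ball _ (by linarith), mul_pow, ENNReal.ofReal_mul (by positivity), ← hv, ← hd] at h3
    rw [vol_ball _ hr0, ← hv, ← hc] at h2
    have h4 : J s₀ (p + p) ≤ c * J s₀ p := J_comp s₀ _ _ (by rw [hpp, hp]; linarith)
      (by rw [hpp, hp]; linarith)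
    set ρ := ENNReal.ofReal (r ^ n) with hρ
    have hρ0 : ρ ≠ 0 := by
      rw [hρ, ne_eq, ENNReal.ofReal_eq_zero, not_le]; positivity
    have hρt : ρ ≠ ⊤ := ENNReal.ofReal_ne_top
    have h5 : J (s₀ + s₁ + s₂) p ≤ k * (ENNReal.ofReal (r ^ (2 * (s₀ + s₁ + s₂) - n)) * ρ) := by
      rw [hρ, hk, ← ENNReal.ofReal_mul (by positivity), ← Real.rpow_natCast, ← Real.rpow_add hr0,
        sub_add_cancel, ← ENNReal.ofReal_mul (by positivity), Real.rpow_mul hr0.le]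
      unfold J
      apply ENNReal.ofReal_le_ofReal
      rw [hp]
      refine rpow_comp _ (by norm_num) (by positivity) (by positivity) ?_ ?_
      · norm_num; nlinarith
      · norm_num; nlinarith
    have h6 : (d * v) ^ 2 * ρ ^ 2 ≤
        (C * c * c * k * v * ENNReal.ofReal (r ^ (2 * (s₀ + s₁ + s₂) - n))) * ρ ^ 2 := by
      calc (d * v) ^ 2 * ρ ^ 2 = (d * ρ * v) ^ 2 := by ring
        _ ≤ (∫⁻ x, up H x) ^ 2 := pow_le_pow_left₀ zero_le h3 2
        _ ≤ C * J s₁ p * J s₂ p * (c * (c * J s₀ p) * (ρ * v)) := by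
            refine h1.trans ?_
            gcongr
            refine h2.trans ?_
            gcongr
        _ = C * c * c * ρ * v * (J s₀ p * J s₁ p * J s₂ p) := by ring
        _ = C * c * c * ρ * v * J (s₀ + s₁ + s₂) p := by rw [J_mul, J_mul]
        _ ≤ C * c * c * ρ * v * (k * (ENNReal.ofReal (r ^ (2 * (s₀ + s₁ + s₂) - n)) * ρ)) := by
            gcongr
        _ = _ := by ring
    exact (ENNReal.mul_le_mul_iff_left (by positivity) (by finiteness)).1 h6
  linarith

lemma not_integrable (hn : 3 ≤ n) : (∫⁻ x : E n, J (-(n / 2 : ℝ)) x) = ⊤ := by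
  by_contra hfin
  have : Nonempty (Fin n) := ⟨⟨0, by omega⟩⟩
  have hc : Continuous fun x : E n => (1 + ‖x‖ ^ 2) ^ (-(n / 2 : ℝ)) :=
    Continuous.rpow_const (by fun_prop) fun x => Or.inl (by positivity)
  have hintg : Integrable fun x : E n => (1 + ‖x‖ ^ 2) ^ (-(n / 2 : ℝ)) := by
    refine ⟨hc.aestronglyMeasurable, ?_⟩
    rw [hasFiniteIntegral_iff_ofReal (.of_forall fun x => by positivity)]
    exact Ne.lt_top hfin
  have h2 := (integrable_fun_norm_addHaar (E := E n) volume
    (f := fun r : ℝ => (1 + r ^ 2) ^ (-(n / 2 : ℝ)))).1 hintg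
  rw [finrank_euclideanSpace_fin] at h2
  have h3 := (h2.mono_set (Set.Ioi_subset_Ioi (zero_le_one (α := ℝ)))).const_mul
    ((2 : ℝ) ^ ((n : ℝ) / 2))
  refine not_integrableOn_Ioi_inv (a := 1) (Integrable.mono' h3 ?_ ?_)
  · exact measurable_inv.aestronglyMeasurable
  · refine (ae_restrict_iff' measurableSet_Ioi).2 (.of_forall fun r hr => ?_)
    have hr1 : (1 : ℝ) < r := hr
    have hr0 : 0 < r := by linarith
    rw [Real.norm_of_nonneg (by positivity), smul_eq_mul]
    have e1 : (2 * r ^ 2) ^ (-(n / 2 : ℝ)) ≤ (1 + r ^ 2) ^ (-(n / 2 : ℝ)) := by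
      refine Real.rpow_le_rpow_of_nonpos (by positivity) (by nlinarith) ?_
      have : (0 : ℝ) ≤ n := by positivity
      linarith
    have e2 : (2 * r ^ 2) ^ (-(n / 2 : ℝ)) = 2 ^ (-(n / 2 : ℝ)) * r ^ (-(n : ℝ)) := by
      rw [Real.mul_rpow (by norm_num) (by positivity), ← Real.rpow_natCast, ← Real.rpow_mul hr0.le]
      congr 2; push_cast; ring
    have e3 : r ^ (n - 1) * r ^ (-(n : ℝ)) = r⁻¹ := by
      rw [← Real.rpow_natCast, ← Real.rpow_add hr0, Nat.cast_sub (by omega), ← Real.rpow_neg_one]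
      congr 1; push_cast; ring
    have e4 : (2 : ℝ) ^ ((n : ℝ) / 2) * 2 ^ (-(n / 2 : ℝ)) = 1 := by
      rw [← Real.rpow_add (by norm_num)]; simp
    calc r⁻¹ = ((2 : ℝ) ^ ((n : ℝ) / 2) * 2 ^ (-(n / 2 : ℝ))) * (r ^ (n - 1) * r ^ (-(n : ℝ))) := by
          rw [e3, e4, one_mul]
      _ = (2 : ℝ) ^ ((n : ℝ) / 2) * (r ^ (n - 1) * (2 * r ^ 2) ^ (-(n / 2 : ℝ))) := by
          rw [e2]; ring
      _ ≤ _ := by gcongr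

lemma testC (hn : 3 ≤ n) {s₀ s₁ s₂ : ℝ} (h : P n s₀ s₁ s₂) (h12 : s₁ + s₂ = 0)
    (h0 : s₀ = n / 2) : False := by
  subst h0
  obtain ⟨C, hC, h⟩ := keyP h
  have key : ∀ k : ℕ, ∫⁻ x in Metric.closedBall (0 : E n) k, J (-(n / 2 : ℝ)) x ≤ C := by
    intro k
    have hk : (0 : ℝ) < k + 1 := by positivity
    obtain ⟨χ, tχ, χ1, χle, χ0⟩ := bump (0 : E n) hk (show (k + 1 : ℝ) < k + 2 by linarith)
    have hsm : ContDiff ℝ ∞ fun x : E n => (1 + ‖x‖ ^ 2) ^ (-(n / 2 : ℝ)) :=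
      (Function.hasTemperateGrowth_one_add_norm_sq_rpow (E n) _).1
    let H : E n → ℝ := fun x => χ x * (1 + ‖x‖ ^ 2) ^ (-(n / 2 : ℝ))
    have tH : Tst H := ⟨tχ.smooth.mul hsm, tχ.cpt.mul_right,
      fun x => mul_nonneg (tχ.nonneg x) (by positivity)⟩
    obtain ⟨p, hp⟩ := exists_vec hn (show (0 : ℝ) ≤ 8 * (k + 2) by positivity)
    have h1 := h p (-p) (k + 2) H (by positivity) hp.ge (by rw [norm_neg]; exact hp.ge) tH (by
      intro x hx
      rw [add_neg_cancel] at hx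
      simp [H, χ0 x hx])
    rw [J_neg_arg, mul_assoc C, J_mul, h12, J_zero, mul_one] at h1
    have eH : ∀ x, up H x = up χ x * J (-(n / 2 : ℝ)) x := by
      intro x; unfold up J; rw [← ENNReal.ofReal_mul (tχ.nonneg x)]
    have h2 : Nsq (n / 2 : ℝ) (up H) ≤ ∫⁻ x, up H x := by
      unfold Nsq
      refine lintegral_mono fun x => ?_
      have hle : up χ x ≤ 1 := by unfold up; simpa using χle x
      rw [eH]
      calc _ = up χ x * (up χ x * J (-(n / 2 : ℝ)) x) * (J (-(n / 2 : ℝ)) x * J (n / 2 : ℝ) x) := by ring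
        _ = up χ x * (up χ x * J (-(n / 2 : ℝ)) x) := by rw [J_neg_mul, mul_one]
        _ ≤ 1 * (up χ x * J (-(n / 2 : ℝ)) x) := by gcongr
        _ = _ := one_mul _
    have h3 : (∫⁻ x, up H x) ≤ C := by
      rcases eq_or_ne (∫⁻ x, up H x) 0 with hz | hz
      · rw [hz]; exact zero_le
      · have h4 : (∫⁻ x, up H x) * (∫⁻ x, up H x) ≤ C * ∫⁻ x, up H x := by
          rw [← pow_two]
          exact h1.trans (by gcongr)
        exact (ENNReal.mul_le_mul_iff_left hz tH.lint).1 h4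
    refine le_trans ?_ h3
    rw [← lintegral_indicator Metric.isClosed_closedBall.measurableSet]
    refine lintegral_mono fun x => ?_
    by_cases hx : x ∈ Metric.closedBall (0 : E n) k
    · rw [Set.indicator_of_mem hx, eH]
      have : up χ x = 1 := by
        unfold up
        rw [χ1 x (Metric.closedBall_subset_closedBall (by linarith) hx), ENNReal.ofReal_one]
      rw [this, one_mul]
    · rw [Set.indicator_of_notMem hx]; exact zero_le
  have cov : AECover (volume : Measure (E n)) Filter.atTop
      (fun k : ℕ => Metric.closedBall (0 : E n) (k : ℝ)) :=
    aecover_closedBall tendsto_natCast_atTop_atTop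
  have lim := cov.lintegral_tendsto_of_countably_generated
    (f := J (-(n / 2 : ℝ))) (measurable_J _).aemeasurable
  have := le_of_tendsto' lim key
  rw [not_integrable hn] at this
  exact hC (top_le_iff.1 this)

end SobProd

/-- Product estimates in Sobolev spaces (D'Ancona–Foschi–Selberg). -/
theorem product_sobolev_estimate_iff (n : ℕ) (hn : 3 ≤ n) (s₀ s₁ s₂ : ℝ) :
    (∃ C > (0 : ℝ), ∀ f g : SchwartzMap (EuclideanSpace ℝ (Fin n)) ℂ,
        sobolevNorm n (-s₀) (fun x => f x * g x) ≤
          C * sobolevNorm n s₁ (⇑f) * sobolevNorm n s₂ (⇑g)) ↔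
      (s₀ + s₁ + s₂ ≥ n / 2 ∧ s₀ + s₁ ≥ 0 ∧ s₀ + s₂ ≥ 0 ∧ s₁ + s₂ ≥ 0 ∧
        (s₀ + s₁ + s₂ = n / 2 → s₀ + s₁ > 0 ∧ s₀ + s₂ > 0 ∧ s₁ + s₂ > 0)) := by
  constructor
  · intro h
    have p0 := SobProd.P_of_est h
    have p1 := SobProd.P_rot p0
    have p2 := SobProd.P_rot (SobProd.P_swap p0)
    have a12 := SobProd.testA hn p0
    have a02 := SobProd.testA hn p1
    have a01 := SobProd.testA hn p2
    refine ⟨SobProd.testB hn p0, a01, a02, a12, fun e => ⟨?_, ?_, ?_⟩⟩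
    · refine lt_of_le_of_ne a01 fun e2 => ?_
      exact SobProd.testC hn p2 e2.symm (by linarith)
    · refine lt_of_le_of_ne a02 fun e2 => ?_
      exact SobProd.testC hn p1 e2.symm (by linarith)
    · refine lt_of_le_of_ne a12 fun e2 => ?_
      exact SobProd.testC hn p0 e2.symm (by linarith)
  · rintro ⟨h, h01, h02, h12, h5⟩
    exact SobProd.suff_main hn h h01 h02 h12 h5
end
end

section
/- Let s₀, s₁, s₂ ∈ ℝ and b₁, b₂ > 1/2. Suppose that: (416) s₀+s₁+s₂ ≥ 2−(b₁+b₂); (417) s₀+s₁+s₂ ≥ 3/2−b₁; (418) s₀+s₁+s₂ ≥ 3/2−b₂; (419) s₀+s₁+s₂ ≥ 1; (420) s₀+2(s₁+s₂) ≥ 3/2; (421) s₁+s₂ ≥ 0; (422) s₀+s₂ ≥ 0; (423) s₀+s₁ ≥ 0; where (420) is strict if s₀ ∈ {1/2, 3/2, 3/2−2b₁, 3/2−2b₂, 5/2−2(b₁+b₂)}, and (421), (422), (423) are strict if one of (416), (417), (418), (419) is an equality. Then there exists a constant C > 0 such that ‖fg‖_{H^{−s₀,0}(ℝ^{1+3})}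 ≤ C‖f‖_{H^{s₁,b₁}(ℝ^{1+3})}‖g‖_{H^{s₂,b₂}(ℝ^{1+3})} for all Schwartz functions f, g on ℝ^{1+3}. -/
/-!
STATEMENT 1: Product estimates in wave-Sobolev spaces `H^{s,b}` on `ℝ^{1+3}`
(Selberg–Tesfahun / D'Ancona–Foschi–Selberg).
-/

open MeasureTheory
open scoped FourierTransform

noncomputable section

/-- The spatial part of a spacetime Fourier variable `ζ = (τ, ξ) ∈ ℝ^{1+3}`. -/
def spacePart (ζ : EuclideanSpace ℝ (Fin 4)) : EuclideanSpace ℝ (Fin 3) :=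
  (WithLp.equiv 2 (Fin 3 → ℝ)).symm fun i => ζ i.succ

/-- The wave-Sobolev (Klainerman–Machedon) norm
`‖u‖_{H^{s,b}} = ‖⟨ξ⟩^s ⟨|τ|−|ξ|⟩^b û(τ,ξ)‖_{L²_{τ,ξ}}` on `ℝ^{1+3}`,
where the coordinate `ζ 0` of the Fourier variable is the temporal frequency `τ`
and `spacePart ζ = ξ` is the spatial frequency. -/
def waveSobolevNorm (s b : ℝ) (u : EuclideanSpace ℝ (Fin 4) → ℂ) : ℝ :=
  (∫ ζ : EuclideanSpace ℝ (Fin 4),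
      (1 + ‖spacePart ζ‖ ^ 2) ^ s * (1 + (|ζ 0| - ‖spacePart ζ‖) ^ 2) ^ b *
        ‖𝓕 u ζ‖ ^ 2) ^ (1 / 2 : ℝ)


namespace WSP
open MeasureTheory Set
open scoped ENNReal

abbrev E3 := EuclideanSpace ℝ (Fin 3)
abbrev V := ℝ × E3

instance instHaarV : (volume : Measure V).IsAddHaarMeasure :=
  Measure.prod.instIsAddHaarMeasure (volume : Measure ℝ) (volume : Measure E3)

/-- Boundedness of the bilinear operator with kernel `k`. -/
def Bdd (k : V → V → ℝ≥0∞) : Prop :=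
  ∃ C : ℝ≥0∞, C ≠ ⊤ ∧ ∀ F G : V → ℝ≥0∞, Measurable F → Measurable G →
    ∫⁻ ζ, (∫⁻ a, k a (ζ - a) * F a * G (ζ - a)) ^ 2 ≤ C * (∫⁻ a, F a ^ 2) * (∫⁻ a, G a ^ 2)

theorem cs {α : Type*} [MeasurableSpace α] (μ : Measure α) {f g : α → ℝ≥0∞}
    (hf : AEMeasurable f μ) (hg : AEMeasurable g μ) :
    (∫⁻ a, f a * g a ∂μ) ^ 2 ≤ (∫⁻ a, f a ^ 2 ∂μ) * (∫⁻ a, g a ^ 2 ∂μ) := by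
  have h := ENNReal.lintegral_mul_le_Lp_mul_Lq μ Real.HolderConjugate.two_two hf hg
  have h2 : (∫⁻ a, f a * g a ∂μ) ^ 2 ≤ ((∫⁻ a, f a ^ (2:ℝ) ∂μ) ^ (1 / (2:ℝ)) *
      (∫⁻ a, g a ^ (2:ℝ) ∂μ) ^ (1 / (2:ℝ))) ^ 2 := by
    gcongr
    exact h
  refine h2.trans (le_of_eq ?_)
  rw [mul_pow, ← ENNReal.rpow_natCast, ← ENNReal.rpow_natCast, ← ENNReal.rpow_mul,
    ← ENNReal.rpow_mul]
  norm_num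

theorem Bdd.mono {k k' : V → V → ℝ≥0∞} (c : ℝ≥0∞) (hc : c ≠ ⊤) (h' : Bdd k')
    (h : ∀ a b, k a b ≤ c * k' a b) : Bdd k := by
  obtain ⟨C, hC, H⟩ := h'
  refine ⟨c ^ 2 * C, ENNReal.mul_ne_top (ENNReal.pow_ne_top hc) hC, fun F G hF hG => ?_⟩
  calc ∫⁻ ζ, (∫⁻ a, k a (ζ - a) * F a * G (ζ - a)) ^ 2
      ≤ ∫⁻ ζ, c ^ 2 * (∫⁻ a, k' a (ζ - a) * F a * G (ζ - a)) ^ 2 := by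
        refine lintegral_mono fun ζ => ?_
        rw [← mul_pow]
        gcongr
        rw [← lintegral_const_mul' _ _ hc]
        refine lintegral_mono fun a => ?_
        rw [← mul_assoc, ← mul_assoc]
        gcongr
        exact h _ _
    _ = c ^ 2 * ∫⁻ ζ, (∫⁻ a, k' a (ζ - a) * F a * G (ζ - a)) ^ 2 :=
        lintegral_const_mul' _ _ (ENNReal.pow_ne_top hc)
    _ ≤ c ^ 2 * (C * (∫⁻ a, F a ^ 2) * (∫⁻ a, G a ^ 2)) := by gcongr; exact H F G hF hG
    _ = _ := by ring

theorem meas_shear {k : V → V → ℝ≥0∞} (hk : Measurable (Function.uncurry k)) :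
    Measurable fun p : V × V => k p.2 (p.1 - p.2) :=
  hk.comp (measurable_snd.prodMk (measurable_fst.sub measurable_snd))

theorem meas_int {k : V → V → ℝ≥0∞} (hk : Measurable (Function.uncurry k)) {F G : V → ℝ≥0∞}
    (hF : Measurable F) (hG : Measurable G) :
    Measurable fun p : V × V => k p.2 (p.1 - p.2) * F p.2 * G (p.1 - p.2) :=
  ((meas_shear hk).mul (hF.comp measurable_snd)).mul
    (hG.comp (measurable_fst.sub measurable_snd))

theorem Bdd.add {k k1 k2 : V → V → ℝ≥0∞} (m1 : Measurable (Function.uncurry k1))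
    (h1 : Bdd k1) (h2 : Bdd k2)
    (h : ∀ a b, k a b ≤ k1 a b + k2 a b) : Bdd k := by
  obtain ⟨C, hC, H⟩ := h1
  obtain ⟨D, hD, K⟩ := h2
  refine ⟨2 * (C + D), ENNReal.mul_ne_top (by simp) (ENNReal.add_ne_top.2 ⟨hC, hD⟩),
    fun F G hF hG => ?_⟩
  have sq : ∀ x y : ℝ≥0∞, (x + y) ^ 2 ≤ 2 * (x ^ 2 + y ^ 2) := by
    intro x y
    have := ENNReal.rpow_add_le_mul_rpow_add_rpow x y (p := 2) (by norm_num)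
    have e : (2:ℝ≥0∞) ^ ((2:ℝ) - 1) = 2 := by norm_num
    rw [e] at this
    exact_mod_cast this
  calc ∫⁻ ζ, (∫⁻ a, k a (ζ - a) * F a * G (ζ - a)) ^ 2
      ≤ ∫⁻ ζ, 2 * ((∫⁻ a, k1 a (ζ - a) * F a * G (ζ - a)) ^ 2 +
          (∫⁻ a, k2 a (ζ - a) * F a * G (ζ - a)) ^ 2) := by
        refine lintegral_mono fun ζ => ?_
        refine le_trans ?_ (sq _ _)
        gcongr
        have hm : Measurable fun a => k1 a (ζ - a) * F a * G (ζ - a) :=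
          (meas_int m1 hF hG).comp (measurable_const.prodMk measurable_id)
        rw [← lintegral_add_left hm]
        refine lintegral_mono fun a => ?_
        rw [← add_mul, ← add_mul]
        gcongr
        exact h _ _
    _ = 2 * ((∫⁻ ζ, (∫⁻ a, k1 a (ζ - a) * F a * G (ζ - a)) ^ 2) +
          ∫⁻ ζ, (∫⁻ a, k2 a (ζ - a) * F a * G (ζ - a)) ^ 2) := by
        rw [lintegral_const_mul' _ _ (by simp), lintegral_add_left]
        exact (Measurable.lintegral_prod_right' (meas_int m1 hF hG)).pow_const 2
    _ ≤ 2 * (C * (∫⁻ a, F a ^ 2) * (∫⁻ a, G a ^ 2) + D * (∫⁻ a, F a ^ 2) * (∫⁻ a, G a ^ 2)) := by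
        gcongr
        · exact H F G hF hG
        · exact K F G hF hG
    _ = _ := by ring

theorem Bdd.swap {k : V → V → ℝ≥0∞} (h : Bdd fun a b => k b a) : Bdd k := by
  obtain ⟨C, hC, H⟩ := h
  refine ⟨C, hC, fun F G hF hG => ?_⟩
  refine le_trans (le_of_eq ?_) ((H G F hG hF).trans (le_of_eq (by ring)))
  refine lintegral_congr fun ζ => ?_
  congr 1
  rw [← lintegral_sub_left_eq_self _ ζ]
  refine lintegral_congr fun a => ?_
  rw [sub_sub_cancel]
  ring

theorem bdd_cs1 {k : V → V → ℝ≥0∞} (hk : Measurable (Function.uncurry k)) (C : ℝ≥0∞) (hC : C ≠ ⊤)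
    (h : ∀ᵐ ζ : V, ∫⁻ a, k a (ζ - a) ^ 2 ≤ C) : Bdd k := by
  refine ⟨C, hC, fun F G hF hG => ?_⟩
  calc ∫⁻ ζ, (∫⁻ a, k a (ζ - a) * F a * G (ζ - a)) ^ 2
      ≤ ∫⁻ ζ, C * ∫⁻ a, F a ^ 2 * G (ζ - a) ^ 2 := by
        refine lintegral_mono_ae ?_
        filter_upwards [h] with ζ hζ
        have : Measurable fun a : V => ζ - a := measurable_const.sub measurable_id
        have := cs (volume : Measure V) (f := fun a => k a (ζ - a)) (g := fun a => F a * G (ζ - a))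
          ((meas_shear hk).comp (measurable_const.prodMk measurable_id)).aemeasurable
          (hF.mul (hG.comp this)).aemeasurable
        simp only [← mul_assoc] at this
        refine this.trans ?_
        gcongr
        simp only [mul_pow]
        exact le_rfl
    _ = C * ∫⁻ ζ, ∫⁻ a, F a ^ 2 * G (ζ - a) ^ 2 := lintegral_const_mul' _ _ hC
    _ = C * ∫⁻ a, ∫⁻ ζ, F a ^ 2 * G (ζ - a) ^ 2 := by
        rw [lintegral_lintegral_swap]
        exact (((hF.comp measurable_snd).pow_const 2).mul
          ((hG.comp (measurable_fst.sub measurable_snd)).pow_const 2)).aemeasurable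
    _ = C * ∫⁻ a, F a ^ 2 * ∫⁻ x, G x ^ 2 := by
        congr 1
        refine lintegral_congr fun a => ?_
        have hm : Measurable fun ζ => G (ζ - a) ^ 2 :=
          (hG.comp (measurable_id.sub measurable_const)).pow_const 2
        rw [lintegral_const_mul _ hm]
        congr 1
        exact lintegral_sub_right_eq_self (fun x => G x ^ 2) a
    _ = _ := by
        rw [lintegral_mul_const _ (hF.pow_const 2), mul_assoc]

theorem bdd_cs2 {k : V → V → ℝ≥0∞} (hk : Measurable (Function.uncurry k)) (C : ℝ≥0∞) (hC : C ≠ ⊤)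
    (h : ∀ b : V, ∫⁻ a, k a b ^ 2 ≤ C) : Bdd k := by
  refine ⟨C, hC, fun F G hF hG => ?_⟩
  have hm : Measurable fun p : V × V => k p.2 (p.1 - p.2) ^ 2 * G (p.1 - p.2) ^ 2 :=
    ((meas_shear hk).pow_const 2).mul ((hG.comp (measurable_fst.sub measurable_snd)).pow_const 2)
  have hm2 : Measurable fun p : V × V => k p.1 p.2 ^ 2 * G p.2 ^ 2 :=
    (hk.pow_const 2).mul ((hG.comp measurable_snd).pow_const 2)
  calc ∫⁻ ζ, (∫⁻ a, k a (ζ - a) * F a * G (ζ - a)) ^ 2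
      ≤ ∫⁻ ζ, (∫⁻ a, F a ^ 2) * ∫⁻ a, k a (ζ - a) ^ 2 * G (ζ - a) ^ 2 := by
        refine lintegral_mono fun ζ => ?_
        have : Measurable fun a : V => ζ - a := measurable_const.sub measurable_id
        have := cs (volume : Measure V) (f := F) (g := fun a => k a (ζ - a) * G (ζ - a))
          hF.aemeasurable (((meas_shear hk).comp (measurable_const.prodMk measurable_id)).mul
            (hG.comp this)).aemeasurable
        simp only [mul_pow] at this
        refine le_trans (le_of_eq ?_) this
        congr 1
        refine lintegral_congr fun a => ?_
        ring
    _ = (∫⁻ a, F a ^ 2) * ∫⁻ ζ, ∫⁻ a, k a (ζ - a) ^ 2 * G (ζ - a) ^ 2 := by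
        rw [lintegral_const_mul]
        exact Measurable.lintegral_prod_right' hm
    _ = (∫⁻ a, F a ^ 2) * ∫⁻ a, ∫⁻ ζ, k a (ζ - a) ^ 2 * G (ζ - a) ^ 2 := by
        rw [lintegral_lintegral_swap]
        exact hm.aemeasurable
    _ = (∫⁻ a, F a ^ 2) * ∫⁻ a, ∫⁻ b, k a b ^ 2 * G b ^ 2 := by
        congr 1
        refine lintegral_congr fun a => ?_
        exact lintegral_sub_right_eq_self (fun x => k a x ^ 2 * G x ^ 2) a
    _ = (∫⁻ a, F a ^ 2) * ∫⁻ b, ∫⁻ a, k a b ^ 2 * G b ^ 2 := by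
        rw [lintegral_lintegral_swap]
        exact hm2.aemeasurable
    _ ≤ (∫⁻ a, F a ^ 2) * ∫⁻ b, C * G b ^ 2 := by
        gcongr with b
        rw [lintegral_mul_const]
        · gcongr
          exact h b
        · exact (hk.comp (measurable_id.prodMk measurable_const)).pow_const 2
    _ = _ := by
        rw [lintegral_const_mul' _ _ hC]; ring

theorem amgm (x y : ℝ≥0∞) : 2 * (x * y) ≤ x ^ 2 + y ^ 2 := by
  wlog h : x ≤ y generalizing x y
  · rw [mul_comm x, add_comm]
    exact this y x (le_of_not_ge h)
  obtain ⟨d, rfl⟩ := exists_add_of_le h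
  calc 2 * (x * (x + d)) ≤ 2 * (x * (x + d)) + d ^ 2 := le_self_add
    _ = _ := by ring

theorem bdd_quad {μ : V → V → ℝ≥0∞} (hμ : Measurable (Function.uncurry μ)) {v w : V → ℝ≥0∞}
    (hv : Measurable v) (hw : Measurable w) (C : ℝ≥0∞) (hC : C ≠ ⊤)
    (h : ∀ a d : V, ∫⁻ c, μ a (c + d - a) * μ c d * v c ^ 2 * w (c + d - a) ^ 2 ≤ C) :
    Bdd fun a b => μ a b * v a * w b := by
  refine ⟨C, hC, fun F G hF hG => ?_⟩
  -- integrand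
  let Q : V → V → V → ℝ≥0∞ := fun ζ a c =>
    μ a (ζ - a) * μ c (ζ - c) * (F a * G (ζ - c) * v c * w (ζ - a)) ^ 2
  have hμ' : ∀ {X : Type} [MeasurableSpace X] {f g : X → V}, Measurable f → Measurable g →
      Measurable fun x => μ (f x) (g x) := fun hf hg => hμ.comp (hf.prodMk hg)
  have hQm : ∀ {X : Type} [MeasurableSpace X] {f g e : X → V}, Measurable f → Measurable g →
      Measurable e → Measurable fun x => Q (f x) (g x) (e x) := by
    intro X _ f g e hf hg he
    have h1 := hf.sub hg
    have h2 := hf.sub he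
    exact ((hμ' hg h1).mul (hμ' he h2)).mul
      ((((hF.comp hg).mul (hG.comp h2)).mul (hv.comp he)).mul (hw.comp h1) |>.pow_const 2)
  have hTm : ∀ ζ, Measurable fun a => μ a (ζ - a) * v a * w (ζ - a) * F a * G (ζ - a) := by
    intro ζ
    have h1 : Measurable fun a : V => ζ - a := measurable_const.sub measurable_id
    exact ((((hμ' measurable_id h1).mul hv).mul (hw.comp h1)).mul hF).mul (hG.comp h1)
  have key : ∀ ζ, (∫⁻ a, μ a (ζ - a) * v a * w (ζ - a) * F a * G (ζ - a)) ^ 2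
      ≤ ∫⁻ a, ∫⁻ c, Q ζ a c := by
    intro ζ
    have e1 : (∫⁻ a, μ a (ζ - a) * v a * w (ζ - a) * F a * G (ζ - a)) ^ 2 =
        ∫⁻ a, ∫⁻ c, (μ a (ζ - a) * v a * w (ζ - a) * F a * G (ζ - a)) *
          (μ c (ζ - c) * v c * w (ζ - c) * F c * G (ζ - c)) := by
      rw [sq, ← lintegral_mul_const _ (hTm ζ)]
      refine lintegral_congr fun a => ?_
      rw [lintegral_const_mul _ (hTm ζ)]
    have hQ1 : ∀ a, Measurable fun c => Q ζ a c := fun a =>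
      hQm measurable_const measurable_const measurable_id
    have hQ2 : Measurable fun a => ∫⁻ c, Q ζ a c :=
      Measurable.lintegral_prod_right' (f := fun p : V × V => Q ζ p.1 p.2)
        (hQm measurable_const measurable_fst measurable_snd)
    have e2 : 2 * (∫⁻ a, μ a (ζ - a) * v a * w (ζ - a) * F a * G (ζ - a)) ^ 2 ≤
        2 * ∫⁻ a, ∫⁻ c, Q ζ a c := by
      rw [e1, ← lintegral_const_mul' _ _ (by simp)]
      calc _ ≤ ∫⁻ a, ((∫⁻ c, Q ζ a c) + ∫⁻ c, Q ζ c a) := by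
            refine lintegral_mono fun a => ?_
            rw [← lintegral_add_left (hQ1 a), ← lintegral_const_mul' _ _ (by simp)]
            refine lintegral_mono fun c => ?_
            have := amgm (F a * G (ζ - c) * v c * w (ζ - a)) (F c * G (ζ - a) * v a * w (ζ - c))
            calc _ = μ a (ζ - a) * μ c (ζ - c) * (2 * ((F a * G (ζ - c) * v c * w (ζ - a)) *
                  (F c * G (ζ - a) * v a * w (ζ - c)))) := by ring
              _ ≤ μ a (ζ - a) * μ c (ζ - c) * ((F a * G (ζ - c) * v c * w (ζ - a)) ^ 2 +
                  (F c * G (ζ - a) * v a * w (ζ - c)) ^ 2) := by gcongr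
              _ = _ := by simp only [Q]; ring
        _ = (∫⁻ a, ∫⁻ c, Q ζ a c) + ∫⁻ a, ∫⁻ c, Q ζ c a := lintegral_add_left hQ2 _
        _ = _ := by
            rw [lintegral_lintegral_swap (f := fun a c => Q ζ c a)
              (hQm measurable_const measurable_snd measurable_fst).aemeasurable]
            ring
    exact (ENNReal.mul_le_mul_iff_right (by simp) (by simp)).1 e2
  calc ∫⁻ ζ, (∫⁻ a, μ a (ζ - a) * v a * w (ζ - a) * F a * G (ζ - a)) ^ 2
      ≤ ∫⁻ ζ, ∫⁻ a, ∫⁻ c, Q ζ a c := lintegral_mono key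
    _ = ∫⁻ a, ∫⁻ ζ, ∫⁻ c, Q ζ a c := by
        rw [lintegral_lintegral_swap]
        exact (Measurable.lintegral_prod_right' (f := fun p : (V × V) × V => Q p.1.1 p.1.2 p.2)
          (hQm (measurable_fst.comp measurable_fst) (measurable_snd.comp measurable_fst)
            measurable_snd)).aemeasurable
    _ = ∫⁻ a, ∫⁻ c, ∫⁻ ζ, Q ζ a c := by
        refine lintegral_congr fun a => ?_
        rw [lintegral_lintegral_swap]
        exact (hQm measurable_fst measurable_const measurable_snd).aemeasurable
    _ = ∫⁻ a, ∫⁻ c, ∫⁻ d, Q (c + d) a c := by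
        refine lintegral_congr fun a => lintegral_congr fun c => ?_
        exact (lintegral_add_left_eq_self (fun ζ => Q ζ a c) c).symm
    _ = ∫⁻ a, ∫⁻ d, ∫⁻ c, Q (c + d) a c := by
        refine lintegral_congr fun a => ?_
        rw [lintegral_lintegral_swap]
        exact (hQm (measurable_fst.add measurable_snd) measurable_const
          measurable_fst).aemeasurable
    _ ≤ ∫⁻ a, ∫⁻ d, F a ^ 2 * G d ^ 2 * C := by
        refine lintegral_mono fun a => lintegral_mono fun d => ?_
        calc _ = ∫⁻ c, F a ^ 2 * G d ^ 2 *
              (μ a (c + d - a) * μ c d * v c ^ 2 * w (c + d - a) ^ 2) := by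
              refine lintegral_congr fun c => ?_
              simp only [Q, add_sub_cancel_left]
              ring
          _ = F a ^ 2 * G d ^ 2 *
              ∫⁻ c, (μ a (c + d - a) * μ c d * v c ^ 2 * w (c + d - a) ^ 2) := by
              rw [lintegral_const_mul]
              have h1 : Measurable fun c : V => c + d - a :=
                (measurable_id.add measurable_const).sub measurable_const
              exact (((hμ' measurable_const h1).mul (hμ' measurable_id measurable_const)).mul
                (hv.pow_const 2)).mul ((hw.comp h1).pow_const 2)
          _ ≤ _ := by gcongr; exact h a d
    _ = C * (∫⁻ a, F a ^ 2) * (∫⁻ a, G a ^ 2) := by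
        simp_rw [mul_assoc]
        have : ∀ a, ∫⁻ d, F a ^ 2 * (G d ^ 2 * C) = F a ^ 2 * ((∫⁻ d, G d ^ 2) * C) := by
          intro a
          rw [lintegral_const_mul _ ((hG.pow_const 2).mul_const C),
            lintegral_mul_const _ (hG.pow_const 2)]
        simp_rw [this]
        rw [lintegral_mul_const _ (hF.pow_const 2)]
        ring

end WSP

namespace WSP
open MeasureTheory Set
open scoped ENNReal

theorem lintegral_E3 (f : E3 → ℝ≥0∞) (hf : Measurable f) :
    ∫⁻ c, f c = ∫⁻ z : ℝ, ∫⁻ y : ℝ × ℝ, f (WithLp.toLp 2 ![z, y.1, y.2]) := by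
  have h1 := (PiLp.volume_preserving_toLp (Fin 3)).lintegral_comp hf
  rw [← h1]
  have h2 := (volume_preserving_piFinSuccAbove (fun _ : Fin 3 => ℝ) 0).symm
  have hm : Measurable fun x : Fin 3 → ℝ => f (WithLp.toLp 2 x) :=
    hf.comp (by fun_prop)
  rw [← h2.lintegral_comp hm]
  have h3 := ((MeasurePreserving.id (volume : Measure ℝ)).prod
    (volume_preserving_finTwoArrow ℝ).symm)
  have hm2 : Measurable fun x : ℝ × (Fin 2 → ℝ) => f (WithLp.toLp 2
    ((MeasurableEquiv.piFinSuccAbove (fun _ : Fin 3 => ℝ) 0).symm x)) :=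
    hm.comp (MeasurableEquiv.measurable _)
  have h4 := h3.lintegral_comp hm2
  refine h4.symm.trans ?_
  rw [lintegral_prod]
  · refine lintegral_congr fun z => lintegral_congr fun y => ?_
    congr 2
    ext i
    fin_cases i <;> rfl
  · exact (hm2.comp h3.measurable).aemeasurable

theorem polar_radial (g : ℝ → ℝ≥0∞) (hg : Measurable g) :
    ∫⁻ y : ℝ × ℝ, g (y.1 ^ 2 + y.2 ^ 2) =
      ENNReal.ofReal (2 * Real.pi) * ∫⁻ s in Ioi (0:ℝ), ENNReal.ofReal s * g (s ^ 2) := by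
  rw [← lintegral_comp_polarCoord_symm]
  have e : ∀ p : ℝ × ℝ, ENNReal.ofReal p.1 • g ((polarCoord.symm p).1 ^ 2 +
      (polarCoord.symm p).2 ^ 2) = (fun p : ℝ × ℝ => ENNReal.ofReal p.1 * g (p.1 ^ 2)) p := by
    intro p
    simp only [polarCoord_symm_apply, smul_eq_mul]
    congr 2
    nlinarith [Real.sin_sq_add_cos_sq p.2]
  simp_rw [e]
  rw [polarCoord_target, Measure.volume_eq_prod, ← Measure.prod_restrict, lintegral_prod]
  · simp only [lintegral_const, Measure.restrict_apply MeasurableSet.univ, univ_inter,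
      Real.volume_Ioo]
    rw [lintegral_mul_const' _ _ (by simp), mul_comm]
    congr 2
    ring
  · exact ((by fun_prop : Measurable fun p : ℝ × ℝ => ENNReal.ofReal p.1).mul
      (hg.comp (by fun_prop))).aemeasurable

/-- substitution `r = √(z²+s²)` -/
theorem subst1 (z : ℝ) (g : ℝ → ℝ≥0∞) :
    ∫⁻ s in Ioi (0:ℝ), ENNReal.ofReal s * g (√(z ^ 2 + s ^ 2)) ≤
      ∫⁻ r in Ioi |z|, ENNReal.ofReal r * g r := by
  have hd : ∀ s ∈ Ioi (0:ℝ), HasDerivWithinAt (fun s => √(z ^ 2 + s ^ 2))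
      (s / √(z ^ 2 + s ^ 2)) (Ioi 0) s := by
    intro s hs
    have hs' : 0 < s := hs
    have h1 : HasDerivAt (fun s : ℝ => z ^ 2 + s ^ 2) (2 * s) s := by
      simpa using ((hasDerivAt_pow 2 s).const_add (z ^ 2))
    have h2 := (h1.sqrt (by positivity)).hasDerivWithinAt (s := Ioi 0)
    rwa [mul_div_mul_left _ _ (by norm_num)] at h2
  have hi : InjOn (fun s => √(z ^ 2 + s ^ 2)) (Ioi 0) := by
    intro s hs t ht hst
    simp only [mem_Ioi] at hs ht hst
    rw [Real.sqrt_inj (by positivity) (by positivity)] at hst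
    nlinarith
  have h := lintegral_image_eq_lintegral_abs_deriv_mul measurableSet_Ioi hd hi
    (fun r => ENNReal.ofReal r * g r)
  have e : ∫⁻ s in Ioi (0:ℝ), ENNReal.ofReal s * g (√(z ^ 2 + s ^ 2)) =
      ∫⁻ x in Ioi (0:ℝ), ENNReal.ofReal |x / √(z ^ 2 + x ^ 2)| *
        (ENNReal.ofReal (√(z ^ 2 + x ^ 2)) * g (√(z ^ 2 + x ^ 2))) := by
    refine setLIntegral_congr_fun measurableSet_Ioi fun s hs => ?_
    have hs' : 0 < s := hs
    rw [← mul_assoc, ← ENNReal.ofReal_mul (abs_nonneg _), abs_of_nonneg (by positivity)]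
    congr 2
    field_simp
  rw [e, ← h]
  refine lintegral_mono_set ?_
  rintro _ ⟨s, hs, rfl⟩
  have hs' : 0 < s := hs
  simp only [mem_Ioi]
  rw [← Real.sqrt_sq_eq_abs]
  exact Real.sqrt_lt_sqrt (sq_nonneg z) (by nlinarith)

theorem subst2 (r E : ℝ) (hE : 0 < E) (g : ℝ → ℝ≥0∞) :
    ∫⁻ z in Ioo (-r) r, g (√(r ^ 2 - 2 * E * z + E ^ 2)) ≤
      ENNReal.ofReal (1 / E) * ∫⁻ ρ in Ioi (0:ℝ), ENNReal.ofReal ρ * g ρ := by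
  have hpos : ∀ z ∈ Ioo (-r) r, 0 < r ^ 2 - 2 * E * z + E ^ 2 := by
    intro z hz
    nlinarith [sq_nonneg (r - E), mul_pos hE (sub_pos.2 hz.2)]
  have hd : ∀ z ∈ Ioo (-r) r, HasDerivWithinAt (fun z => √(r ^ 2 - 2 * E * z + E ^ 2))
      (-E / √(r ^ 2 - 2 * E * z + E ^ 2)) (Ioo (-r) r) z := by
    intro z hz
    have h1 : HasDerivAt (fun z : ℝ => r ^ 2 - 2 * E * z + E ^ 2) (-(2 * E)) z := by
      simpa using (((hasDerivAt_id z).const_mul (2 * E)).const_sub (r ^ 2)).add_const (E ^ 2)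
    have h2 := (h1.sqrt (hpos z hz).ne').hasDerivWithinAt (s := Ioo (-r) r)
    rwa [← mul_neg, mul_div_mul_left _ _ (by norm_num)] at h2
  have hi : InjOn (fun z => √(r ^ 2 - 2 * E * z + E ^ 2)) (Ioo (-r) r) := by
    intro s hs t ht hst
    simp only at hst
    rw [Real.sqrt_inj (hpos s hs).le (hpos t ht).le] at hst
    have : E * (s - t) = 0 := by linarith
    rcases mul_eq_zero.1 this with h | h <;> linarith
  have h := lintegral_image_eq_lintegral_abs_deriv_mul measurableSet_Ioo hd hi
    (fun r => ENNReal.ofReal (1 / E) * (ENNReal.ofReal r * g r))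
  have e : ∫⁻ z in Ioo (-r) r, g (√(r ^ 2 - 2 * E * z + E ^ 2)) =
      ∫⁻ x in Ioo (-r) r, ENNReal.ofReal |-E / √(r ^ 2 - 2 * E * x + E ^ 2)| *
        (ENNReal.ofReal (1 / E) * (ENNReal.ofReal (√(r ^ 2 - 2 * E * x + E ^ 2)) *
          g (√(r ^ 2 - 2 * E * x + E ^ 2)))) := by
    refine setLIntegral_congr_fun measurableSet_Ioo fun s hs => ?_
    have := Real.sqrt_pos.2 (hpos s hs)
    rw [← mul_assoc, ← mul_assoc, ← ENNReal.ofReal_mul (abs_nonneg _),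
      ← ENNReal.ofReal_mul (by positivity), abs_div, abs_neg, abs_of_pos hE, abs_of_pos this]
    field_simp
    simp
  rw [e, ← h, ← lintegral_const_mul' _ _ (by simp)]
  refine lintegral_mono_set ?_
  rintro _ ⟨z, hz, rfl⟩
  exact Real.sqrt_pos.2 (hpos z hz)

theorem bipolar0 {H : ℝ → ℝ → ℝ≥0∞} (hH : Measurable (Function.uncurry H)) {E : ℝ} (hE : 0 < E) :
    ∫⁻ c : E3, H ‖c‖ ‖c - WithLp.toLp 2 ![E, 0, 0]‖ ≤ ENNReal.ofReal (2 * Real.pi / E) *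
      ∫⁻ r in Ioi (0:ℝ), ENNReal.ofReal r * ∫⁻ ρ in Ioi (0:ℝ), ENNReal.ofReal ρ * H r ρ := by
  have hH' : ∀ {X : Type} [MeasurableSpace X] {f g : X → ℝ}, Measurable f → Measurable g →
      Measurable fun x => H (f x) (g x) := fun hf hg => hH.comp (hf.prodMk hg)
  rw [lintegral_E3 _ (hH' (by fun_prop) (by fun_prop))]
  have n1 : ∀ x y z : ℝ, ‖(WithLp.toLp 2 ![x, y, z] : E3)‖ = √(x ^ 2 + (y ^ 2 + z ^ 2)) := by
    intro x y z
    rw [EuclideanSpace.norm_eq, Fin.sum_univ_three]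
    simp [add_assoc]
  have n2 : ∀ x y z : ℝ, ‖(WithLp.toLp 2 ![x, y, z] : E3) - WithLp.toLp 2 ![E, 0, 0]‖ =
      √((x - E) ^ 2 + (y ^ 2 + z ^ 2)) := by
    intro x y z
    rw [← n1]
    congr 1
    ext i
    fin_cases i <;> simp
  simp_rw [n1, n2]
  calc _ = ∫⁻ z : ℝ, ENNReal.ofReal (2 * Real.pi) * ∫⁻ s in Ioi (0:ℝ), ENNReal.ofReal s *
        H (√(z ^ 2 + s ^ 2)) (√((z - E) ^ 2 + s ^ 2)) := by
        refine lintegral_congr fun z => ?_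
        rw [← polar_radial (fun q => H (√(z ^ 2 + q)) (√((z - E) ^ 2 + q)))
          (hH' (by fun_prop) (by fun_prop))]
    _ ≤ ∫⁻ z : ℝ, ENNReal.ofReal (2 * Real.pi) * ∫⁻ r in Ioi |z|, ENNReal.ofReal r *
        H r (√(r ^ 2 - 2 * E * z + E ^ 2)) := by
        refine lintegral_mono fun z => ?_
        refine mul_le_mul_right ?_ _
        refine le_trans (le_of_eq ?_) (subst1 z (fun r => H r (√(r ^ 2 - 2 * E * z + E ^ 2))))
        refine lintegral_congr fun s => ?_
        rw [Real.sq_sqrt (by positivity)]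
        ring_nf
    _ = ENNReal.ofReal (2 * Real.pi) * ∫⁻ z : ℝ, ∫⁻ r in Ioi |z|, ENNReal.ofReal r *
        H r (√(r ^ 2 - 2 * E * z + E ^ 2)) := lintegral_const_mul' _ _ ENNReal.ofReal_ne_top
    _ = ENNReal.ofReal (2 * Real.pi) * ∫⁻ z : ℝ, ∫⁻ r : ℝ, {p : ℝ × ℝ | |p.1| < p.2}.indicator
        (fun p => ENNReal.ofReal p.2 * H p.2 (√(p.2 ^ 2 - 2 * E * p.1 + E ^ 2))) (z, r) := by
        congr 1
        refine lintegral_congr fun z => ?_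
        rw [← lintegral_indicator measurableSet_Ioi]
        rfl
    _ = ENNReal.ofReal (2 * Real.pi) * ∫⁻ r : ℝ, ∫⁻ z : ℝ, {p : ℝ × ℝ | |p.1| < p.2}.indicator
        (fun p => ENNReal.ofReal p.2 * H p.2 (√(p.2 ^ 2 - 2 * E * p.1 + E ^ 2))) (z, r) := by
        rw [lintegral_lintegral_swap]
        refine Measurable.aemeasurable ?_
        refine Measurable.indicator (f := fun p : ℝ × ℝ =>
          ENNReal.ofReal p.2 * H p.2 (√(p.2 ^ 2 - 2 * E * p.1 + E ^ 2))) ?_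
          (measurableSet_lt (by fun_prop) (by fun_prop))
        exact Measurable.mul (by fun_prop) (hH' (by fun_prop) (by fun_prop))
    _ ≤ ENNReal.ofReal (2 * Real.pi) * ∫⁻ r : ℝ, (Ioi (0:ℝ)).indicator (fun r =>
        ENNReal.ofReal (1 / E) * (ENNReal.ofReal r *
          ∫⁻ ρ in Ioi (0:ℝ), ENNReal.ofReal ρ * H r ρ)) r := by
        gcongr with r
        by_cases hr : 0 < r
        · rw [indicator_of_mem (by exact hr)]
          have e : ∀ z, {p : ℝ × ℝ | |p.1| < p.2}.indicator
              (fun p => ENNReal.ofReal p.2 * H p.2 (√(p.2 ^ 2 - 2 * E * p.1 + E ^ 2))) (z, r) =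
              (Ioo (-r) r).indicator (fun z => ENNReal.ofReal r *
                H r (√(r ^ 2 - 2 * E * z + E ^ 2))) z := by
            intro z
            simp only [indicator, mem_ofPred_eq, mem_Ioo, abs_lt]
          simp_rw [e]
          rw [lintegral_indicator measurableSet_Ioo, lintegral_const_mul' _ _ (by simp),
            mul_left_comm]
          gcongr
          exact subst2 r E hE (H r)
        · refine (le_of_eq ?_).trans zero_le
          rw [lintegral_eq_zero_iff']
          · filter_upwards with z
            rw [indicator_of_notMem]
            · rfl
            · simp only [mem_ofPred_eq]
              intro h
              exact hr ((abs_nonneg z).trans_lt h)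
          · refine Measurable.aemeasurable ?_
            refine (Measurable.indicator (f := fun p : ℝ × ℝ =>
              ENNReal.ofReal p.2 * H p.2 (√(p.2 ^ 2 - 2 * E * p.1 + E ^ 2))) ?_
              (measurableSet_lt (by fun_prop) (by fun_prop))).comp
                (measurable_id.prodMk measurable_const)
            exact Measurable.mul (by fun_prop) (hH' (by fun_prop) (by fun_prop))
    _ = _ := by
        rw [lintegral_indicator measurableSet_Ioi, lintegral_const_mul' _ _ (by simp), ← mul_assoc,
          ← ENNReal.ofReal_mul (by positivity)]
        congr 2
        ring

theorem bipolar {H : ℝ → ℝ → ℝ≥0∞} (hH : Measurable (Function.uncurry H)) {e : E3} (he : e ≠ 0) :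
    ∫⁻ c : E3, H ‖c‖ ‖c - e‖ ≤ ENNReal.ofReal (2 * Real.pi / ‖e‖) *
      ∫⁻ r in Ioi (0:ℝ), ENNReal.ofReal r * ∫⁻ ρ in Ioi (0:ℝ), ENNReal.ofReal ρ * H r ρ := by
  refine le_trans (le_of_eq ?_) (bipolar0 hH (norm_pos_iff.2 he))
  have hn : ‖e‖ = ‖(WithLp.toLp 2 ![‖e‖, 0, 0] : E3)‖ := by
    rw [EuclideanSpace.norm_eq (WithLp.toLp 2 ![‖e‖, 0, 0] : E3), Fin.sum_univ_three]
    simp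
  have hR := Submodule.reflection_sub hn
  set T := (Submodule.span ℝ {e - (WithLp.toLp 2 ![‖e‖, 0, 0] : E3)})ᗮ.reflection
  have hm : Measurable fun c : E3 => H ‖c‖ ‖c - WithLp.toLp 2 ![‖e‖, 0, 0]‖ :=
    hH.comp (Measurable.prodMk (by fun_prop) (by fun_prop))
  rw [← T.measurePreserving.lintegral_comp hm]
  refine lintegral_congr fun c => ?_
  rw [← hR, ← map_sub, LinearIsometryEquiv.norm_map, LinearIsometryEquiv.norm_map]

end WSP

namespace WSP
open MeasureTheory Set
open scoped ENNReal

/-- modulation weight (squared) -/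
noncomputable def md (b σ r : ℝ) : ℝ≥0∞ := ENNReal.ofReal ((1 + (|σ| - r) ^ 2) ^ (-b))

noncomputable def vw (b : ℝ) (a : V) : ℝ≥0∞ := ENNReal.ofReal ((1 + (|a.1| - ‖a.2‖) ^ 2) ^ (-(b / 2)))

theorem vw_sq (b : ℝ) (a : V) : vw b a ^ 2 = md b a.1 ‖a.2‖ := by
  have h : (0:ℝ) < 1 + (|a.1| - ‖a.2‖) ^ 2 := by positivity
  rw [vw, md, ← ENNReal.ofReal_pow (by positivity), ← Real.rpow_natCast, ← Real.rpow_mul h.le]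
  congr 2
  push_cast
  ring

theorem vw_neg (b : ℝ) (a : V) : vw b (-a) = vw b a := by
  simp [vw]

theorem meas_vw (b : ℝ) : Measurable (vw b) := by
  unfold vw; fun_prop

theorem meas_md (b : ℝ) : Measurable fun p : ℝ × ℝ => md b p.1 p.2 := by
  unfold md; fun_prop

theorem meas_md' (b : ℝ) {X : Type} [MeasurableSpace X] {f g : X → ℝ} (hf : Measurable f)
    (hg : Measurable g) : Measurable fun x => md b (f x) (g x) := by
  unfold md; fun_prop

/-- total mass -/
noncomputable def Cm (b : ℝ) : ℝ≥0∞ := ∫⁻ x : ℝ, ENNReal.ofReal ((1 + x ^ 2) ^ (-b))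

theorem Cm_ne_top {b : ℝ} (hb : 1 / 2 < b) : Cm b ≠ ⊤ := by
  have h := integrable_rpow_neg_one_add_norm_sq (E := ℝ) (μ := volume) (r := 2 * b)
    (by simp; linarith)
  have h2 := h.lintegral_lt_top
  refine ne_of_lt (lt_of_le_of_lt (le_of_eq ?_) h2)
  refine lintegral_congr fun x => ?_
  rw [Real.norm_eq_abs, sq_abs]
  congr 2
  ring

theorem md_int_r (b σ : ℝ) : ∫⁻ ρ in Ioi (0:ℝ), md b σ ρ ≤ Cm b := by
  refine (setLIntegral_le_lintegral _ _).trans (le_of_eq ?_)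
  exact lintegral_sub_left_eq_self (fun x => ENNReal.ofReal ((1 + x ^ 2) ^ (-b))) |σ|

theorem md_int_t (b r : ℝ) : ∫⁻ σ : ℝ, md b σ r ≤ 2 * Cm b := by
  have h : ∀ σ, md b σ r ≤ ENNReal.ofReal ((1 + (σ - r) ^ 2) ^ (-b)) +
      ENNReal.ofReal ((1 + (σ + r) ^ 2) ^ (-b)) := by
    intro σ
    rcases abs_cases σ with ⟨h, _⟩ | ⟨h, _⟩
    · rw [md, h]; exact le_self_add
    · rw [md, h, show (-σ - r) ^ 2 = (σ + r) ^ 2 by ring]; exact le_add_self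
  refine (lintegral_mono h).trans (le_of_eq ?_)
  rw [lintegral_add_left (by fun_prop), two_mul]
  congr 1
  · exact lintegral_sub_right_eq_self (fun x => ENNReal.ofReal ((1 + x ^ 2) ^ (-b))) r
  · exact lintegral_add_right_eq_self (fun x => ENNReal.ofReal ((1 + x ^ 2) ^ (-b))) r

theorem work (b₁ b₂ : ℝ) (e : V) (he : e.2 ≠ 0) (g : E3 → ℝ≥0∞) (hg : Measurable g)
    (h : ℝ → ℝ≥0∞) (hh : Measurable h)
    (H : ∀ c : E3, g c * ENNReal.ofReal (‖c‖ * ‖c - e.2‖) ≤ ENNReal.ofReal ‖e.2‖ * h ‖c‖) :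
    ∫⁻ c : V, g c.2 * vw b₁ c ^ 2 * vw b₂ (c - e) ^ 2 ≤
      ENNReal.ofReal (2 * Real.pi) * Cm b₂ * (2 * Cm b₁) * ∫⁻ r in Ioi (0:ℝ), h r := by
  have hE : 0 < ‖e.2‖ := norm_pos_iff.2 he
  simp_rw [vw_sq]
  have hm : Measurable fun c : V => g c.2 * md b₁ c.1 ‖c.2‖ * md b₂ (c - e).1 ‖(c - e).2‖ :=
    ((hg.comp measurable_snd).mul (meas_md' b₁ (by fun_prop) (by fun_prop))).mul
      (meas_md' b₂ (by fun_prop) (by fun_prop))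
  rw [Measure.volume_eq_prod, lintegral_prod _ hm.aemeasurable]
  simp only [Prod.fst_sub, Prod.snd_sub]
  calc _ ≤ ∫⁻ σ : ℝ, ENNReal.ofReal (2 * Real.pi) * ∫⁻ r in Ioi (0:ℝ),
        h r * md b₁ σ r * Cm b₂ := by
        refine lintegral_mono fun σ => ?_
        calc _ ≤ ∫⁻ c : E3, (fun r ρ => ENNReal.ofReal ‖e.2‖ * h r * (ENNReal.ofReal (r * ρ))⁻¹ *
              md b₁ σ r * md b₂ (σ - e.1) ρ) ‖c‖ ‖c - e.2‖ := by
              refine lintegral_mono_ae ?_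
              filter_upwards [Measure.ae_ne volume (0 : E3), Measure.ae_ne volume e.2] with c h0 h1
              have p0 : 0 < ‖c‖ := norm_pos_iff.2 h0
              have p1 : 0 < ‖c - e.2‖ := norm_pos_iff.2 (sub_ne_zero.2 h1)
              have hp : ENNReal.ofReal (‖c‖ * ‖c - e.2‖) ≠ 0 := by
                simp only [ne_eq, ENNReal.ofReal_eq_zero, not_le]; positivity
              beta_reduce
              gcongr
              rw [← div_eq_mul_inv, ENNReal.le_div_iff_mul_le (Or.inl hp)
                (Or.inl ENNReal.ofReal_ne_top)]
              exact H c
          _ ≤ ENNReal.ofReal (2 * Real.pi / ‖e.2‖) * ∫⁻ r in Ioi (0:ℝ), ENNReal.ofReal r *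
                ∫⁻ ρ in Ioi (0:ℝ), ENNReal.ofReal ρ * (ENNReal.ofReal ‖e.2‖ * h r *
                  (ENNReal.ofReal (r * ρ))⁻¹ * md b₁ σ r * md b₂ (σ - e.1) ρ) := by
              refine bipolar (H := fun r ρ => ENNReal.ofReal ‖e.2‖ * h r *
                  (ENNReal.ofReal (r * ρ))⁻¹ * md b₁ σ r * md b₂ (σ - e.1) ρ) ?_ he
              refine Measurable.mul (Measurable.mul (Measurable.mul (Measurable.mul
                measurable_const (hh.comp measurable_fst)) (by fun_prop)) ?_) ?_
              · exact meas_md' b₁ measurable_const measurable_fst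
              · exact meas_md' b₂ measurable_const measurable_snd
          _ = ENNReal.ofReal (2 * Real.pi) * ∫⁻ r in Ioi (0:ℝ),
                h r * md b₁ σ r * ∫⁻ ρ in Ioi (0:ℝ), md b₂ (σ - e.1) ρ := by
              rw [div_eq_mul_inv, ENNReal.ofReal_mul (by positivity), mul_assoc]
              congr 1
              rw [← lintegral_const_mul' _ _ ENNReal.ofReal_ne_top]
              refine setLIntegral_congr_fun measurableSet_Ioi fun r hr => ?_
              have hr' : 0 < r := hr
              beta_reduce
              rw [← mul_assoc, ← lintegral_const_mul' _ _ (ENNReal.mul_ne_top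
                ENNReal.ofReal_ne_top ENNReal.ofReal_ne_top)]
              have m2 : Measurable fun ρ => md b₂ (σ - e.1) ρ :=
                meas_md' b₂ measurable_const measurable_id
              rw [← lintegral_const_mul _ m2]
              refine setLIntegral_congr_fun measurableSet_Ioi fun ρ hρ => ?_
              have hρ' : 0 < ρ := hρ
              beta_reduce
              have key : ENNReal.ofReal ‖e.2‖⁻¹ * ENNReal.ofReal r * ENNReal.ofReal ρ *
                  ENNReal.ofReal ‖e.2‖ * (ENNReal.ofReal (r * ρ))⁻¹ = 1 := by
                rw [← ENNReal.ofReal_inv_of_pos (by positivity),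
                  ← ENNReal.ofReal_mul (by positivity), ← ENNReal.ofReal_mul (by positivity),
                  ← ENNReal.ofReal_mul (by positivity), ← ENNReal.ofReal_mul (by positivity),
                  ← ENNReal.ofReal_one]
                congr 1
                field_simp
              calc _ = (ENNReal.ofReal ‖e.2‖⁻¹ * ENNReal.ofReal r * ENNReal.ofReal ρ *
                  ENNReal.ofReal ‖e.2‖ * (ENNReal.ofReal (r * ρ))⁻¹) *
                    (h r * md b₁ σ r * md b₂ (σ - e.1) ρ) := by ring
                _ = _ := by rw [key, one_mul]
          _ ≤ _ := by
              gcongr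
              exact md_int_r _ _
    _ = ENNReal.ofReal (2 * Real.pi) * ∫⁻ σ : ℝ, ∫⁻ r in Ioi (0:ℝ), h r * md b₁ σ r * Cm b₂ :=
        lintegral_const_mul' _ _ ENNReal.ofReal_ne_top
    _ = ENNReal.ofReal (2 * Real.pi) * ∫⁻ r in Ioi (0:ℝ), ∫⁻ σ : ℝ, h r * md b₁ σ r * Cm b₂ := by
        rw [lintegral_lintegral_swap]
        exact (((hh.comp measurable_snd).mul (meas_md b₁)).mul measurable_const).aemeasurable
    _ ≤ ENNReal.ofReal (2 * Real.pi) * ∫⁻ r in Ioi (0:ℝ), h r * (2 * Cm b₁) * Cm b₂ := by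
        gcongr with r
        have m1 : Measurable fun σ => md b₁ σ r := meas_md' b₁ measurable_id measurable_const
        rw [lintegral_mul_const _ (m1.const_mul _), lintegral_const_mul _ m1]
        gcongr
        exact md_int_t _ _
    _ = _ := by
        simp_rw [mul_assoc]
        rw [lintegral_mul_const _ hh]
        ring

/-- one-dimensional power integral -/
theorem pow_int {p R : ℝ} (hp : 0 < p) (hR : 0 ≤ R) :
    ∫⁻ r in Ioc (0:ℝ) R, ENNReal.ofReal (r ^ (p - 1)) = ENNReal.ofReal (R ^ p / p) := by
  have hi : IntervalIntegrable (fun r : ℝ => r ^ (p - 1)) volume 0 R :=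
    intervalIntegral.intervalIntegrable_rpow' (by linarith)
  rw [intervalIntegrable_iff_integrableOn_Ioc_of_le hR] at hi
  rw [← ofReal_integral_eq_lintegral_ofReal hi, ← intervalIntegral.integral_of_le hR,
    integral_rpow (Or.inl (by linarith))]
  · simp [hp.ne']
  · refine (ae_restrict_iff' measurableSet_Ioc).2 (Filter.Eventually.of_forall fun r hr => ?_)
    exact Real.rpow_nonneg hr.1.le _

/-- integral of a power over a ball in three dimensions -/
theorem ball_int {q : ℝ} (hq : q < 3) : ∃ C : ℝ≥0∞, C ≠ ⊤ ∧ ∀ R : ℝ, 0 < R →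
    ∫⁻ x in {x : E3 | ‖x‖ ≤ R}, ENNReal.ofReal (‖x‖ ^ (-q)) ≤ C * ENNReal.ofReal (R ^ (3 - q)) := by
  let c : ℝ := volume.real (Metric.ball (0:E3) 1)
  refine ⟨ENNReal.ofReal (3 * c / (3 - q)), ENNReal.ofReal_ne_top, fun R hR => ?_⟩
  have h3 : 0 < 3 - q := by linarith
  have hi : IntegrableOn (fun y : ℝ => y ^ 2 * y ^ (-q)) (Ioc 0 R) := by
    have hi : IntervalIntegrable (fun r : ℝ => r ^ (2 - q)) volume 0 R :=
      intervalIntegral.intervalIntegrable_rpow' (by linarith)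
    rw [intervalIntegrable_iff_integrableOn_Ioc_of_le hR.le] at hi
    refine hi.congr_fun (fun y hy => ?_) measurableSet_Ioc
    beta_reduce
    rw [sub_eq_add_neg, Real.rpow_add hy.1]
    norm_num
  let f : ℝ → ℝ := (Iic R).indicator fun y => y ^ (-q)
  have e : ∀ y : ℝ, y ^ 2 • f y = (Iic R).indicator (fun y => y ^ 2 * y ^ (-q)) y := by
    intro y
    by_cases h : y ∈ Iic R <;> simp [f, h]
  have hI : Integrable fun x : E3 => f ‖x‖ := by
    rw [integrable_fun_norm_addHaar volume (f := f)]
    simp only [finrank_euclideanSpace, Fintype.card_fin, Nat.reduceSub]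
    simp_rw [e]
    rw [IntegrableOn, integrable_indicator_iff measurableSet_Iic, IntegrableOn,
      Measure.restrict_restrict measurableSet_Iic, inter_comm, Ioi_inter_Iic]
    exact hi
  have e2 : ∫⁻ x in {x : E3 | ‖x‖ ≤ R}, ENNReal.ofReal (‖x‖ ^ (-q)) =
      ∫⁻ x : E3, ENNReal.ofReal (f ‖x‖) := by
    rw [← lintegral_indicator (measurableSet_le (by fun_prop) (by fun_prop))]
    refine lintegral_congr fun x => ?_
    by_cases h : ‖x‖ ≤ R <;> simp [f, indicator, h]
  have hf0 : ∀ x : E3, 0 ≤ f ‖x‖ := fun x => by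
    by_cases h : ‖x‖ ≤ R
    · simp only [f, indicator, mem_Iic, h, if_true]; positivity
    · simp [f, indicator, h]
  rw [e2, ← ofReal_integral_eq_lintegral_ofReal hI (Filter.Eventually.of_forall hf0),
    integral_fun_norm_addHaar, ← ENNReal.ofReal_mul (by positivity)]
  refine ENNReal.ofReal_le_ofReal (le_of_eq ?_)
  simp only [finrank_euclideanSpace, Fintype.card_fin, Nat.reduceSub]
  simp_rw [e]
  rw [setIntegral_indicator measurableSet_Iic, Ioi_inter_Iic]
  have e3 : ∫ y in Ioc 0 R, y ^ 2 * y ^ (-q) = R ^ (3 - q) / (3 - q) := by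
    rw [← intervalIntegral.integral_of_le hR.le]
    have : ∫ y in (0:ℝ)..R, y ^ 2 * y ^ (-q) = ∫ y in (0:ℝ)..R, y ^ (2 - q) := by
      refine intervalIntegral.integral_congr_ae (Filter.Eventually.of_forall fun y hy => ?_)
      rw [uIoc_of_le hR.le] at hy
      rw [sub_eq_add_neg, Real.rpow_add hy.1]
      norm_num
    rw [this, integral_rpow (Or.inl (by linarith)), show 2 - q + 1 = 3 - q by ring,
      Real.zero_rpow h3.ne', sub_zero]
  rw [e3]
  simp only [nsmul_eq_mul, smul_eq_mul, c]
  push_cast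
  ring

end WSP

namespace WSP
open MeasureTheory Set
open scoped ENNReal

/-- kernel with spatial multiplier `m` -/
noncomputable def KK (m : E3 → E3 → ℝ≥0∞) (b₁ b₂ : ℝ) (a b : V) : ℝ≥0∞ :=
  m a.2 b.2 * vw b₁ a * vw b₂ b

theorem meas_KK {m : E3 → E3 → ℝ≥0∞} (hm : Measurable (Function.uncurry m)) (b₁ b₂ : ℝ) :
    Measurable (Function.uncurry (KK m b₁ b₂)) := by
  have h1 : Measurable fun p : V × V => m p.1.2 p.2.2 :=
    hm.comp ((measurable_snd.comp measurable_fst).prodMk (measurable_snd.comp measurable_snd))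
  exact (h1.mul ((meas_vw b₁).comp measurable_fst)).mul ((meas_vw b₂).comp measurable_snd)

theorem vw_le_one {b : ℝ} (hb : 0 ≤ b) (a : V) : vw b a ≤ 1 := by
  rw [vw, ENNReal.ofReal_le_one]
  exact Real.rpow_le_one_of_one_le_of_nonpos (by nlinarith [sq_nonneg (|a.1| - ‖a.2‖)]) (by linarith)

theorem KK_mono {m m' : E3 → E3 → ℝ≥0∞} {b₁ b₂ : ℝ} (c : ℝ≥0∞) (hc : c ≠ ⊤)
    (h' : Bdd (KK m' b₁ b₂)) (h : ∀ x y, m x y ≤ c * m' x y) : Bdd (KK m b₁ b₂) := by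
  refine Bdd.mono c hc h' fun a b => ?_
  simp only [KK]
  rw [← mul_assoc, ← mul_assoc]
  gcongr
  exact h _ _

theorem KK_add {m m1 m2 : E3 → E3 → ℝ≥0∞} {b₁ b₂ : ℝ} (hm : Measurable (Function.uncurry m1))
    (h1 : Bdd (KK m1 b₁ b₂)) (h2 : Bdd (KK m2 b₁ b₂)) (h : ∀ x y, m x y ≤ m1 x y + m2 x y) :
    Bdd (KK m b₁ b₂) := by
  refine Bdd.add (meas_KK hm _ _) h1 h2 fun a b => ?_
  simp only [KK]
  rw [← add_mul, ← add_mul]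
  gcongr
  exact h _ _

theorem KK_swap {m : E3 → E3 → ℝ≥0∞} {b₁ b₂ : ℝ} (h : Bdd (KK (fun x y => m y x) b₂ b₁)) :
    Bdd (KK m b₁ b₂) := by
  refine Bdd.swap ?_
  convert h using 3 with a b
  simp only [KK]
  ring

theorem KT1 {m : E3 → E3 → ℝ≥0∞} {b₁ b₂ : ℝ} (hm : Measurable (Function.uncurry m))
    (hb₁ : 1 / 2 < b₁) (hb₂ : 1 / 2 < b₂) (C : ℝ≥0∞) (hC : C ≠ ⊤)
    (H : ∀ z : E3, z ≠ 0 → ∃ h : ℝ → ℝ≥0∞, Measurable h ∧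
      (∀ x : E3, m x (z - x) ^ 2 * ENNReal.ofReal (‖x‖ * ‖x - z‖) ≤ ENNReal.ofReal ‖z‖ * h ‖x‖) ∧
      ∫⁻ r in Ioi (0:ℝ), h r ≤ C) : Bdd (KK m b₁ b₂) := by
  refine bdd_cs1 (meas_KK hm _ _) (ENNReal.ofReal (2 * Real.pi) * Cm b₂ * (2 * Cm b₁) * C) ?_ ?_
  · have := Cm_ne_top hb₁
    have := Cm_ne_top hb₂
    finiteness
  · have hz : ∀ᵐ ζ : V, ζ.2 ≠ 0 := by
      have : ∀ᵐ x : E3, x ≠ 0 := Measure.ae_ne volume 0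
      exact Measure.quasiMeasurePreserving_snd.ae this
    filter_upwards [hz] with ζ hζ
    obtain ⟨h, hh, h1, h2⟩ := H ζ.2 hζ
    have hg : Measurable fun x : E3 => m x (ζ.2 - x) ^ 2 :=
      (hm.comp (measurable_id.prodMk (measurable_const.sub measurable_id))).pow_const 2
    have := work b₁ b₂ ζ hζ (fun x => m x (ζ.2 - x) ^ 2) hg h hh h1
    calc _ = ∫⁻ c : V, m c.2 (ζ.2 - c.2) ^ 2 * vw b₁ c ^ 2 * vw b₂ (c - ζ) ^ 2 := by
          refine lintegral_congr fun c => ?_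
          rw [← vw_neg b₂ (c - ζ), neg_sub]
          simp only [KK, mul_pow, Prod.snd_sub]
      _ ≤ _ := this
      _ ≤ _ := by gcongr

theorem KT2 {m : E3 → E3 → ℝ≥0∞} {b₁ b₂ : ℝ} (hm : Measurable (Function.uncurry m))
    (hb₁ : 1 / 2 < b₁) (hb₂ : 1 / 2 < b₂) (C : ℝ≥0∞) (hC : C ≠ ⊤)
    (H : ∀ y : E3, ∫⁻ x, m x y ^ 2 ≤ C) : Bdd (KK m b₁ b₂) := by
  refine bdd_cs2 (meas_KK hm _ _) (C * (2 * Cm b₁)) ?_ ?_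
  · have := Cm_ne_top hb₁
    finiteness
  · intro b
    have hmb : Measurable fun x => m x b.2 ^ 2 :=
      (hm.comp (measurable_id.prodMk measurable_const)).pow_const 2
    calc _ ≤ ∫⁻ a : V, m a.2 b.2 ^ 2 * md b₁ a.1 ‖a.2‖ := by
          refine lintegral_mono fun a => ?_
          simp only [KK, mul_pow]
          rw [← vw_sq]
          calc _ ≤ m a.2 b.2 ^ 2 * vw b₁ a ^ 2 * 1 ^ 2 := by
                gcongr
                exact vw_le_one (by linarith) _
            _ = _ := by simp
      _ = ∫⁻ x : E3, ∫⁻ t : ℝ, m x b.2 ^ 2 * md b₁ t ‖x‖ := by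
          rw [Measure.volume_eq_prod, lintegral_prod_symm]
          exact ((hmb.comp measurable_snd).mul (meas_md' b₁ (by fun_prop)
            (by fun_prop))).aemeasurable
      _ ≤ ∫⁻ x : E3, m x b.2 ^ 2 * (2 * Cm b₁) := by
          refine lintegral_mono fun x => ?_
          have m1 : Measurable fun σ => md b₁ σ ‖x‖ := meas_md' b₁ measurable_id measurable_const
          rw [lintegral_const_mul _ m1]
          gcongr
          exact md_int_t _ _
      _ ≤ _ := by
          rw [lintegral_mul_const _ hmb]
          gcongr
          exact H _

theorem KT3 {m : E3 → E3 → ℝ≥0∞} {b₁ b₂ : ℝ} (hm : Measurable (Function.uncurry m))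
    (hb₁ : 1 / 2 < b₁) (hb₂ : 1 / 2 < b₂) (C : ℝ≥0∞) (hC : C ≠ ⊤)
    (H0 : ∀ x z : E3, m x z * m z x = 0)
    (H : ∀ x w : E3, x ≠ w → ∃ h : ℝ → ℝ≥0∞, Measurable h ∧
      (∀ z : E3, m x (z + w - x) * m z w * ENNReal.ofReal (‖z‖ * ‖z + w - x‖) ≤
        ENNReal.ofReal ‖x - w‖ * h ‖z‖) ∧
      ∫⁻ r in Ioi (0:ℝ), h r ≤ C) : Bdd (KK m b₁ b₂) := by
  have hμ : Measurable (Function.uncurry fun a b : V => m a.2 b.2) :=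
    hm.comp ((measurable_snd.comp measurable_fst).prodMk (measurable_snd.comp measurable_snd))
  refine bdd_quad (μ := fun a b => m a.2 b.2) hμ (meas_vw b₁) (meas_vw b₂)
    (ENNReal.ofReal (2 * Real.pi) * Cm b₂ * (2 * Cm b₁) * C) ?_ ?_
  · have := Cm_ne_top hb₁
    have := Cm_ne_top hb₂
    finiteness
  · intro a d
    by_cases had : a.2 = d.2
    · refine le_trans (le_of_eq ?_) zero_le
      rw [lintegral_eq_zero_iff']
      · filter_upwards with c
        simp only [Prod.snd_sub, Prod.snd_add, had, add_sub_cancel_right]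
        simp [H0]
      · have h1 : Measurable fun c : V => c + d - a :=
          (measurable_id.add measurable_const).sub measurable_const
        have h2 : Measurable fun c : V => m a.2 (c + d - a).2 :=
          hm.comp (measurable_const.prodMk (measurable_snd.comp h1))
        have h3 : Measurable fun c : V => m c.2 d.2 :=
          hm.comp (measurable_snd.prodMk measurable_const)
        exact (((h2.mul h3).mul ((meas_vw _).pow_const 2)).mul
          (((meas_vw _).comp h1).pow_const 2)).aemeasurable
    obtain ⟨h, hh, h1, h2⟩ := H a.2 d.2 had
    have hg : Measurable fun z : E3 => m a.2 (z + d.2 - a.2) * m z d.2 :=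
      (hm.comp (measurable_const.prodMk ((measurable_id.add measurable_const).sub
        measurable_const))).mul (hm.comp (measurable_id.prodMk measurable_const))
    have he : (a - d).2 ≠ 0 := by simpa [sub_eq_zero] using had
    have := work b₁ b₂ (a - d) he (fun z => m a.2 (z + d.2 - a.2) * m z d.2) hg h hh (by
      intro z
      rw [Prod.snd_sub, show z - (a.2 - d.2) = z + d.2 - a.2 by abel]
      exact h1 z)
    calc _ = ∫⁻ c : V, m a.2 (c.2 + d.2 - a.2) * m c.2 d.2 * vw b₁ c ^ 2 *
            vw b₂ (c - (a - d)) ^ 2 := by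
          refine lintegral_congr fun c => ?_
          rw [show c - (a - d) = c + d - a by abel]
          simp
      _ ≤ _ := this
      _ ≤ _ := by gcongr

end WSP

namespace WSP
open MeasureTheory Set
open scoped ENNReal

noncomputable def J (p x : ℝ) : ℝ := (1 + x ^ 2) ^ p

theorem J_base (x : ℝ) : 0 < 1 + x ^ 2 := by positivity
theorem J_one_le (x : ℝ) : 1 ≤ 1 + x ^ 2 := by nlinarith [sq_nonneg x]
theorem J_pos (p x : ℝ) : 0 < J p x := Real.rpow_pos_of_pos (J_base x) _
theorem J_add (p q x : ℝ) : J (p + q) x = J p x * J q x := Real.rpow_add (J_base x) _ _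
theorem J_sq (p x : ℝ) : J (p / 2) x ^ 2 = J p x := by
  rw [sq, ← J_add]; congr 1; ring
theorem J_mono {p q : ℝ} (h : p ≤ q) (x : ℝ) : J p x ≤ J q x :=
  Real.rpow_le_rpow_of_exponent_le (J_one_le x) h
theorem meas_J (p : ℝ) : Measurable (J p) := by unfold J; fun_prop

theorem J_anti {q x y K : ℝ} (hq : 0 ≤ q) (hK : 1 ≤ K) (hx : 0 ≤ x) (h : x ≤ K * y) :
    J (-q) y ≤ (K ^ 2) ^ q * J (-q) x := by
  unfold J
  have h1 : 1 + x ^ 2 ≤ K ^ 2 * (1 + y ^ 2) := by nlinarith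
  rw [Real.rpow_neg (J_base y).le, Real.rpow_neg (J_base x).le, inv_eq_one_div, ← div_eq_mul_inv,
    div_le_div_iff₀ (Real.rpow_pos_of_pos (J_base y) _) (Real.rpow_pos_of_pos (J_base x) _),
    one_mul, ← Real.mul_rpow (by positivity) (J_base y).le]
  exact Real.rpow_le_rpow (J_base x).le h1 hq

theorem J_comp {p x y K : ℝ} (hK : 1 ≤ K) (hx : 0 ≤ x) (hy : 0 ≤ y) (h : x ≤ K * y)
    (h' : y ≤ K * x) : J p x ≤ (K ^ 2) ^ |p| * J p y := by
  rcases le_total 0 p with hp | hp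
  · rw [abs_of_nonneg hp]
    unfold J
    rw [← Real.mul_rpow (by positivity) (J_base y).le]
    refine Real.rpow_le_rpow (J_base x).le ?_ hp
    nlinarith
  · rw [abs_of_nonpos hp]
    have := J_anti (q := -p) (by linarith) hK hy h'
    rwa [neg_neg] at this

theorem J_le_pow {q x : ℝ} (hq : 0 ≤ q) (hx : 0 < x) : J (-q) x ≤ x ^ (-(2 * q)) := by
  unfold J
  rw [Real.rpow_neg (J_base x).le, Real.rpow_neg hx.le]
  refine inv_anti₀ (by positivity) ?_
  rw [Real.rpow_mul hx.le]
  refine Real.rpow_le_rpow (by positivity) ?_ hq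
  norm_num

theorem J_trade {s α s' α' x y : ℝ} (hx : 0 ≤ x) (h : x ≤ y) (h1 : s' + α' ≤ s + α) (h2 : α' ≤ α) :
    J (-s) x * J (-α) y ≤ J (-s') x * J (-α') y := by
  have e1 : J (-α) y = J (-α') y * J (-(α - α')) y := by rw [← J_add]; congr 1; ring
  have e2 : J (-(α - α')) y ≤ J (-(α - α')) x := by
    have := J_anti (q := α - α') (K := 1) (x := x) (y := y) (by linarith) le_rfl hx (by linarith)
    simpa using this
  have e3 : J (-s) x * J (-(α - α')) x ≤ J (-s') x := by
    rw [← J_add]; exact J_mono (by linarith) x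
  calc _ = J (-s) x * J (-(α - α')) y * J (-α') y := by rw [e1]; ring
    _ ≤ J (-s) x * J (-(α - α')) x * J (-α') y := by
      have := J_pos (-s) x
      have := J_pos (-α') y
      gcongr
    _ ≤ _ := by
      have := J_pos (-α') y
      gcongr

/-- the full spatial multiplier -/
noncomputable def mul0 (s₀ s₁ s₂ : ℝ) (x y : E3) : ℝ :=
  J (-s₀ / 2) ‖x + y‖ * J (-s₁ / 2) ‖x‖ * J (-s₂ / 2) ‖y‖

theorem mul0_pos (s₀ s₁ s₂ : ℝ) (x y : E3) : 0 < mul0 s₀ s₁ s₂ x y :=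
  mul_pos (mul_pos (J_pos _ _) (J_pos _ _)) (J_pos _ _)

theorem meas_mul0 (s₀ s₁ s₂ : ℝ) :
    Measurable fun p : E3 × E3 => mul0 s₀ s₁ s₂ p.1 p.2 := by
  unfold mul0 J; fun_prop

theorem mul0_swap (s₀ s₁ s₂ : ℝ) (x y : E3) : mul0 s₀ s₁ s₂ x y = mul0 s₀ s₂ s₁ y x := by
  unfold mul0; rw [add_comm x y]; ring

open Classical in
theorem meas_ite {α : Type*} [MeasurableSpace α] {P : α → Prop} {f : α → ℝ≥0∞}
    (hP : MeasurableSet {x | P x}) (hf : Measurable f) :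
    Measurable fun x => if P x then f x else 0 := Measurable.ite hP hf measurable_const

open Classical in
/-- restriction of a multiplier to a region -/
noncomputable def cut (P : E3 → E3 → Prop) (f : E3 → E3 → ℝ) (x y : E3) : ℝ≥0∞ :=
  if P x y then ENNReal.ofReal (f x y) else 0

theorem cut_pos {P : E3 → E3 → Prop} {f : E3 → E3 → ℝ} {x y : E3} (h : P x y) :
    cut P f x y = ENNReal.ofReal (f x y) := by simp [cut, h]

theorem cut_neg {P : E3 → E3 → Prop} {f : E3 → E3 → ℝ} {x y : E3} (h : ¬ P x y) :
    cut P f x y = 0 := by simp [cut, h]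

open Classical in
theorem meas_cut {P : E3 → E3 → Prop} {f : E3 → E3 → ℝ}
    (hP : MeasurableSet {p : E3 × E3 | P p.1 p.2})
    (hf : Measurable fun p : E3 × E3 => f p.1 p.2) :
    Measurable (Function.uncurry (cut P f)) :=
  meas_ite (P := fun p : E3 × E3 => P p.1 p.2) hP hf.ennreal_ofReal

theorem cut_mono {P P' : E3 → E3 → Prop} {f f' : E3 → E3 → ℝ} {b₁ b₂ : ℝ} (c : ℝ) (hc : 0 ≤ c)
    (h' : Bdd (KK (cut P' f') b₁ b₂)) (h : ∀ x y, P x y → P' x y ∧ f x y ≤ c * f' x y) :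
    Bdd (KK (cut P f) b₁ b₂) := by
  refine KK_mono (ENNReal.ofReal c) ENNReal.ofReal_ne_top h' fun x y => ?_
  by_cases hp : P x y
  · rw [cut_pos hp, cut_pos (h x y hp).1, ← ENNReal.ofReal_mul hc]
    exact ENNReal.ofReal_le_ofReal (h x y hp).2
  · rw [cut_neg hp]; exact zero_le

theorem cut_or {P P1 P2 : E3 → E3 → Prop} {f : E3 → E3 → ℝ} {b₁ b₂ : ℝ}
    (hP1 : MeasurableSet {p : E3 × E3 | P1 p.1 p.2})
    (hf : Measurable fun p : E3 × E3 => f p.1 p.2)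
    (h1 : Bdd (KK (cut P1 f) b₁ b₂)) (h2 : Bdd (KK (cut P2 f) b₁ b₂))
    (h : ∀ x y, P x y → P1 x y ∨ P2 x y) : Bdd (KK (cut P f) b₁ b₂) := by
  refine KK_add (meas_cut hP1 hf) h1 h2 fun x y => ?_
  by_cases hp : P x y
  · rw [cut_pos hp]
    rcases h x y hp with h | h
    · rw [cut_pos h]; exact le_self_add
    · rw [cut_pos h]; exact le_add_self
  · rw [cut_neg hp]; exact zero_le

theorem meas_LH : MeasurableSet {p : E3 × E3 | ‖p.1‖ ≤ ‖p.2‖ ∧ ‖p.1‖ ≤ 4 * ‖p.1 + p.2‖} := by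
  have h1 : MeasurableSet {p : E3 × E3 | ‖p.1‖ ≤ ‖p.2‖} :=
    measurableSet_le (by fun_prop) (by fun_prop)
  have h2 : MeasurableSet {p : E3 × E3 | ‖p.1‖ ≤ 4 * ‖p.1 + p.2‖} :=
    measurableSet_le (by fun_prop) (by fun_prop)
  exact h1.inter h2

theorem LH_real {γ s R r : ℝ} (hγ : 0 < γ) (hs : 1 ≤ γ + s) (hr : 0 < r) (hR : r ≤ 4 * R) :
    J (-γ) R * J (-s) r * r ≤ 16 ^ (γ - min γ (1/2)) *
      (R ^ (-(2 * min γ (1/2))) * r ^ (2 * min γ (1/2) - 1)) := by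
  set g := min γ (1/2) with hg
  have hg0 : 0 < g := lt_min hγ (by norm_num)
  have hg1 : g ≤ γ := min_le_left _ _
  have hg2 : g ≤ 1/2 := min_le_right _ _
  have hR0 : 0 < R := by linarith
  have a1 : J (-γ) R = J (-(γ - g)) R * J (-g) R := by rw [← J_add]; congr 1; ring
  have a2 := J_anti (q := γ - g) (K := 4) (by linarith) (by norm_num) hr.le hR
  have a3 := J_le_pow hg0.le hR0
  have a4 : J (-(γ - g)) r * J (-s) r ≤ J (-(1 - g)) r := by
    rw [← J_add]; exact J_mono (by linarith) r
  have a5 := J_le_pow (q := 1 - g) (by linarith) hr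
  have a6 : r ^ (-(2 * (1 - g))) * r = r ^ (2 * g - 1) := by
    nth_rewrite 2 [← Real.rpow_one r]
    rw [← Real.rpow_add hr]; congr 1; ring
  have p1 := J_pos (-(γ - g)) R
  have p2 := J_pos (-g) R
  have p3 := J_pos (-s) r
  have p4 := J_pos (-(γ - g)) r
  calc _ = J (-(γ - g)) R * J (-g) R * J (-s) r * r := by rw [a1]
    _ ≤ (16 ^ (γ - g) * J (-(γ - g)) r) * (R ^ (-(2 * g))) * J (-s) r * r := by
      rw [show (4:ℝ) ^ 2 = 16 by norm_num] at a2
      gcongr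
    _ = 16 ^ (γ - g) * (R ^ (-(2 * g)) * ((J (-(γ - g)) r * J (-s) r) * r)) := by ring
    _ ≤ 16 ^ (γ - g) * (R ^ (-(2 * g)) * (r ^ (-(2 * (1 - g))) * r)) := by
      have := a4.trans a5
      gcongr
    _ = _ := by rw [a6]

/-- the one-dimensional integral bound in the low-high case -/
theorem LH_int {γ s : ℝ} (hγ : 0 ≤ γ) (hs : 1 ≤ γ + s) (hs' : γ = 0 → 1 < s) :
    ∃ C : ℝ≥0∞, C ≠ ⊤ ∧ ∀ R : ℝ, 0 < R →
      ∫⁻ r in Ioc 0 (4 * R), ENNReal.ofReal (J (-γ) R * J (-s) r * r) ≤ C := by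
  rcases hγ.eq_or_lt with h0 | h0
  · subst h0
    have h1 := hs' rfl
    refine ⟨Cm (s - 1/2), Cm_ne_top (by linarith), fun R hR => ?_⟩
    refine le_trans (lintegral_mono fun r => ?_) (setLIntegral_le_lintegral _ _)
    refine ENNReal.ofReal_le_ofReal ?_
    have e : J (-(s - 1/2)) r = J (-s) r * J (1/2) r := by rw [← J_add]; congr 1; ring
    have e2 : r ≤ J (1/2) r := by
      unfold J
      rw [← Real.sqrt_eq_rpow]
      exact Real.le_sqrt_of_sq_le (by linarith)
    have e3 : J (-0) R = 1 := by simp [J]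
    change _ ≤ J (-(s - 1/2)) r
    rw [e, e3, one_mul]
    have := J_pos (-s) r
    gcongr
  · set g := min γ (1/2) with hg
    have hg0 : 0 < g := lt_min h0 (by norm_num)
    refine ⟨ENNReal.ofReal (16 ^ (γ - g) * (4 ^ (2 * g) / (2 * g))), ENNReal.ofReal_ne_top,
      fun R hR => ?_⟩
    calc _ ≤ ∫⁻ r in Ioc 0 (4 * R), ENNReal.ofReal (16 ^ (γ - g) * R ^ (-(2 * g))) *
            ENNReal.ofReal (r ^ (2 * g - 1)) := by
          refine setLIntegral_mono (by fun_prop) fun r hr => ?_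
          rw [← ENNReal.ofReal_mul (by positivity)]
          refine ENNReal.ofReal_le_ofReal ?_
          rw [mul_assoc (16 ^ (γ - g))]
          exact LH_real h0 hs hr.1 hr.2
      _ = _ := by
          rw [lintegral_const_mul' _ _ ENNReal.ofReal_ne_top, pow_int (by positivity) (by positivity),
            ← ENNReal.ofReal_mul (by positivity)]
          congr 1
          rw [Real.mul_rpow (by norm_num) hR.le, Real.rpow_neg hR.le]
          have : 0 < R ^ (2 * g) := by positivity
          field_simp

open Classical in
theorem LH1 {s₀ s₁ s₂ b₁ b₂ : ℝ} (hb₁ : 1 / 2 < b₁) (hb₂ : 1 / 2 < b₂)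
    (h1 : 1 ≤ s₀ + s₁ + s₂) (h2 : 0 ≤ s₀ + s₂) (h3 : s₀ + s₂ = 0 → 1 < s₁) :
    Bdd (KK (cut (fun x y => ‖x‖ ≤ ‖y‖ ∧ ‖x‖ ≤ 4 * ‖x + y‖) (mul0 s₀ s₁ s₂)) b₁ b₂) := by
  obtain ⟨C, hC, hI⟩ := LH_int h2 (s := s₁) (by linarith) h3
  set k : ℝ := 5 * (5 ^ 2) ^ |(-s₂)| with hk
  have hk0 : 0 < k := by positivity
  refine KT1 (meas_cut ?_ (meas_mul0 _ _ _)) hb₁ hb₂ (ENNReal.ofReal k * C)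
    (by finiteness) ?_
  · exact meas_LH
  intro z hz
  have hz0 : 0 < ‖z‖ := norm_pos_iff.2 hz
  have mh : Measurable fun r => ENNReal.ofReal (k * (J (-(s₀ + s₂)) ‖z‖ * J (-s₁) r * r)) := by
    have := meas_J (-s₁)
    fun_prop
  refine ⟨fun r => if r ≤ 4 * ‖z‖ then ENNReal.ofReal (k * (J (-(s₀ + s₂)) ‖z‖ * J (-s₁) r * r))
    else 0, ?_, ?_, ?_⟩
  · exact meas_ite (measurableSet_le (by fun_prop) (by fun_prop)) mh
  · intro x
    by_cases hc : ‖x‖ ≤ ‖z - x‖ ∧ ‖x‖ ≤ 4 * ‖x + (z - x)‖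
    · rw [cut_pos hc]
      rw [add_sub_cancel] at hc
      beta_reduce
      rw [if_pos hc.2, ← ENNReal.ofReal_pow (mul0_pos _ _ _ _ _).le, ← ENNReal.ofReal_mul (by positivity),
        ← ENNReal.ofReal_mul (by positivity)]
      refine ENNReal.ofReal_le_ofReal ?_
      simp only [mul0, mul_pow, J_sq, add_sub_cancel]
      rw [norm_sub_rev x z]
      have t1 : ‖z - x‖ ≤ 5 * ‖z‖ := by linarith [norm_sub_le z x]
      have t2 : ‖z‖ ≤ 5 * ‖z - x‖ := by
        have : ‖z‖ ≤ ‖z - x‖ + ‖x‖ := by simpa using norm_add_le (z - x) x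
        linarith [hc.1, norm_nonneg (z - x)]
      have t3 := J_comp (p := -s₂) (K := 5) (by norm_num) (norm_nonneg _) (norm_nonneg _) t1 t2
      have e : J (-(s₀ + s₂)) ‖z‖ = J (-s₀) ‖z‖ * J (-s₂) ‖z‖ := by rw [← J_add]; congr 1; ring
      rw [e]
      have p1 := J_pos (-s₀) ‖z‖
      have p2 := J_pos (-s₁) ‖x‖
      have p3 := J_pos (-s₂) ‖z - x‖
      have p4 := J_pos (-s₂) ‖z‖
      calc _ ≤ J (-s₀) ‖z‖ * J (-s₁) ‖x‖ * ((5 ^ 2) ^ |(-s₂)| * J (-s₂) ‖z‖) *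
            (‖x‖ * (5 * ‖z‖)) := by gcongr
        _ = _ := by rw [hk]; ring
    · rw [cut_neg hc]; simp
  · calc _ = ∫⁻ r in Ioc 0 (4 * ‖z‖),
            ENNReal.ofReal (k * (J (-(s₀ + s₂)) ‖z‖ * J (-s₁) r * r)) := by
          rw [← lintegral_indicator measurableSet_Ioi, ← lintegral_indicator measurableSet_Ioc]
          refine lintegral_congr fun r => ?_
          simp only [indicator, mem_Ioi, mem_Ioc]
          split_ifs <;> simp_all
      _ ≤ _ := by
          simp_rw [ENNReal.ofReal_mul hk0.le]
          rw [lintegral_const_mul' _ _ ENNReal.ofReal_ne_top]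
          gcongr
          exact hI _ hz0

end WSP

namespace WSP
open MeasureTheory Set
open scoped ENNReal

theorem norm_add_ge {x z : E3} (h : 0 ≤ inner ℝ x z) : ‖x‖ ≤ ‖x + z‖ ∧ ‖z‖ ≤ ‖x + z‖ := by
  have e := norm_add_sq_real x z
  constructor
  · refine le_of_sq_le_sq ?_ (norm_nonneg _)
    nlinarith [sq_nonneg ‖z‖]
  · refine le_of_sq_le_sq ?_ (norm_nonneg _)
    nlinarith [sq_nonneg ‖x‖]

theorem geo {x y z w : E3} (hs : x + y = z + w) (h1 : 4 * ‖x + y‖ < ‖x‖)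
    (h4 : 4 * ‖z + w‖ < ‖w‖) (hin : 0 ≤ inner ℝ x z) :
    ‖z‖ * ‖y‖ ≤ ‖x - w‖ * (3 * min ‖x‖ ‖w‖) := by
  obtain ⟨g1, g2⟩ := norm_add_ge hin
  have k1 : ‖x + z‖ ≤ ‖x - w‖ + ‖z + w‖ := by
    have := norm_add_le (x - w) (z + w)
    rwa [show x - w + (z + w) = x + z by abel] at this
  have k2 : ‖y‖ ≤ ‖x + y‖ + ‖x‖ := by
    have := norm_sub_le (x + y) x
    rwa [show x + y - x = y by abel] at this
  have k3 : ‖z‖ ≤ ‖z + w‖ + ‖w‖ := by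
    have := norm_sub_le (z + w) w
    rwa [show z + w - w = z by abel] at this
  rw [hs] at h1 k2
  have n1 := norm_nonneg x
  have n2 := norm_nonneg z
  have n3 := norm_nonneg w
  have n4 := norm_nonneg y
  have n5 := norm_nonneg (x - w)
  have n6 := norm_nonneg (z + w)
  have d1 : ‖y‖ ≤ 5 / 4 * ‖x‖ := by linarith
  have d2 : ‖z‖ ≤ 5 / 4 * ‖w‖ := by linarith
  have d3 : 3 / 4 * ‖x‖ ≤ ‖x - w‖ := by linarith
  have d4 : 3 / 4 * ‖z‖ ≤ ‖x - w‖ := by linarith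
  rcases min_cases ‖x‖ ‖w‖ with ⟨e, _⟩ | ⟨e, _⟩ <;> rw [e]
  · nlinarith [mul_le_mul d4 d1 n4 n5]
  · nlinarith [mul_le_mul d3 d2 n2 n5, mul_le_mul_of_nonneg_left d1 n2]

theorem mM {m M p : ℝ} (hm : 0 < m) (hM : m ≤ M) (hp : 0 ≤ p) : m ^ p * M ^ (-p) ≤ 1 := by
  have hM0 : 0 < M := by linarith
  rw [Real.rpow_neg hM0.le, ← div_eq_mul_inv, div_le_one (by positivity)]
  exact Real.rpow_le_rpow hm.le hM hp

theorem quad_red {P : E3 → E3 → Prop} (hP : MeasurableSet {p : E3 × E3 | P p.1 p.2})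
    {s α b₁ b₂ : ℝ} (hb₁ : 1 / 2 < b₁) (hb₂ : 1 / 2 < b₂) (hα : 0 ≤ α)
    (hsub : ∀ x y, P x y → 4 * ‖x + y‖ < ‖x‖ ∧ 4 * ‖x + y‖ < ‖y‖)
    (hin : ∀ x y z w, P x y → P z w → 0 ≤ inner ℝ x z) (C : ℝ≥0∞) (hC : C ≠ ⊤)
    (H : ∀ N₁ N₂ : ℝ, 0 < N₁ → 0 < N₂ → ∃ φ : ℝ → ℝ≥0∞, Measurable φ ∧
      (∀ x y z w, P x y → P z w → x + y = z + w → ‖x‖ = N₁ → ‖w‖ = N₂ →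
        ENNReal.ofReal (J (-s) ‖z + w‖) ≤ φ ‖z‖) ∧
      ENNReal.ofReal (min N₁ N₂ * (N₁ * N₂) ^ (-α)) * ∫⁻ r in Ioi (0:ℝ), φ r ≤ C) :
    Bdd (KK (cut P (mul0 s (α / 2) (α / 2))) b₁ b₂) := by
  set k : ℝ := 3 * ((2 ^ 2) ^ (α / 4) * (2 ^ 2) ^ (α / 4)) with hk
  have hk0 : 0 < k := by positivity
  refine KT3 (meas_cut hP (meas_mul0 _ _ _)) hb₁ hb₂ (ENNReal.ofReal k * C) (by finiteness) ?_ ?_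
  · intro x z
    by_cases h1 : P x z
    · by_cases h2 : P z x
      · exfalso
        have := norm_add_ge (hin x z z x h1 h2)
        have h3 := hsub x z h1
        linarith [norm_nonneg (x + z)]
      · rw [cut_neg h2, mul_zero]
    · rw [cut_neg h1, zero_mul]
  intro x w hxw
  by_cases hN : 0 < ‖x‖ ∧ 0 < ‖w‖
  swap
  · refine ⟨0, measurable_zero, fun z => ?_, by simp⟩
    refine le_trans (le_of_eq ?_) zero_le
    by_cases h1 : P x (z + w - x)
    · by_cases h2 : P z w
      · exfalso
        have h3 := hsub _ _ h1
        have h4 := hsub _ _ h2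
        exact hN ⟨by linarith [norm_nonneg (x + (z + w - x))], by linarith [norm_nonneg (z + w)]⟩
      · rw [cut_neg h2]; simp
    · rw [cut_neg h1]; simp
  obtain ⟨hx0, hw0⟩ := hN
  obtain ⟨φ, hφ, hφ1, hφ2⟩ := H ‖x‖ ‖w‖ hx0 hw0
  set A : ℝ := min ‖x‖ ‖w‖ * (‖x‖ * ‖w‖) ^ (-α) with hA
  have hA0 : 0 ≤ A := by positivity
  refine ⟨fun r => ENNReal.ofReal (k * A) * φ r, hφ.const_mul _, fun z => ?_, ?_⟩
  · by_cases h1 : P x (z + w - x)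
    swap
    · rw [cut_neg h1]; simp
    by_cases h2 : P z w
    swap
    · rw [cut_neg h2]; simp
    have hs : x + (z + w - x) = z + w := by abel
    have hφ3 := hφ1 x _ z w h1 h2 hs rfl rfl
    rw [cut_pos h1, cut_pos h2]
    have h3 := hsub _ _ h1
    have h4 := hsub _ _ h2
    have hg := geo hs h3.1 h4.2 (hin _ _ _ _ h1 h2)
    set y := z + w - x with hy
    refine le_trans ?_ (mul_le_mul_right (mul_le_mul_right hφ3 _) _)
    rw [← ENNReal.ofReal_mul (mul0_pos _ _ _ _ _).le,
      ← ENNReal.ofReal_mul (mul_pos (mul0_pos _ _ _ _ _) (mul0_pos _ _ _ _ _)).le,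
      ← ENNReal.ofReal_mul (by positivity), ← ENNReal.ofReal_mul (by positivity)]
    refine ENNReal.ofReal_le_ofReal ?_
    have d1 : ‖x‖ ≤ 2 * ‖y‖ := by
      have := norm_sub_le (x + y) y
      rw [show x + y - y = x by abel] at this
      linarith [h3.2, norm_nonneg y]
    have d2 : ‖w‖ ≤ 2 * ‖z‖ := by
      have := norm_sub_le (z + w) z
      rw [show z + w - z = w by abel] at this
      linarith [h4.1, norm_nonneg z]
    have c1 := J_anti (q := α / 4) (by linarith) (by norm_num) (norm_nonneg x) d1
    have c2 := J_anti (q := α / 4) (by linarith) (by norm_num) (norm_nonneg w) d2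
    have c3 := J_le_pow (q := α / 2) (by linarith) hx0
    have c4 := J_le_pow (q := α / 2) (by linarith) hw0
    rw [show 2 * (α / 2) = α by ring] at c3 c4
    have e3 : J (-(α / 2)) ‖x‖ = J (-(α / 4)) ‖x‖ * J (-(α / 4)) ‖x‖ := by
      rw [← J_add]; congr 1; ring
    have e4 : J (-(α / 2)) ‖w‖ = J (-(α / 4)) ‖w‖ * J (-(α / 4)) ‖w‖ := by
      rw [← J_add]; congr 1; ring
    have e5 : J (-s) ‖z + w‖ = J (-s / 2) ‖z + w‖ * J (-s / 2) ‖z + w‖ := by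
      rw [← J_add]; congr 1; ring
    have e6 : (‖x‖ * ‖w‖) ^ (-α) = ‖x‖ ^ (-α) * ‖w‖ ^ (-α) :=
      Real.mul_rpow (norm_nonneg _) (norm_nonneg _)
    simp only [mul0, hs]
    rw [show -(α / 2) / 2 = -(α / 4) by ring]
    have p1 := J_pos (-(α / 4)) ‖x‖
    have p2 := J_pos (-(α / 4)) ‖y‖
    have p3 := J_pos (-(α / 4)) ‖z‖
    have p4 := J_pos (-(α / 4)) ‖w‖
    have p5 := J_pos (-s / 2) ‖z + w‖
    have p6 := J_pos (-s) ‖z + w‖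
    calc _ = J (-s) ‖z + w‖ * (J (-(α / 4)) ‖x‖ * J (-(α / 4)) ‖y‖ * (J (-(α / 4)) ‖z‖ *
            J (-(α / 4)) ‖w‖)) * (‖z‖ * ‖y‖) := by rw [e5]; ring
      _ ≤ J (-s) ‖z + w‖ * (J (-(α / 4)) ‖x‖ * ((2 ^ 2) ^ (α / 4) * J (-(α / 4)) ‖x‖) *
            (((2 ^ 2) ^ (α / 4) * J (-(α / 4)) ‖w‖) * J (-(α / 4)) ‖w‖)) *
            (‖x - w‖ * (3 * min ‖x‖ ‖w‖)) := by gcongr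
      _ = k * J (-s) ‖z + w‖ * (J (-(α / 2)) ‖x‖ * J (-(α / 2)) ‖w‖) *
            (‖x - w‖ * min ‖x‖ ‖w‖) := by rw [e3, e4, hk]; ring
      _ ≤ k * J (-s) ‖z + w‖ * (‖x‖ ^ (-α) * ‖w‖ ^ (-α)) * (‖x - w‖ * min ‖x‖ ‖w‖) := by
          have p7 := J_pos (-(α / 2)) ‖w‖
          gcongr
      _ = _ := by rw [hA, e6]; ring
  · rw [lintegral_const_mul _ hφ, ENNReal.ofReal_mul hk0.le, mul_assoc]
    gcongr

/-- octant predicate -/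
def oct (ε : Fin 3 → ℝ) (x : E3) : Prop := ∀ i, 0 ≤ ε i * x i

theorem oct_inner {ε : Fin 3 → ℝ} (hε : ∀ i, ε i ^ 2 = 1) {x z : E3} (hx : oct ε x)
    (hz : oct ε z) : 0 ≤ inner ℝ x z := by
  simp only [PiLp.inner_apply]
  refine Finset.sum_nonneg fun i _ => ?_
  have := mul_nonneg (hx i) (hz i)
  have e : ε i * x i * (ε i * z i) = ε i ^ 2 * (x i * z i) := by ring
  rw [e, hε, one_mul] at this
  simpa [mul_comm] using this

theorem meas_sgn (ε : ℝ) (i : Fin 3) : MeasurableSet {p : E3 × E3 | 0 ≤ ε * p.1 i} :=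
  measurableSet_le (by fun_prop) (by fun_prop)

theorem meas_oct (ε : Fin 3 → ℝ) : MeasurableSet {p : E3 × E3 | oct ε p.1} := by
  have : {p : E3 × E3 | oct ε p.1} = ⋂ i, {p : E3 × E3 | 0 ≤ ε i * p.1 i} := by
    ext p; simp [oct]
  rw [this]
  exact MeasurableSet.iInter fun i => meas_sgn _ _

theorem split1 {P : E3 → E3 → Prop} (hP : MeasurableSet {p : E3 × E3 | P p.1 p.2})
    {f : E3 → E3 → ℝ} (hf : Measurable fun p : E3 × E3 => f p.1 p.2) {b₁ b₂ : ℝ} (i : Fin 3)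
    (h : ∀ ε : ℝ, ε ^ 2 = 1 → Bdd (KK (cut (fun x y => P x y ∧ 0 ≤ ε * x i) f) b₁ b₂)) :
    Bdd (KK (cut P f) b₁ b₂) := by
  refine cut_or (P1 := fun x y => P x y ∧ 0 ≤ 1 * x i) (hP.inter (meas_sgn 1 i)) hf (h 1 (by norm_num)) (h (-1) (by norm_num)) ?_
  intro x y hp
  rcases le_total 0 (x i) with h | h
  · exact Or.inl ⟨hp, by linarith⟩
  · exact Or.inr ⟨hp, by linarith⟩

theorem oct_split {P : E3 → E3 → Prop} (hP : MeasurableSet {p : E3 × E3 | P p.1 p.2})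
    {f : E3 → E3 → ℝ} (hf : Measurable fun p : E3 × E3 => f p.1 p.2) 
    {b₁ b₂ : ℝ}
    (h : ∀ ε : Fin 3 → ℝ, (∀ i, ε i ^ 2 = 1) →
      Bdd (KK (cut (fun x y => P x y ∧ oct ε x) f) b₁ b₂)) :
    Bdd (KK (cut P f) b₁ b₂) := by
  refine split1 hP hf 0 fun ε₀ h0 => ?_
  refine split1 (P := fun x y => P x y ∧ 0 ≤ ε₀ * x 0) (hP.inter (meas_sgn ε₀ 0)) hf 1 fun ε₁ h1 => ?_
  refine split1 (P := fun x y => (P x y ∧ 0 ≤ ε₀ * x 0) ∧ 0 ≤ ε₁ * x 1)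
    ((hP.inter (meas_sgn ε₀ 0)).inter (meas_sgn ε₁ 1)) hf 2 fun ε₂ h2 => ?_
  refine cut_mono 1 zero_le_one (h ![ε₀, ε₁, ε₂] ?_) ?_
  · intro i; fin_cases i <;> assumption
  · rintro x y ⟨⟨⟨hp, q0⟩, q1⟩, q2⟩
    refine ⟨⟨hp, fun i => ?_⟩, by simp⟩
    fin_cases i <;> assumption

end WSP

namespace WSP
open MeasureTheory Set
open scoped ENNReal

/-- high-high to low region -/
def HH (x y : E3) : Prop := 4 * ‖x + y‖ < ‖x‖ ∧ 4 * ‖x + y‖ < ‖y‖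

theorem meas_HH : MeasurableSet {p : E3 × E3 | HH p.1 p.2} := by
  have h1 : MeasurableSet {p : E3 × E3 | 4 * ‖p.1 + p.2‖ < ‖p.1‖} :=
    measurableSet_lt (by fun_prop) (by fun_prop)
  have h2 : MeasurableSet {p : E3 × E3 | 4 * ‖p.1 + p.2‖ < ‖p.2‖} :=
    measurableSet_lt (by fun_prop) (by fun_prop)
  exact h1.inter h2

theorem HH_x {x y : E3} (h : HH x y) : ‖x‖ ≤ 2 * ‖y‖ := by
  have := norm_sub_le (x + y) y
  rw [show x + y - y = x by abel] at this
  linarith [h.2, norm_nonneg y]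

theorem HH_y {x y : E3} (h : HH x y) : ‖y‖ ≤ 2 * ‖x‖ := by
  have := norm_sub_le (x + y) x
  rw [show x + y - x = y by abel] at this
  linarith [h.1, norm_nonneg x]

theorem HH_red {s₀ s₁ s₂ s α b₁ b₂ : ℝ} (h1 : s + α ≤ s₀ + s₁ + s₂) (h2 : α ≤ s₁ + s₂)
    (h : Bdd (KK (cut HH (mul0 s (α / 2) (α / 2))) b₁ b₂)) :
    Bdd (KK (cut HH (mul0 s₀ s₁ s₂)) b₁ b₂) := by
  refine cut_mono ((2 ^ 2) ^ |(-s₂ / 2)| * (2 ^ 2) ^ |(-(α / 2) / 2)|) (by positivity) h ?_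
  intro x y hh
  refine ⟨hh, ?_⟩
  have c1 := J_comp (p := -s₂ / 2) (by norm_num) (norm_nonneg _) (norm_nonneg _) (HH_y hh) (HH_x hh)
  have c2 := J_comp (p := -(α / 2) / 2) (by norm_num) (norm_nonneg _) (norm_nonneg _)
    (HH_x hh) (HH_y hh)
  have hR : ‖x + y‖ ≤ ‖x‖ := by linarith [hh.1, norm_nonneg (x + y)]
  have c3 := J_trade (s := s₀ / 2) (α := (s₁ + s₂) / 2) (s' := s / 2) (α' := α / 2)
    (norm_nonneg _) hR (by linarith) (by linarith)
  have e1 : J (-((s₁ + s₂) / 2)) ‖x‖ = J (-s₁ / 2) ‖x‖ * J (-s₂ / 2) ‖x‖ := by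
    rw [← J_add]; congr 1; ring
  have e2 : J (-(α / 2)) ‖x‖ = J (-(α / 2) / 2) ‖x‖ * J (-(α / 2) / 2) ‖x‖ := by
    rw [← J_add]; congr 1; ring
  rw [show -(s₀ / 2) = -s₀ / 2 by ring, show -(s / 2) = -s / 2 by ring] at c3
  have p0 := J_pos (-s₀ / 2) ‖x + y‖
  have p1 := J_pos (-s₁ / 2) ‖x‖
  have p2 := J_pos (-(α / 2) / 2) ‖x‖
  have p3 := J_pos (-s / 2) ‖x + y‖
  unfold mul0
  calc _ ≤ J (-s₀ / 2) ‖x + y‖ * J (-s₁ / 2) ‖x‖ * ((2 ^ 2) ^ |(-s₂ / 2)| * J (-s₂ / 2) ‖x‖) := by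
        gcongr
    _ = (2 ^ 2) ^ |(-s₂ / 2)| * (J (-s₀ / 2) ‖x + y‖ * J (-((s₁ + s₂) / 2)) ‖x‖) := by
        rw [e1]; ring
    _ ≤ (2 ^ 2) ^ |(-s₂ / 2)| * (J (-s / 2) ‖x + y‖ * J (-(α / 2)) ‖x‖) := by
        exact mul_le_mul_of_nonneg_left c3 (by positivity)
    _ = (2 ^ 2) ^ |(-s₂ / 2)| * (J (-s / 2) ‖x + y‖ *
          (J (-(α / 2) / 2) ‖x‖ * J (-(α / 2) / 2) ‖x‖)) := by rw [e2]
    _ ≤ (2 ^ 2) ^ |(-s₂ / 2)| * (J (-s / 2) ‖x + y‖ *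
          (J (-(α / 2) / 2) ‖x‖ * ((2 ^ 2) ^ |(-(α / 2) / 2)| * J (-(α / 2) / 2) ‖y‖))) := by
        gcongr
    _ = _ := by ring

theorem HHA {s b₁ b₂ : ℝ} (hb₁ : 1 / 2 < b₁) (hb₂ : 1 / 2 < b₂) (hs : 3 / 2 < s) :
    Bdd (KK (cut HH (mul0 s (0 / 2) (0 / 2))) b₁ b₂) := by
  have hI := (integrable_rpow_neg_one_add_norm_sq (E := E3) (μ := volume) (r := 2 * s)
    (by simp; linarith)).lintegral_lt_top
  refine KT2 (meas_cut meas_HH (meas_mul0 _ _ _)) hb₁ hb₂ _ hI.ne fun y => ?_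
  refine le_trans ?_ (le_of_eq (lintegral_add_right_eq_self
    (fun x : E3 => ENNReal.ofReal ((1 + ‖x‖ ^ 2) ^ (-(2 * s) / 2))) y))
  refine lintegral_mono fun x => ?_
  by_cases h : HH x y
  · rw [cut_pos h, ← ENNReal.ofReal_pow (mul0_pos _ _ _ _ _).le]
    refine ENNReal.ofReal_le_ofReal (le_of_eq ?_)
    unfold mul0
    simp only [mul_pow, J_sq]
    simp [J]
    congr 1; ring
  · rw [cut_neg h]; simp

/-- very low output frequency -/
theorem HHB1 {s b₁ b₂ : ℝ} (hb₁ : 1 / 2 < b₁) (hb₂ : 1 / 2 < b₂) (hs0 : 0 ≤ s) (hs : s < 3 / 2) :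
    Bdd (KK (cut (fun x y => HH x y ∧ ‖x + y‖ ^ 2 ≤ ‖y‖)
      (mul0 s ((3 / 2 - s) / 2 / 2) ((3 / 2 - s) / 2 / 2))) b₁ b₂) := by
  obtain ⟨C, hC, hI⟩ := ball_int (q := 2 * s) (by linarith)
  set α := (3 / 2 - s) / 2 with hα
  have hα0 : 0 < α := by rw [hα]; linarith
  have hP : MeasurableSet {p : E3 × E3 | HH p.1 p.2 ∧ ‖p.1 + p.2‖ ^ 2 ≤ ‖p.2‖} :=
    meas_HH.inter (measurableSet_le (f := fun p : E3 × E3 => ‖p.1 + p.2‖ ^ 2)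
      (g := fun p : E3 × E3 => ‖p.2‖) (by fun_prop) (by fun_prop))
  refine KT2 (meas_cut hP (meas_mul0 _ _ _)) hb₁ hb₂ (ENNReal.ofReal ((2 ^ 2) ^ (α / 2)) * C)
    (by finiteness) fun y => ?_
  by_cases hy : y = 0
  · refine le_trans (le_of_eq ?_) zero_le
    rw [lintegral_eq_zero_iff']
    · filter_upwards with x
      rw [cut_neg]
      · simp
      · rintro ⟨h, _⟩
        have := h.2
        simp only [hy, add_zero, norm_zero] at this
        linarith [norm_nonneg x]
    · exact (((meas_cut (P := fun x y => HH x y ∧ ‖x + y‖ ^ 2 ≤ ‖y‖) hP (meas_mul0 _ _ _)).comp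
        (measurable_id.prodMk measurable_const)).pow_const 2).aemeasurable
  have hy0 : 0 < ‖y‖ := norm_pos_iff.2 hy
  let g : E3 → ℝ≥0∞ := {x : E3 | ‖x‖ ≤ √‖y‖}.indicator fun x => ENNReal.ofReal (‖x‖ ^ (-(2 * s)))
  have hg : ∀ᵐ x : E3, cut (fun x y => HH x y ∧ ‖x + y‖ ^ 2 ≤ ‖y‖) (mul0 s (α / 2) (α / 2)) x y ^ 2
      ≤ ENNReal.ofReal ((2 ^ 2) ^ (α / 2) * ‖y‖ ^ (-(2 * α))) * g (x + y) := by
    filter_upwards [Measure.ae_ne volume (-y)] with x hx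
    by_cases h : HH x y ∧ ‖x + y‖ ^ 2 ≤ ‖y‖
    · have hxy : 0 < ‖x + y‖ := norm_pos_iff.2 fun h => hx (eq_neg_of_add_eq_zero_left h)
      rw [cut_pos h]
      have : x + y ∈ {x : E3 | ‖x‖ ≤ √‖y‖} := Real.le_sqrt_of_sq_le h.2
      simp only [g]
      rw [indicator_of_mem this, ← ENNReal.ofReal_pow (mul0_pos _ _ _ _ _).le,
        ← ENNReal.ofReal_mul (by positivity)]
      refine ENNReal.ofReal_le_ofReal ?_
      unfold mul0
      simp only [mul_pow, J_sq]
      have c1 := J_le_pow hs0 hxy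
      have c2 := J_anti (q := α / 2) (by linarith) (by norm_num) (norm_nonneg _) (HH_y h.1)
      have c3 := J_le_pow hα0.le hy0
      have e : J (-α) ‖y‖ = J (-(α / 2)) ‖y‖ * J (-(α / 2)) ‖y‖ := by
        rw [← J_add]; congr 1; ring
      have p0 := J_pos (-s) ‖x + y‖
      have p1 := J_pos (-(α / 2)) ‖x‖
      have p2 := J_pos (-(α / 2)) ‖y‖
      calc _ ≤ ‖x + y‖ ^ (-(2 * s)) * ((2 ^ 2) ^ (α / 2) * J (-(α / 2)) ‖y‖) *
            J (-(α / 2)) ‖y‖ := by gcongr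
        _ = (2 ^ 2) ^ (α / 2) * J (-α) ‖y‖ * ‖x + y‖ ^ (-(2 * s)) := by rw [e]; ring
        _ ≤ _ := by gcongr
    · rw [cut_neg h]; simp
  refine (lintegral_mono_ae hg).trans ?_
  rw [lintegral_const_mul' _ _ ENNReal.ofReal_ne_top, lintegral_add_right_eq_self g y]
  simp only [g]
  rw [lintegral_indicator (measurableSet_le (by fun_prop) (by fun_prop))]
  refine (mul_le_mul_right (hI _ (Real.sqrt_pos.2 hy0)) _).trans (le_of_eq ?_)
  have e : ‖y‖ ^ (-(2 * α)) * √‖y‖ ^ (3 - 2 * s) = 1 := by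
    rw [Real.sqrt_eq_rpow, ← Real.rpow_mul hy0.le, ← Real.rpow_add hy0, hα]
    ring_nf
    simp
  rw [mul_left_comm, ← ENNReal.ofReal_mul (by positivity), mul_assoc ((2 ^ 2 : ℝ) ^ (α / 2)), e,
    mul_one, mul_comm]

theorem u_le {z w : E3} : |‖z‖ - ‖w‖| ≤ ‖z + w‖ := by
  have := abs_norm_sub_norm_le z (-w)
  simpa using this

theorem HHC {s b₁ b₂ : ℝ} (hb₁ : 1 / 2 < b₁) (hb₂ : 1 / 2 < b₂) (hs0 : 0 ≤ s) (hs : s < 1 / 2) :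
    Bdd (KK (cut HH (mul0 s ((1 - s) / 2) ((1 - s) / 2))) b₁ b₂) := by
  refine oct_split meas_HH (meas_mul0 _ _ _) fun ε hε => ?_
  refine quad_red (P := fun x y => HH x y ∧ oct ε x) (meas_HH.inter (meas_oct ε)) hb₁ hb₂ (by linarith) (fun x y h => h.1)
    (fun x y z w h h' => oct_inner hε h.2 h'.2) (ENNReal.ofReal (2 / (1 - 2 * s)))
    ENNReal.ofReal_ne_top fun N₁ N₂ h₁ h₂ => ?_
  set m := min N₁ N₂ with hm
  have hm0 : 0 < m := lt_min h₁ h₂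
  let ψ : ℝ → ℝ≥0∞ := (Icc (-m) m).indicator fun u => ENNReal.ofReal (J (-s) u)
  have hψ : Measurable ψ := ((meas_J _).ennreal_ofReal).indicator measurableSet_Icc
  refine ⟨fun r => ψ (r - N₂), hψ.comp (by fun_prop), ?_, ?_⟩
  · intro x y z w h h' hs hx hw
    have hu := u_le (z := z) (w := w)
    have hR1 := h.1.1
    have hR2 := h'.1.2
    rw [hs, hx] at hR1
    rw [hw] at hR2 hu
    have hRm : ‖z + w‖ ≤ m := le_min (by linarith [norm_nonneg (z + w)])
      (by linarith [norm_nonneg (z + w)])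
    have hmem : ‖z‖ - N₂ ∈ Icc (-m) m := abs_le.1 (hu.trans hRm)
    simp only [ψ]
    rw [indicator_of_mem hmem]
    refine ENNReal.ofReal_le_ofReal ?_
    have := J_anti (q := s) (K := 1) hs0 le_rfl (abs_nonneg (‖z‖ - N₂)) (by linarith)
    simpa [J] using this
  · have i1 : ∫⁻ r in Ioi (0:ℝ), ψ (r - N₂) ≤ ∫⁻ r, ψ r :=
      (setLIntegral_le_lintegral _ _).trans (le_of_eq (lintegral_sub_right_eq_self ψ N₂))
    have i2 : ∫⁻ r in Ioc 0 m, ENNReal.ofReal (J (-s) r) ≤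
        ENNReal.ofReal (m ^ (1 - 2 * s) / (1 - 2 * s)) := by
      rw [← pow_int (by linarith) hm0.le]
      refine setLIntegral_mono (by fun_prop) fun r hr => ENNReal.ofReal_le_ofReal ?_
      have := J_le_pow hs0 hr.1
      rwa [show 1 - 2 * s - 1 = -(2 * s) by ring]
    have i3 : ∫⁻ r, ψ r ≤ 2 * ENNReal.ofReal (m ^ (1 - 2 * s) / (1 - 2 * s)) := by
      simp only [ψ]
      have hsym : ∫⁻ r in Ico (-m) 0, ENNReal.ofReal (J (-s) r) =
          ∫⁻ r in Ioc 0 m, ENNReal.ofReal (J (-s) r) := by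
        rw [← lintegral_indicator measurableSet_Ico, ← lintegral_indicator measurableSet_Ioc,
          ← lintegral_neg_eq_self]
        refine lintegral_congr fun r => ?_
        simp only [indicator, mem_Ico, mem_Ioc, J, neg_sq, neg_lt_zero, neg_le_neg_iff]
        simp only [and_comm]
      have hsplit : ∫⁻ r in Icc (-m) m, ENNReal.ofReal (J (-s) r) ≤
          (∫⁻ r in Ico (-m) 0, ENNReal.ofReal (J (-s) r)) +
          ∫⁻ r in Icc 0 m, ENNReal.ofReal (J (-s) r) := by
        refine le_trans (lintegral_mono_set ?_) (lintegral_union_le _ _ _)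
        intro r hr
        rcases lt_or_ge r 0 with h | h
        · exact Or.inl ⟨hr.1, h⟩
        · exact Or.inr ⟨h, hr.2⟩
      rw [lintegral_indicator measurableSet_Icc]
      rw [setLIntegral_congr (Ioc_ae_eq_Icc (a := (0:ℝ)) (b := m)).symm, hsym] at hsplit
      refine hsplit.trans ?_
      rw [two_mul]
      gcongr
    refine (mul_le_mul_right (i1.trans i3) _).trans ?_
    rw [show (2:ℝ≥0∞) = ENNReal.ofReal 2 by simp, ← ENNReal.ofReal_mul (by norm_num),
      ← ENNReal.ofReal_mul (by positivity)]
    refine ENNReal.ofReal_le_ofReal ?_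
    set M := max N₁ N₂ with hM
    have hmM : m ≤ M := min_le_max
    have hM0 : 0 < M := by linarith
    have e1 : N₁ * N₂ = m * M := (min_mul_max _ _).symm
    have key := mM hm0 hmM (p := 1 - s) (by linarith)
    have e2 : m * (N₁ * N₂) ^ (-(1 - s)) * m ^ (1 - 2 * s) = m ^ (1 - s) * M ^ (-(1 - s)) := by
      rw [e1, Real.mul_rpow hm0.le hM0.le]
      have : m * m ^ (-(1 - s)) * m ^ (1 - 2 * s) = m ^ (1 - s) := by
        nth_rewrite 1 [← Real.rpow_one m]
        rw [← Real.rpow_add hm0, ← Real.rpow_add hm0]; congr 1; ring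
      rw [← this]; ring
    have h12 : 0 < 1 - 2 * s := by linarith
    calc _ = (m * (N₁ * N₂) ^ (-(1 - s)) * m ^ (1 - 2 * s)) * (2 / (1 - 2 * s)) := by ring
      _ ≤ 1 * (2 / (1 - 2 * s)) := by rw [e2]; gcongr
      _ = _ := one_mul _

theorem HHB2 {s b₁ b₂ : ℝ} (hb₁ : 1 / 2 < b₁) (hb₂ : 1 / 2 < b₂) (hs0 : 1 / 2 < s) (hs : s < 3 / 2) :
    Bdd (KK (cut (fun x y => HH x y ∧ ‖y‖ < ‖x + y‖ ^ 2)
      (mul0 s ((3 / 2 - s) / 2 / 2) ((3 / 2 - s) / 2 / 2))) b₁ b₂) := by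
  set α := (3 / 2 - s) / 2 with hα
  have hα0 : 0 < α := by rw [hα]; linarith
  have hP : MeasurableSet {p : E3 × E3 | HH p.1 p.2 ∧ ‖p.2‖ < ‖p.1 + p.2‖ ^ 2} :=
    meas_HH.inter (measurableSet_lt (f := fun p : E3 × E3 => ‖p.2‖)
      (g := fun p : E3 × E3 => ‖p.1 + p.2‖ ^ 2) (by fun_prop) (by fun_prop))
  refine oct_split hP (meas_mul0 _ _ _) fun ε hε => ?_
  refine quad_red (P := fun x y => (HH x y ∧ ‖y‖ < ‖x + y‖ ^ 2) ∧ oct ε x) (hP.inter (meas_oct ε)) hb₁ hb₂ hα0.le (fun x y h => h.1.1)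
    (fun x y z w h h' => oct_inner hε h.2 h'.2)
    (ENNReal.ofReal (2 ^ s * (1 / 2) ^ (1 / 2 - s)) * Cm s)
    (ENNReal.mul_ne_top ENNReal.ofReal_ne_top (Cm_ne_top hs0)) fun N₁ N₂ h₁ h₂ => ?_
  set m := min N₁ N₂ with hm
  set M := max N₁ N₂ with hM
  have hm0 : 0 < m := lt_min h₁ h₂
  have hmM : m ≤ M := min_le_max
  have hM0 : 0 < M := by linarith
  set lam := √(1 / 2 * M) with hl
  have hl0 : 0 < lam := Real.sqrt_pos.2 (by positivity)
  have hl2 : lam ^ 2 = 1 / 2 * M := Real.sq_sqrt (by positivity)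
  let ψ : ℝ → ℝ≥0∞ := fun u => ENNReal.ofReal (2 ^ s * lam ^ (-(2 * s))) *
    ENNReal.ofReal ((1 + (lam⁻¹ * u) ^ 2) ^ (-s))
  have hψ : Measurable ψ := by fun_prop
  refine ⟨fun r => ψ (r - N₂), hψ.comp (by fun_prop), ?_, ?_⟩
  · intro x y z w h h' hs hx hw
    have hu := u_le (z := z) (w := w)
    have hR1 := h.1.2
    have hR2 := h'.1.2
    have hxy := HH_x h.1.1
    rw [hs] at hR1
    rw [hx] at hxy
    rw [hw] at hR2 hu
    have hRM : lam ^ 2 ≤ ‖z + w‖ ^ 2 := by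
      rw [hl2, hM]
      have : max N₁ N₂ ≤ 2 * ‖z + w‖ ^ 2 := max_le (by linarith) (by linarith)
      linarith
    have hu2 : (‖z‖ - N₂) ^ 2 ≤ ‖z + w‖ ^ 2 := by
      rw [← sq_abs (‖z‖ - N₂)]
      gcongr
    simp only [ψ]
    rw [← ENNReal.ofReal_mul (by positivity)]
    refine ENNReal.ofReal_le_ofReal ?_
    set u := ‖z‖ - N₂
    have e1 : 2 ^ s * lam ^ (-(2 * s)) * (1 + (lam⁻¹ * u) ^ 2) ^ (-s) =
        ((lam ^ 2 + u ^ 2) / 2) ^ (-s) := by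
      have e0 : (lam ^ 2 + u ^ 2) / 2 = 2⁻¹ * (lam ^ 2 * (1 + (lam⁻¹ * u) ^ 2)) := by
        field_simp
      have hq : 0 ≤ 1 + (lam⁻¹ * u) ^ 2 := add_nonneg zero_le_one (sq_nonneg _)
      have hl2' : 0 ≤ lam ^ 2 := sq_nonneg _
      have h2 : (2⁻¹:ℝ) ^ (-s) = 2 ^ s := by
        rw [Real.inv_rpow (by norm_num), Real.rpow_neg (by norm_num), inv_inv]
      have h3 : (lam ^ 2) ^ (-s) = lam ^ (-(2 * s)) := by
        rw [← Real.rpow_natCast, ← Real.rpow_mul hl0.le]; congr 1; push_cast; ring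
      rw [e0, Real.mul_rpow (by norm_num) (mul_nonneg hl2' hq), Real.mul_rpow hl2' hq, h2, h3]
      ring
    rw [e1]
    unfold J
    refine Real.rpow_le_rpow_of_nonpos (by positivity) ?_ (by linarith)
    linarith
  · have i1 : ∫⁻ r in Ioi (0:ℝ), ψ (r - N₂) ≤ ∫⁻ r, ψ r :=
      (setLIntegral_le_lintegral _ _).trans (le_of_eq (lintegral_sub_right_eq_self ψ N₂))
    have i2 : ∫⁻ r, ψ r = ENNReal.ofReal (2 ^ s * lam ^ (-(2 * s))) *
        (ENNReal.ofReal lam * Cm s) := by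
      simp only [ψ]
      rw [lintegral_const_mul' _ _ ENNReal.ofReal_ne_top]
      congr 1
      have hmf : Measurable fun u : ℝ => ENNReal.ofReal ((1 + u ^ 2) ^ (-s)) := by fun_prop
      have := Real.map_volume_mul_left (inv_pos.2 hl0).ne'
      have h2 := lintegral_map (μ := volume) hmf (measurable_const_mul lam⁻¹)
      rw [this, lintegral_smul_measure] at h2
      rw [← h2, inv_inv, abs_of_pos hl0]
      rfl
    refine (mul_le_mul_right (i1.trans i2.le) _).trans ?_
    rw [← mul_assoc, ← mul_assoc, ← ENNReal.ofReal_mul (by positivity),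
      ← ENNReal.ofReal_mul (by positivity)]
    refine mul_le_mul' (ENNReal.ofReal_le_ofReal ?_) le_rfl
    have e1 : N₁ * N₂ = m * M := (min_mul_max _ _).symm
    have key := mM hm0 hmM (p := 1 - α) (by rw [hα]; linarith)
    have e3 : lam ^ (-(2 * s)) * lam = (1 / 2) ^ (1 / 2 - s) * M ^ (1 / 2 - s) := by
      nth_rewrite 2 [← Real.rpow_one lam]
      rw [← Real.rpow_add hl0, hl, Real.sqrt_eq_rpow, ← Real.rpow_mul (by positivity),
        ← Real.mul_rpow (by positivity) (by positivity)]
      congr 1; ring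
    have e2 : m * (N₁ * N₂) ^ (-α) * M ^ (1 / 2 - s) = m ^ (1 - α) * M ^ (-(1 - α)) := by
      rw [e1, Real.mul_rpow hm0.le hM0.le]
      have t1 : m * m ^ (-α) = m ^ (1 - α) := by
        nth_rewrite 1 [← Real.rpow_one m]
        rw [← Real.rpow_add hm0]; congr 1
      have t2 : M ^ (-α) * M ^ (1 / 2 - s) = M ^ (-(1 - α)) := by
        rw [← Real.rpow_add hM0]; congr 1; rw [hα]; ring
      rw [← t1, ← t2]; ring
    calc _ = (m * (N₁ * N₂) ^ (-α)) * 2 ^ s * (lam ^ (-(2 * s)) * lam) := by ring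
      _ = (m * (N₁ * N₂) ^ (-α) * M ^ (1 / 2 - s)) * (2 ^ s * (1 / 2) ^ (1 / 2 - s)) := by
          rw [e3]; ring
      _ ≤ 1 * (2 ^ s * (1 / 2) ^ (1 / 2 - s)) := by rw [e2]; gcongr
      _ = _ := one_mul _

theorem HHB {s b₁ b₂ : ℝ} (hb₁ : 1 / 2 < b₁) (hb₂ : 1 / 2 < b₂) (hs0 : 1 / 2 < s) (hs : s < 3 / 2) :
    Bdd (KK (cut HH (mul0 s ((3 / 2 - s) / 2 / 2) ((3 / 2 - s) / 2 / 2))) b₁ b₂) := by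
  have hP : MeasurableSet {p : E3 × E3 | HH p.1 p.2 ∧ ‖p.2‖ < ‖p.1 + p.2‖ ^ 2} :=
    meas_HH.inter (measurableSet_lt (f := fun p : E3 × E3 => ‖p.2‖)
      (g := fun p : E3 × E3 => ‖p.1 + p.2‖ ^ 2) (by fun_prop) (by fun_prop))
  refine cut_or hP (meas_mul0 _ _ _) (HHB2 hb₁ hb₂ hs0 hs) (HHB1 hb₁ hb₂ (by linarith) hs) ?_
  intro x y h
  rcases lt_or_ge ‖y‖ (‖x + y‖ ^ 2) with h1 | h1
  · exact Or.inl ⟨h, h1⟩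
  · exact Or.inr ⟨h, h1⟩

theorem HH_all {s₀ s₁ s₂ b₁ b₂ : ℝ} (hb₁ : 1 / 2 < b₁) (hb₂ : 1 / 2 < b₂)
    (h419 : s₀ + s₁ + s₂ ≥ 1)
    (h420 : s₀ + 2 * (s₁ + s₂) ≥ 3 / 2)
    (h421 : s₁ + s₂ ≥ 0) (hst : s₀ = 1 / 2 ∨ s₀ = 3 / 2 → s₀ + 2 * (s₁ + s₂) > 3 / 2) :
    Bdd (KK (cut HH (mul0 s₀ s₁ s₂)) b₁ b₂) := by
  rcases lt_trichotomy s₀ (3 / 2) with h | h | h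
  · rcases lt_trichotomy s₀ (1 / 2) with h' | h' | h'
    · rcases le_total (0:ℝ) s₀ with h'' | h''
      · exact HH_red (by linarith) (by linarith) (HHC hb₁ hb₂ h'' h')
      · exact HH_red (s := 0) (by linarith) (by linarith) (HHC hb₁ hb₂ le_rfl (by norm_num))
    · have := hst (Or.inl h')
      set e := min (s₁ + s₂ - 1 / 2) (1 / 2) with he
      have e0 : 0 < e := lt_min (by linarith) (by norm_num)
      have e1 : e ≤ s₁ + s₂ - 1 / 2 := min_le_left _ _
      have e2 : e ≤ 1 / 2 := min_le_right _ _
      exact HH_red (s := 1 / 2 + e) (by linarith) (by linarith)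
        (HHB hb₁ hb₂ (by linarith) (by linarith))
    · exact HH_red (by linarith) (by linarith) (HHB hb₁ hb₂ h' h)
  · have := hst (Or.inr h)
    set e := min (s₁ + s₂) (1 / 4) with he
    have e0 : 0 < e := lt_min (by linarith) (by norm_num)
    have e1 : e ≤ s₁ + s₂ := min_le_left _ _
    have e2 : e ≤ 1 / 4 := min_le_right _ _
    exact HH_red (s := 3 / 2 - 2 * e) (by linarith) (by linarith)
      (HHB hb₁ hb₂ (by linarith) (by linarith))
  · exact HH_red (by linarith) (by linarith) (HHA hb₁ hb₂ h)

theorem main_bdd {s₀ s₁ s₂ b₁ b₂ : ℝ} (hb₁ : 1 / 2 < b₁) (hb₂ : 1 / 2 < b₂)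
    (h419 : s₀ + s₁ + s₂ ≥ 1)
    (h420 : s₀ + 2 * (s₁ + s₂) ≥ 3 / 2)
    (h421 : s₁ + s₂ ≥ 0) (h422 : s₀ + s₂ ≥ 0) (h423 : s₀ + s₁ ≥ 0)
    (hst : s₀ = 1 / 2 ∨ s₀ = 3 / 2 → s₀ + 2 * (s₁ + s₂) > 3 / 2)
    (hstrict : s₀ + s₁ + s₂ = 1 → s₁ + s₂ > 0 ∧ s₀ + s₂ > 0 ∧ s₀ + s₁ > 0) :
    Bdd (KK (fun x y => ENNReal.ofReal (mul0 s₀ s₁ s₂ x y)) b₁ b₂) := by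
  have hA := LH1 hb₁ hb₂ h419 h422 (by
    intro h
    by_contra h'
    have := hstrict (by linarith)
    linarith)
  have hB' := LH1 (s₀ := s₀) (s₁ := s₂) (s₂ := s₁) hb₂ hb₁ (by linarith) h423 (by
    intro h
    by_contra h'
    have := hstrict (by linarith)
    linarith)
  have hB : Bdd (KK (cut (fun x y => ‖y‖ ≤ ‖x‖ ∧ ‖y‖ ≤ 4 * ‖y + x‖) (mul0 s₀ s₁ s₂)) b₁ b₂) := by
    refine KK_swap ?_
    have e : (fun x y => cut (fun x y => ‖y‖ ≤ ‖x‖ ∧ ‖y‖ ≤ 4 * ‖y + x‖) (mul0 s₀ s₁ s₂) y x) =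
        cut (fun x y => ‖x‖ ≤ ‖y‖ ∧ ‖x‖ ≤ 4 * ‖x + y‖) (mul0 s₀ s₂ s₁) := by
      funext x y
      simp only [cut, mul0_swap s₀ s₁ s₂]
      by_cases h : ‖x‖ ≤ ‖y‖ ∧ ‖x‖ ≤ 4 * ‖x + y‖ <;> simp only [h, if_true, if_false]
    rw [e]
    exact hB'
  have hC := HH_all hb₁ hb₂ h419 h420 h421 hst
  have hBm : MeasurableSet {p : E3 × E3 | ‖p.2‖ ≤ ‖p.1‖ ∧ ‖p.2‖ ≤ 4 * ‖p.2 + p.1‖} :=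
    measurable_swap meas_LH
  have hT : Bdd (KK (cut (fun _ _ => True) (mul0 s₀ s₁ s₂)) b₁ b₂) := by
    refine cut_or meas_LH (meas_mul0 _ _ _) hA
      (cut_or (P := fun x y => ¬ (‖x‖ ≤ ‖y‖ ∧ ‖x‖ ≤ 4 * ‖x + y‖)) hBm (meas_mul0 _ _ _) hB hC ?_) ?_
    · intro x y h
      rw [add_comm y x]
      unfold HH
      by_contra h'
      grind
    · intro x y _
      exact em _
  convert hT using 4 with x y
  simp [cut]

end WSP

namespace WSP
open MeasureTheory Set
open scoped ENNReal FourierTransform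

abbrev E4 := EuclideanSpace ℝ (Fin 4)

/-- splitting coordinates -/
def Phi (a : V) : E4 :=
  WithLp.toLp 2 ((MeasurableEquiv.piFinSuccAbove (fun _ : Fin 4 => ℝ) 0).symm (a.1, WithLp.ofLp a.2))

theorem Phi_mp : MeasurePreserving Phi volume volume := by
  have h1 := PiLp.volume_preserving_toLp (Fin 4)
  have h2 := (volume_preserving_piFinSuccAbove (fun _ : Fin 4 => ℝ) 0).symm
  have h3 := (MeasurePreserving.id (volume : Measure ℝ)).prod (PiLp.volume_preserving_ofLp (Fin 3))
  exact h1.comp (h2.comp h3)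

theorem Phi_zero (a : V) : Phi a 0 = a.1 := rfl

theorem Phi_succ (a : V) (i : Fin 3) : Phi a i.succ = a.2 i := rfl

theorem Phi_space (a : V) : spacePart (Phi a) = a.2 := by
  ext i
  rfl

theorem Phi_sub (a b : V) : Phi (a - b) = Phi a - Phi b := by
  ext i
  refine Fin.cases ?_ (fun i => ?_) i <;> rfl

/-- the weight -/
def wt (s b : ℝ) (ζ : E4) : ℝ :=
  (1 + ‖spacePart ζ‖ ^ 2) ^ s * (1 + (|ζ 0| - ‖spacePart ζ‖) ^ 2) ^ b

theorem wt_pos (s b : ℝ) (ζ : E4) : 0 < wt s b ζ := by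
  unfold wt; positivity

theorem cont_space : Continuous spacePart := by
  unfold spacePart
  simp only [WithLp.equiv_symm_apply]
  fun_prop

theorem cont_wt (s b : ℝ) : Continuous (wt s b) := by
  have := cont_space
  unfold wt
  refine Continuous.mul ?_ ?_
  · exact Continuous.rpow_const (by fun_prop) fun x => Or.inl (by positivity)
  · exact Continuous.rpow_const (by fun_prop) fun x => Or.inl (by positivity)

theorem norm_sq_E4 (ζ : E4) : ‖ζ‖ ^ 2 = (ζ 0) ^ 2 + ‖spacePart ζ‖ ^ 2 := by
  rw [EuclideanSpace.real_norm_sq_eq, EuclideanSpace.real_norm_sq_eq, Fin.sum_univ_succ]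
  rfl

theorem wt_le (s b : ℝ) : ∃ n : ℕ, ∀ ζ, wt s b ζ ≤ (1 + ‖ζ‖) ^ n := by
  obtain ⟨n, hn⟩ := exists_nat_ge (|s| + |b|)
  refine ⟨2 * n, fun ζ => ?_⟩
  have h := norm_sq_E4 ζ
  have aux : ∀ q p : ℝ, 0 ≤ q → q ≤ ‖ζ‖ ^ 2 → (1 + q) ^ p ≤ (1 + ‖ζ‖ ^ 2) ^ |p| := by
    intro q p h0 h1
    calc (1 + q) ^ p ≤ (1 + q) ^ |p| :=
          Real.rpow_le_rpow_of_exponent_le (by linarith) (le_abs_self p)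
      _ ≤ _ := Real.rpow_le_rpow (by linarith) (by linarith) (abs_nonneg p)
  have a1 := aux (‖spacePart ζ‖ ^ 2) s (sq_nonneg _) (by nlinarith [sq_nonneg (ζ 0)])
  have a2 := aux ((|ζ 0| - ‖spacePart ζ‖) ^ 2) b (sq_nonneg _) (by
    nlinarith [sq_abs (ζ 0), mul_nonneg (abs_nonneg (ζ 0)) (norm_nonneg (spacePart ζ))])
  have hp : (1:ℝ) ≤ 1 + ‖ζ‖ ^ 2 := by nlinarith [sq_nonneg ‖ζ‖]
  unfold wt
  calc _ ≤ (1 + ‖ζ‖ ^ 2) ^ |s| * (1 + ‖ζ‖ ^ 2) ^ |b| := by gcongr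
    _ = (1 + ‖ζ‖ ^ 2) ^ (|s| + |b|) := (Real.rpow_add (by linarith) _ _).symm
    _ ≤ (1 + ‖ζ‖ ^ 2) ^ (n : ℝ) := Real.rpow_le_rpow_of_exponent_le hp hn
    _ = (1 + ‖ζ‖ ^ 2) ^ n := Real.rpow_natCast _ _
    _ ≤ ((1 + ‖ζ‖) ^ 2) ^ n := by
        gcongr
        nlinarith [norm_nonneg ζ]
    _ = _ := by rw [pow_mul]

theorem wt_int (s b : ℝ) (h : SchwartzMap E4 ℂ) :
    Integrable fun ζ => wt s b ζ * ‖h ζ‖ ^ 2 := by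
  obtain ⟨n, hn⟩ := wt_le s b
  have hc := fun ζ => SchwartzMap.one_add_le_sup_seminorm_apply (𝕜 := ℝ) (m := (n, 0)) le_rfl le_rfl h ζ
  set D := 2 ^ (n, 0).1 * ((Finset.Iic (n, 0)).sup fun m => SchwartzMap.seminorm ℝ m.1 m.2) h
  have hi : Integrable fun ζ => D * ‖h ζ‖ := h.integrable.norm.const_mul D
  refine hi.mono' ((cont_wt s b).mul (h.continuous.norm.pow 2)).aestronglyMeasurable ?_
  filter_upwards with ζ
  have h1 := hc ζ
  simp only [norm_iteratedFDeriv_zero] at h1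
  have hw := wt_pos s b ζ
  rw [Real.norm_of_nonneg (by positivity)]
  calc wt s b ζ * ‖h ζ‖ ^ 2 ≤ (1 + ‖ζ‖) ^ n * ‖h ζ‖ ^ 2 := by gcongr; exact hn ζ
    _ = ((1 + ‖ζ‖) ^ n * ‖h ζ‖) * ‖h ζ‖ := by ring
    _ ≤ _ := by gcongr

/-- the squared norm, transferred to the product space -/
def NN (s b : ℝ) (h : E4 → ℂ) : ℝ≥0∞ :=
  ∫⁻ a : V, ENNReal.ofReal (wt s b (Phi a) * ‖h (Phi a)‖ ^ 2)

theorem NN_eq (s b : ℝ) (h : E4 → ℂ) (hc : Continuous h) :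
    NN s b h = ∫⁻ ζ : E4, ENNReal.ofReal (wt s b ζ * ‖h ζ‖ ^ 2) := by
  refine Phi_mp.lintegral_comp (f := fun ζ => ENNReal.ofReal (wt s b ζ * ‖h ζ‖ ^ 2)) ?_
  exact ((cont_wt s b).mul (hc.norm.pow 2)).measurable.ennreal_ofReal

theorem norm_eq (s b : ℝ) (u : E4 → ℂ) (h : SchwartzMap E4 ℂ) (hu : 𝓕 u = ⇑h) :
    waveSobolevNorm s b u = (NN s b h).toReal ^ (1 / 2 : ℝ) := by
  unfold waveSobolevNorm
  rw [hu, NN_eq _ _ _ h.continuous]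
  congr 1
  exact integral_eq_lintegral_of_nonneg_ae
    (Filter.Eventually.of_forall fun ζ => mul_nonneg (wt_pos s b ζ).le (sq_nonneg _))
    ((cont_wt s b).mul (h.continuous.norm.pow 2)).aestronglyMeasurable

theorem NN_fin (s b : ℝ) (h : SchwartzMap E4 ℂ) : NN s b h ≠ ⊤ := by
  rw [NN_eq _ _ _ h.continuous]
  exact (wt_int s b h).lintegral_lt_top.ne

theorem conv_eq (f g : SchwartzMap E4 ℂ) :
    𝓕 (fun z => f z * g z) =
      ⇑(SchwartzMap.convolution (ContinuousLinearMap.mul ℂ ℂ) (𝓕 f) (𝓕 g)) := by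
  set c := SchwartzMap.convolution (ContinuousLinearMap.mul ℂ ℂ) (𝓕 f) (𝓕 g) with hc
  have key : ∀ f : SchwartzMap E4 ℂ, ∀ x, (𝓕 (𝓕 f)) (-x) = f x := by
    intro f x
    have : 𝓕⁻ (𝓕 f) = f := by simp
    nth_rewrite 2 [← this]
    rw [SchwartzMap.fourierInv_coe, Real.fourierInv_eq_fourier_neg, ← SchwartzMap.fourier_coe]
  have h1 : (fun z => f z * g z) = ⇑(𝓕⁻ c : SchwartzMap E4 ℂ) := by
    funext x
    rw [SchwartzMap.fourierInv_coe, Real.fourierInv_eq_fourier_neg, ← SchwartzMap.fourier_coe,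
      hc, SchwartzMap.fourier_convolution]
    simp [key]
  rw [h1, ← SchwartzMap.fourier_coe]
  simp

theorem conv_le (F G : SchwartzMap E4 ℂ) (ζ : V) :
    ‖SchwartzMap.convolution (ContinuousLinearMap.mul ℂ ℂ) F G (Phi ζ)‖ₑ ≤
      ∫⁻ a : V, ENNReal.ofReal (‖F (Phi a)‖ * ‖G (Phi (ζ - a))‖) := by
  rw [SchwartzMap.convolution_apply]
  unfold MeasureTheory.convolution
  refine (enorm_integral_le_lintegral_enorm _).trans (le_of_eq ?_)
  have hm : Measurable fun η : E4 => ‖ContinuousLinearMap.mul ℂ ℂ (F η) (G (Phi ζ - η))‖ₑ := by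
    have h1 := F.continuous
    have h2 := G.continuous
    simp only [ContinuousLinearMap.mul_apply']
    exact (h1.mul (h2.comp (by fun_prop))).measurable.enorm
  rw [← Phi_mp.lintegral_comp hm]
  refine lintegral_congr fun a => ?_
  rw [Phi_sub, ContinuousLinearMap.mul_apply', ← norm_mul, ofReal_norm]

theorem final {s₀ s₁ s₂ b₁ b₂ : ℝ}
    (h : Bdd (KK (fun x y => ENNReal.ofReal (mul0 s₀ s₁ s₂ x y)) b₁ b₂)) :
    ∃ C : ℝ≥0∞, C ≠ ⊤ ∧ ∀ F G : SchwartzMap E4 ℂ,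
      NN (-s₀) 0 (SchwartzMap.convolution (ContinuousLinearMap.mul ℂ ℂ) F G) ≤
        C * NN s₁ b₁ F * NN s₂ b₂ G := by
  obtain ⟨C, hC, H⟩ := h
  refine ⟨C, hC, fun F G => ?_⟩
  let W : ℝ → ℝ → SchwartzMap E4 ℂ → V → ℝ := fun s b f a =>
    J (s / 2) ‖a.2‖ * (1 + (|a.1| - ‖a.2‖) ^ 2) ^ (b / 2) * ‖f (Phi a)‖
  have W0 : ∀ s b f a, 0 ≤ W s b f a := by
    intro s b f a
    have := J_pos (s / 2) ‖a.2‖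
    simp only [W]
    positivity
  have hW : ∀ s b f, Measurable fun a => ENNReal.ofReal (W s b f a) := by
    intro s b f
    have h1 : Measurable fun a => f (Phi a) := f.continuous.measurable.comp Phi_mp.measurable
    have h2 : Measurable fun a => ‖f (Phi a)‖ := h1.norm
    have h3 : Measurable fun a : V => (1 + ‖a.2‖ ^ 2) ^ (s / 2) *
        (1 + (|a.1| - ‖a.2‖) ^ 2) ^ (b / 2) := by fun_prop
    exact (h3.mul h2).ennreal_ofReal
  have hN : ∀ s b (f : SchwartzMap E4 ℂ), NN s b f = ∫⁻ a, ENNReal.ofReal (W s b f a) ^ 2 := by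
    intro s b f
    refine lintegral_congr fun a => ?_
    rw [← ENNReal.ofReal_pow (W0 _ _ _ _)]
    congr 1
    have q : (0:ℝ) < 1 + (|a.1| - ‖a.2‖) ^ 2 := by positivity
    simp only [W, mul_pow, wt, Phi_space, Phi_zero, J]
    rw [← Real.rpow_natCast (_ ^ (b / 2)), ← Real.rpow_natCast (_ ^ (s / 2)),
      ← Real.rpow_mul q.le, ← Real.rpow_mul (by positivity)]
    norm_num
  rw [hN s₁, hN s₂]
  refine le_trans (lintegral_mono fun ζ => ?_) (H _ _ (hW s₁ b₁ F) (hW s₂ b₂ G))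
  have e1 : ENNReal.ofReal (wt (-s₀) 0 (Phi ζ) *
      ‖SchwartzMap.convolution (ContinuousLinearMap.mul ℂ ℂ) F G (Phi ζ)‖ ^ 2) =
      (ENNReal.ofReal (J (-s₀ / 2) ‖ζ.2‖) *
        ‖SchwartzMap.convolution (ContinuousLinearMap.mul ℂ ℂ) F G (Phi ζ)‖ₑ) ^ 2 := by
    rw [← ofReal_norm, ← ENNReal.ofReal_mul (J_pos _ _).le,
      ← ENNReal.ofReal_pow (mul_nonneg (J_pos _ _).le (norm_nonneg _)), mul_pow]
    congr 2
    simp only [wt, Phi_space, Real.rpow_zero, mul_one, J]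
    have q : (0:ℝ) ≤ 1 + ‖ζ.2‖ ^ 2 := by positivity
    rw [← Real.rpow_natCast (_ ^ (-s₀ / 2)), ← Real.rpow_mul q]
    norm_num
  rw [e1]
  refine pow_le_pow_left' ?_ 2
  refine (mul_le_mul_right (conv_le F G ζ) _).trans ?_
  rw [← lintegral_const_mul' _ _ ENNReal.ofReal_ne_top]
  refine lintegral_mono fun a => le_of_eq ?_
  have p0 := J_pos (-s₀ / 2) ‖ζ.2‖
  have p1 := J_pos (-s₁ / 2) ‖a.2‖
  have p2 := J_pos (-s₂ / 2) ‖(ζ - a).2‖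
  have q1 : (0:ℝ) < 1 + (|a.1| - ‖a.2‖) ^ 2 := by positivity
  have q2 : (0:ℝ) < 1 + (|(ζ - a).1| - ‖(ζ - a).2‖) ^ 2 := by positivity
  have m0 := (mul0_pos s₀ s₁ s₂ a.2 (ζ - a).2).le
  simp only [KK, vw]
  rw [← ENNReal.ofReal_mul p0.le, ← ENNReal.ofReal_mul m0, ← ENNReal.ofReal_mul (by positivity),
    ← ENNReal.ofReal_mul (by positivity), ← ENNReal.ofReal_mul
      (mul_nonneg (by positivity) (W0 _ _ _ _))]
  congr 1
  have j1 : J (-s₁ / 2) ‖a.2‖ * J (s₁ / 2) ‖a.2‖ = 1 := by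
    rw [← J_add, show -s₁ / 2 + s₁ / 2 = 0 by ring]; simp [J]
  have j2 : J (-s₂ / 2) ‖(ζ - a).2‖ * J (s₂ / 2) ‖(ζ - a).2‖ = 1 := by
    rw [← J_add, show -s₂ / 2 + s₂ / 2 = 0 by ring]; simp [J]
  have k1 : (1 + (|a.1| - ‖a.2‖) ^ 2) ^ (-(b₁ / 2)) * (1 + (|a.1| - ‖a.2‖) ^ 2) ^ (b₁ / 2) = 1 := by
    rw [← Real.rpow_add q1]; simp
  have k2 : (1 + (|(ζ - a).1| - ‖(ζ - a).2‖) ^ 2) ^ (-(b₂ / 2)) *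
      (1 + (|(ζ - a).1| - ‖(ζ - a).2‖) ^ 2) ^ (b₂ / 2) = 1 := by
    rw [← Real.rpow_add q2]; simp
  have hz : a.2 + (ζ - a).2 = ζ.2 := by simp
  simp only [mul0, W, hz]
  symm
  set X := (1 + (|a.1| - ‖a.2‖) ^ 2)
  set Y := (1 + (|(ζ - a).1| - ‖(ζ - a).2‖) ^ 2)
  calc _ = J (-s₀ / 2) ‖ζ.2‖ * (‖F (Phi a)‖ * ‖G (Phi (ζ - a))‖) *
        (J (-s₁ / 2) ‖a.2‖ * J (s₁ / 2) ‖a.2‖) *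
        (J (-s₂ / 2) ‖(ζ - a).2‖ * J (s₂ / 2) ‖(ζ - a).2‖) *
        (X ^ (-(b₁ / 2)) * X ^ (b₁ / 2)) * (Y ^ (-(b₂ / 2)) * Y ^ (b₂ / 2)) := by ring
    _ = _ := by
      rw [j1, j2, k1, k2]
      ring

end WSP

/-- Product estimates in wave-Sobolev spaces on `ℝ^{1+3}`. -/
theorem product_wave_sobolev_estimate (s₀ s₁ s₂ b₁ b₂ : ℝ)
    (hb₁ : 1 / 2 < b₁) (hb₂ : 1 / 2 < b₂)
    (h416 : s₀ + s₁ + s₂ ≥ 2 - (b₁ + b₂))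
    (h417 : s₀ + s₁ + s₂ ≥ 3 / 2 - b₁)
    (h418 : s₀ + s₁ + s₂ ≥ 3 / 2 - b₂)
    (h419 : s₀ + s₁ + s₂ ≥ 1)
    (h420 : s₀ + 2 * (s₁ + s₂) ≥ 3 / 2)
    (h421 : s₁ + s₂ ≥ 0) (h422 : s₀ + s₂ ≥ 0) (h423 : s₀ + s₁ ≥ 0)
    (h420strict : (s₀ = 1 / 2 ∨ s₀ = 3 / 2 ∨ s₀ = 3 / 2 - 2 * b₁ ∨ s₀ = 3 / 2 - 2 * b₂ ∨
        s₀ = 5 / 2 - 2 * (b₁ + b₂)) → s₀ + 2 * (s₁ + s₂) > 3 / 2)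
    (hstrict : (s₀ + s₁ + s₂ = 2 - (b₁ + b₂) ∨ s₀ + s₁ + s₂ = 3 / 2 - b₁ ∨
        s₀ + s₁ + s₂ = 3 / 2 - b₂ ∨ s₀ + s₁ + s₂ = 1) →
        s₁ + s₂ > 0 ∧ s₀ + s₂ > 0 ∧ s₀ + s₁ > 0) :
    ∃ C > (0 : ℝ), ∀ f g : SchwartzMap (EuclideanSpace ℝ (Fin 4)) ℂ,
      waveSobolevNorm (-s₀) 0 (fun z => f z * g z) ≤
        C * waveSobolevNorm s₁ b₁ (⇑f) * waveSobolevNorm s₂ b₂ (⇑g) := by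
  have hM := WSP.main_bdd (s₀ := s₀) (s₁ := s₁) (s₂ := s₂) hb₁ hb₂ h419 h420 h421 h422 h423
    (fun h => h420strict (by tauto)) (fun h => hstrict (by tauto))
  obtain ⟨C, hC, H⟩ := WSP.final hM
  refine ⟨C.toReal ^ (1 / 2 : ℝ) + 1, by positivity, fun f g => ?_⟩
  rw [WSP.norm_eq _ _ _ _ (WSP.conv_eq f g),
    WSP.norm_eq s₁ b₁ (⇑f) (𝓕 f) (SchwartzMap.fourier_coe f).symm,
    WSP.norm_eq s₂ b₂ (⇑g) (𝓕 g) (SchwartzMap.fourier_coe g).symm]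
  have h1 := ENNReal.toReal_mono (ENNReal.mul_ne_top (ENNReal.mul_ne_top hC
    (WSP.NN_fin s₁ b₁ (𝓕 f))) (WSP.NN_fin s₂ b₂ (𝓕 g))) (H (𝓕 f) (𝓕 g))
  rw [ENNReal.toReal_mul, ENNReal.toReal_mul] at h1
  refine (Real.rpow_le_rpow ENNReal.toReal_nonneg h1 (by norm_num)).trans ?_
  rw [Real.mul_rpow (by positivity) ENNReal.toReal_nonneg,
    Real.mul_rpow ENNReal.toReal_nonneg ENNReal.toReal_nonneg]
  gcongr
  linarith
end
end
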